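/- If E is a vector bundle on P^m, then its slope μ(E) = deg(E)/rank(E) satisfies −(1/m) Σ_{i=1}^{m} R_i(E) ≤ μ(E) ≤ −(1/m) Σ_{i=1}^{m} r_i(E). -/

import Mathlib

open MvPolynomial Finset Module

noncomputable section

/-- The standard graded polynomial ring `S = K[x_1, …, x_n]`. -/
abbrev PolyS (K : Type) [Field K] (n : ℕ) : Type := MvPolynomial (Fin n) K

/-- The `K`-subspace of homogeneous polynomials of integer degree `z`
(it is `0` if `z < 0`). -/
def homogZ (K : Type) [Field K] (n : ℕ) (z : ℤ) : Submodule K (PolyS K n) :=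
  ⨆ (_ : 0 ≤ z), MvPolynomial.homogeneousSubmodule (Fin n) K z.toNat

/-- The degree-`ℓ` piece of the graded free module `⊕ₚ S(-dg p)`. -/
def freePiece {K : Type} [Field K] {n r : ℕ} (dg : Fin r → ℤ) (ℓ : ℤ) :
    Submodule K (Fin r → PolyS K n) :=
  Submodule.pi Set.univ fun p => homogZ K n (ℓ - dg p)

/-- A (homologically indexed) finite complex of graded free `S`-modules
`F₀ ← F₁ ← ⋯ ← F_len ← 0`, where `Fᵢ = ⊕ₚ S(-deg i p)` and the (degree `0`)
map `Fᵢ₊₁ → Fᵢ` is given by the matrix `dd i`, whose entries are homogeneous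
of the appropriate degrees. -/
structure FreeComplex (K : Type) [Field K] (n : ℕ) where
  len : ℕ
  rk : ℕ → ℕ
  deg : (i : ℕ) → Fin (rk i) → ℤ
  dd : (i : ℕ) → Matrix (Fin (rk i)) (Fin (rk (i+1))) (PolyS K n)
  rk_eq_zero : ∀ i, len < i → rk i = 0
  isHomog : ∀ i p q, dd i p q ∈ homogZ K n (deg (i+1) q - deg i p)
  isComplex : ∀ i, dd i * dd (i+1) = 0

variable {K : Type} [Field K] {n : ℕ}

/-- `F` is exact in positive homological degrees; that is, it is a graded free
resolution of the finitely generated graded module `M = coker (F₁ → F₀)`. -/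
def IsResolution (F : FreeComplex K n) : Prop :=
  ∀ i, LinearMap.ker ((F.dd i).mulVecLin) = LinearMap.range ((F.dd (i+1)).mulVecLin)

/-- The complex is minimal: entries of the differentials lie in the maximal ideal,
i.e. all (constant) entries between generators of equal degrees vanish. -/
def IsMinimal (F : FreeComplex K n) : Prop :=
  ∀ i p q, F.deg (i+1) q = F.deg i p → F.dd i p q = 0

/-- Betti number `β_{i,j}`: the number of generators of `Fᵢ` of degree `j`. -/
def bettiNum (F : FreeComplex K n) (i : ℕ) (j : ℤ) : ℕ :=
  (Finset.univ.filter fun p => F.deg i p = j).card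

/-- The dimension of the degree-`ℓ` piece of the module `M = coker (F₁ → F₀)`
resolved by `F`. -/
def MPieceDim (F : FreeComplex K n) (ℓ : ℤ) : ℕ :=
  finrank K ((freePiece (F.deg 0) ℓ) ⧸
    (Submodule.comap (freePiece (F.deg 0) ℓ).subtype
      ((LinearMap.range ((F.dd 0).mulVecLin)).restrictScalars K)))

/-- The Hilbert polynomial of the twisted free module `S(-a)` in `n` variables:
`binom (t - a + n - 1, n - 1)`. -/
def genHilb (n : ℕ) (a : ℤ) : Polynomial ℚ :=
  if n = 0 then 0 else
    Polynomial.C (((n - 1).factorial : ℚ))⁻¹ *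
      ∏ k ∈ Finset.range (n - 1),
        (Polynomial.X - Polynomial.C (a : ℚ) + Polynomial.C ((k : ℚ) + 1))

/-- The Hilbert polynomial of `M = coker (F₁ → F₀)`, computed from the free
resolution `F` by additivity. -/
def hilbPoly (F : FreeComplex K n) : Polynomial ℚ :=
  ∑ i ∈ Finset.range (F.len + 1),
    Polynomial.C ((-1 : ℚ) ^ i) * ∑ p : Fin (F.rk i), genHilb n (F.deg i p)

/-- The Krull dimension of a module read off from its Hilbert polynomial:
`0` for the zero polynomial (finite length), `deg + 1` otherwise. -/
def polyDim (P : Polynomial ℚ) : ℕ := if P = 0 then 0 else P.natDegree + 1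

/-- `M = coker (F₁ → F₀)` is a Cohen-Macaulay module of codimension `c`:
`F` is a minimal free resolution of length exactly `c` (so `pd M = c`, and by
Auslander–Buchsbaum `depth M = n - c`) and `dim M = n - c`. -/
def IsCMcodim (F : FreeComplex K n) (c : ℕ) : Prop :=
  IsResolution F ∧ IsMinimal F ∧ (∀ i, c < i → F.rk i = 0) ∧ F.rk c ≠ 0 ∧
    polyDim (hilbPoly F) = n - c

/-- The multiplicity `e(M)` of a module of codimension `c`, computed from the
Betti numbers of a free resolution:
`e(M) = ((-1)^c / c!) ⬝ Σ_{i,j} (-1)^i β_{i,j} j^c`. -/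
def multQ (F : FreeComplex K n) (c : ℕ) : ℚ :=
  ((-1 : ℚ) ^ c / c.factorial) *
    ∑ i ∈ Finset.range (F.len + 1),
      (-1 : ℚ) ^ i * ∑ p : Fin (F.rk i), ((F.deg i p : ℚ)) ^ c


/-- A (cohomologically indexed) finite complex of graded free `S`-modules
`0 → E⁰ → E¹ → ⋯ → E^len → 0`, where `Eⁱ = ⊕ₚ S(-deg i p)` and the (degree `0`)
map `Eⁱ → Eⁱ⁺¹` is given by the matrix `dd i`. -/
structure CoComplex (K : Type) [Field K] (n : ℕ) where
  len : ℕ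
  rk : ℕ → ℕ
  deg : (i : ℕ) → Fin (rk i) → ℤ
  dd : (i : ℕ) → Matrix (Fin (rk (i+1))) (Fin (rk i)) (PolyS K n)
  rk_eq_zero : ∀ i, len < i → rk i = 0
  isHomog : ∀ i p q, dd i p q ∈ homogZ K n (deg i q - deg (i+1) p)
  isComplex : ∀ i, dd (i+1) * dd i = 0

/-- The degree-`ℓ` part of the cocycles at cohomological position `i`. -/
def CoComplex.kerPiece (E : CoComplex K n) (i : ℕ) (ℓ : ℤ) :
    Submodule K (Fin (E.rk i) → PolyS K n) :=
  ((LinearMap.ker ((E.dd i).mulVecLin)).restrictScalars K) ⊓ freePiece (E.deg i) ℓ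

/-- The coboundaries at cohomological position `i` (as a `K`-subspace). -/
def CoComplex.imSub (E : CoComplex K n) : (i : ℕ) → Submodule K (Fin (E.rk i) → PolyS K n)
  | 0 => ⊥
  | (j+1) => (LinearMap.range ((E.dd j).mulVecLin)).restrictScalars K

/-- `dim_K (Hⁱ(E))_ℓ`, the dimension of the degree-`ℓ` component of the `i`-th
cohomology module of the complex `E`. -/
def cohomDim (E : CoComplex K n) (i : ℕ) (ℓ : ℤ) : ℕ :=
  finrank K ((E.kerPiece i ℓ) ⧸
    (Submodule.comap (E.kerPiece i ℓ).subtype (E.imSub i)))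

/-- The bilinear pairing `⟨F, E⟩ = Σ_{j ≤ i, k} (-1)^{i-j} β_{i,k}(F) ⬝ dim_K (H^j E)_{-k}`
of a free resolution `F` against a free cocomplex `E`. -/
def pairing (F : FreeComplex K n) (E : CoComplex K n) : ℤ :=
  ∑ i ∈ Finset.range (F.len + 1), ∑ j ∈ Finset.range (i + 1),
    (-1 : ℤ) ^ (i - j) * ∑ p : Fin (F.rk i), (cohomDim E j (-(F.deg i p)) : ℤ)

/-- The modified pairing `⟨F, E⟩_{c,τ}`: terms with `j ≤ i` are kept when `j < τ`
or `j ≤ i - 2`, and the terms with `j = τ`, `i = τ + ε` (`ε ∈ {0,1}`) are kept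
only when the degree `k` of the generator satisfies `k ≤ c + ε`. -/
def pairingMod (F : FreeComplex K n) (E : CoComplex K n) (c : ℤ) (τ : ℕ) : ℤ :=
  (∑ i ∈ Finset.range (F.len + 1), ∑ j ∈ Finset.range (i + 1),
    if j < τ ∨ j + 2 ≤ i then
      (-1 : ℤ) ^ (i - j) * ∑ p : Fin (F.rk i), (cohomDim E j (-(F.deg i p)) : ℤ)
    else 0) +
  ∑ ε ∈ Finset.range 2,
    (-1 : ℤ) ^ ε * ∑ p ∈ Finset.univ.filter (fun p => F.deg (τ + ε) p ≤ c + ε),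
      (cohomDim E τ (-(F.deg (τ + ε) p)) : ℤ)

/-- The dual cocomplex `Hom(F, S)`: `0 → F₀^∨ → F₁^∨ → ⋯`. Its `j`-th cohomology
is `Ext^j_S(M, S)` for the module `M` resolved by `F`. -/
def dualCo (F : FreeComplex K n) : CoComplex K n where
  len := F.len
  rk := F.rk
  deg := fun i p => -F.deg i p
  dd := fun i => (F.dd i).transpose
  rk_eq_zero := F.rk_eq_zero
  isHomog := by
    intro i p q
    have h := F.isHomog i q p
    rw [neg_sub_neg]
    exact h
  isComplex := by
    intro i
    rw [← Matrix.transpose_mul, F.isComplex i, Matrix.transpose_zero]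

/-- `dim_K Ext^j_S(M, S)_e`, where `M = coker (F₁ → F₀)` (zero for `j < 0`). -/
def extDim (F : FreeComplex K n) (j : ℤ) (e : ℤ) : ℕ :=
  if 0 ≤ j then cohomDim (dualCo F) j.toNat e else 0

/-- `h^i(𝓔(d)) = dim_K H^i(ℙ^{n-1}, 𝓔(d))` for the coherent sheaf `𝓔 = M~` on
`ℙ^{n-1}` associated to the module `M = coker (F₁ → F₀)` resolved by `F`,
expressed via graded local duality:
`h^i(𝓔(d)) = dim Ext^{n-1-i}(M,S)_{-d-n}` for `i ≥ 1`, and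
`h^0(𝓔(d)) = dim M_d - dim Ext^{n}(M,S)_{-d-n} + dim Ext^{n-1}(M,S)_{-d-n}`. -/
def sheafH (F : FreeComplex K n) (i : ℕ) (d : ℤ) : ℕ :=
  if i = 0 then
    MPieceDim F d - extDim F (n : ℤ) (-d - n) + extDim F ((n : ℤ) - 1) (-d - n)
  else extDim F ((n : ℤ) - 1 - i) (-d - n)

/-- The ideal generated by the `s × s` minors of a matrix. -/
def minorsIdeal {a b : ℕ} (M : Matrix (Fin a) (Fin b) (PolyS K n)) (s : ℕ) :
    Ideal (PolyS K n) :=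
  Ideal.span (Set.range fun fg : (Fin s ↪ Fin a) × (Fin s ↪ Fin b) =>
    (M.submatrix fg.1 fg.2).det)

/-- The `r`-th Fitting ideal of `M = coker (F₁ → F₀)`: the ideal of
`(rk F₀ - r)`-minors of the presentation matrix. -/
def fittingIdeal (F : FreeComplex K n) (r : ℤ) : Ideal (PolyS K n) :=
  if (F.rk 0 : ℤ) - r ≤ 0 then ⊤ else minorsIdeal (F.dd 0) ((F.rk 0 : ℤ) - r).toNat

/-- The irrelevant maximal ideal `(x_1, …, x_n)` of `S`. -/
def irrel (K : Type) [Field K] (n : ℕ) : Ideal (PolyS K n) :=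
  Ideal.span (Set.range (MvPolynomial.X : Fin n → PolyS K n))

/-- The coherent sheaf `M~` on `ℙ^{n-1}` associated to `M = coker (F₁ → F₀)` is a
locally free sheaf (vector bundle) of rank `r`: the Fitting ideal `Fitt_{r-1}(M)`
is zero and `Fitt_r(M)` contains a power of the irrelevant ideal. -/
def IsVectorBundle (F : FreeComplex K n) (r : ℕ) : Prop :=
  fittingIdeal F ((r : ℤ) - 1) = ⊥ ∧ ∃ N : ℕ, (irrel K n) ^ N ≤ fittingIdeal F r

/-- The rank of a sheaf of dimension `s`: the normalized leading coefficient of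
its Hilbert polynomial, `χ(𝓔(d)) = (rank 𝓔 / s!) d^s + O(d^{s-1})`. -/
def sheafRank (F : FreeComplex K n) (s : ℕ) : ℚ :=
  (s.factorial : ℚ) * (hilbPoly F).coeff s

/-- The sheaf `M~` has natural cohomology: for each `d` at most one `h^i(𝓔(d))`
is nonzero. -/
def HasNaturalCohomology (F : FreeComplex K n) : Prop :=
  ∀ (d : ℤ) (i i' : ℕ), sheafH F i d ≠ 0 → sheafH F i' d ≠ 0 → i = i'

/-- The sheaf `𝓔 = M~` (of dimension `s`) has supernatural cohomology with root
sequence `z_1 > ⋯ > z_s`: it has natural cohomology and its Hilbert polynomial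
`d ↦ χ(𝓔(d))` has the distinct integral roots `z_1 > ⋯ > z_s`. -/
def IsSupernaturalWithRoots (F : FreeComplex K n) {s : ℕ} (z : Fin s → ℤ) : Prop :=
  StrictAnti z ∧ HasNaturalCohomology F ∧
    ∃ a : ℚ, a ≠ 0 ∧
      hilbPoly F = Polynomial.C a * ∏ i : Fin s, (Polynomial.X - Polynomial.C ((z i : ℚ)))


/-- The degree of a sheaf `𝓔` on `ℙ^m`, defined by
`χ(𝓔(t)) = rank(𝓔)·binom(t+m, m) + deg(𝓔)·binom(t+m-1, m-1) + O(t^{m-2})`. -/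
def sheafDeg (m : ℕ) (F : FreeComplex K (m + 1)) : ℚ :=
  ((m - 1).factorial : ℚ) *
    ((hilbPoly F) - Polynomial.C (sheafRank F m) * genHilb (m + 1) 0).coeff (m - 1)

set_option linter.all false

namespace SB

/-- A cochain complex of vector spaces, indexed by the integers. -/
structure Cpx (K : Type) [Field K] where
  V : ℤ → Type
  [acg : ∀ j, AddCommGroup (V j)]
  [mod : ∀ j, Module K (V j)]
  d : ∀ j, V j →ₗ[K] V (j+1)
  dd : ∀ j v, d (j+1) (d j v) = 0

attribute [instance] Cpx.acg Cpx.mod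

variable {K : Type} [Field K]

/-- `H^{j+1}(A) = 0`. -/
def Z (A : Cpx K) (j : ℤ) : Prop := ∀ v : A.V (j+1), A.d (j+1) v = 0 → ∃ w, A.d j w = v

structure Hom (A B : Cpx K) where
  f : ∀ j, A.V j →ₗ[K] B.V j
  comm : ∀ j v, f (j+1) (A.d j v) = B.d j (f j v)

def Hom.id (A : Cpx K) : Hom A A := ⟨fun _ => LinearMap.id, fun _ _ => rfl⟩

def Hom.comp {A B C : Cpx K} (g : Hom B C) (f : Hom A B) : Hom A C :=
  ⟨fun j => g.f j ∘ₗ f.f j, fun j v => by simp [f.comm, g.comm]⟩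

/-- Cohomology at position `j+1`. -/
abbrev Hm (A : Cpx K) (j : ℤ) : Type :=
  LinearMap.ker (A.d (j+1)) ⧸ (LinearMap.range (A.d j)).comap (LinearMap.ker (A.d (j+1))).subtype

def hmk (A : Cpx K) (j : ℤ) : LinearMap.ker (A.d (j+1)) →ₗ[K] Hm A j := Submodule.mkQ _

/-- Class of a cocycle. -/
def hc (A : Cpx K) (j : ℤ) (v : A.V (j+1)) (hv : A.d (j+1) v = 0) : Hm A j :=
  hmk A j ⟨v, LinearMap.mem_ker.2 hv⟩

lemma hmk_surj (A : Cpx K) (j : ℤ) (x : Hm A j) : ∃ v, ∃ hv : A.d (j+1) v = 0,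
    hc A j v hv = x := by
  obtain ⟨⟨v, hv⟩, rfl⟩ := Submodule.mkQ_surjective _ x
  exact ⟨v, hv, rfl⟩

lemma hc_eq_zero (A : Cpx K) (j : ℤ) (v hv) :
    hc A j v hv = 0 ↔ ∃ w, A.d j w = v := by
  unfold hc hmk
  rw [← LinearMap.mem_ker, Submodule.ker_mkQ]
  rfl

lemma hc_eq (A : Cpx K) (j : ℤ) (v hv) (v' hv') :
    hc A j v hv = hc A j v' hv' ↔ ∃ w, A.d j w = v - v' := by
  rw [← sub_eq_zero]
  exact hc_eq_zero A j (v - v') (by rw [map_sub, hv, hv', sub_zero])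

/-- Lift of a map of cycles. -/
def hlift {A B : Cpx K} {i j : ℤ} (φ : A.V (i+1) →ₗ[K] B.V (j+1))
    (h1 : ∀ v, A.d (i+1) v = 0 → B.d (j+1) (φ v) = 0)
    (h2 : ∀ w, ∃ w', B.d j w' = φ (A.d i w)) : Hm A i →ₗ[K] Hm B j :=
  Submodule.mapQ _ _ (φ.restrict (p := LinearMap.ker (A.d (i+1))) (q := LinearMap.ker (B.d (j+1))) h1)
    (by
      rintro ⟨x, hx⟩ ⟨w, hw⟩
      obtain ⟨w', hw'⟩ := h2 w
      refine ⟨w', ?_⟩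
      rw [hw', hw]; rfl)

@[simp] lemma hlift_mk {A B : Cpx K} {i j : ℤ} (φ : A.V (i+1) →ₗ[K] B.V (j+1)) (h1) (h2) (v) (hv) :
    hlift (A := A) (B := B) φ h1 h2 (hc A i v hv) = hc B j (φ v) (h1 v hv) := rfl

def hmap {A B : Cpx K} (f : Hom A B) (j : ℤ) : Hm A j →ₗ[K] Hm B j :=
  hlift (f.f (j+1)) (fun v hv => by rw [← f.comm, hv, map_zero])
    (fun w => ⟨f.f j w, (f.comm j w).symm⟩)

lemma hmap_hc {A B : Cpx K} (f : Hom A B) (j : ℤ) (v) (hv : A.d (j+1) v = 0) :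
    hmap f j (hc A j v hv) = hc B j (f.f _ v) (by rw [← f.comm, hv, map_zero]) := rfl

lemma Z_iff (A : Cpx K) (j : ℤ) : Z A j ↔ ∀ x : Hm A j, x = 0 := by
  constructor
  · intro h x
    obtain ⟨v, hv, rfl⟩ := hmk_surj A j x
    exact (hc_eq_zero _ _ _ _).2 (h v hv)
  · intro h v hv
    exact (hc_eq_zero A j v hv).1 (h _)

structure SES {A B C : Cpx K} (f : Hom A B) (g : Hom B C) : Prop where
  inj : ∀ j v, f.f j v = 0 → v = 0
  surj : ∀ j v, ∃ w, g.f j w = v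
  zero : ∀ j v, g.f j (f.f j v) = 0
  exact : ∀ j v, g.f j v = 0 → ∃ w, f.f j w = v

section LES
variable {A B C : Cpx K} {f : Hom A B} {g : Hom B C}

lemma SES.split (h : SES f g) (j : ℤ) : ∃ (s : C.V j →ₗ[K] B.V j) (r : B.V j →ₗ[K] A.V j),
    (∀ c, g.f j (s c) = c) ∧ (∀ b, f.f j (r b) = b - s (g.f j b)) := by
  obtain ⟨s, hs⟩ := (g.f j).exists_rightInverse_of_surjective
    (LinearMap.range_eq_top.2 (h.surj j))
  obtain ⟨r, hr⟩ := (f.f j).exists_leftInverse_of_injective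
    (LinearMap.ker_eq_bot'.2 (h.inj j))
  have hs' : ∀ c, g.f j (s c) = c := fun c => LinearMap.congr_fun hs c
  have hr' : ∀ c, r (f.f j c) = c := fun c => LinearMap.congr_fun hr c
  refine ⟨s, r ∘ₗ (LinearMap.id - s ∘ₗ g.f j), hs', fun b => ?_⟩
  obtain ⟨w, hw⟩ := h.exact j (b - s (g.f j b)) (by simp [hs'])
  simp only [LinearMap.comp_apply, LinearMap.sub_apply, LinearMap.id_apply]
  rw [← hw, hr']

lemma LES (h : SES f g) (j : ℤ) : ∃ δ : Hm C j →ₗ[K] Hm A (j+1),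
    (∀ x, hmap g j x = 0 → ∃ y, hmap f j y = x) ∧ (∀ x, hmap g j (hmap f j x) = 0) ∧
    (∀ x, δ x = 0 → ∃ y, hmap g j y = x) ∧ (∀ x, δ (hmap g j x) = 0) ∧
    (∀ x, hmap f (j+1) x = 0 → ∃ y, δ y = x) ∧ (∀ x, hmap f (j+1) (δ x) = 0) := by
  obtain ⟨s, r0, hs, hr0⟩ := h.split (j+1)
  obtain ⟨s', r, hs', hr⟩ := h.split (j+1+1)
  have key : ∀ c, C.d (j+1) c = 0 → f.f _ (r (B.d (j+1) (s c))) = B.d (j+1) (s c) := by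
    intro c hc
    rw [hr, g.comm, hs, hc, map_zero, sub_zero]
  have finj : ∀ j a b, f.f j a = f.f j b → a = b := fun j a b e =>
    sub_eq_zero.1 (h.inj j _ (by rw [map_sub, e, sub_self]))
  let δ : Hm C j →ₗ[K] Hm A (j+1) := hlift (r ∘ₗ B.d (j+1) ∘ₗ s)
    (fun v hv => by
      apply h.inj
      rw [f.comm]
      simp only [LinearMap.comp_apply]
      rw [key v hv, B.dd])
    (fun w => by
      obtain ⟨b, rfl⟩ := h.surj j w
      obtain ⟨a, ha⟩ := h.exact (j+1) (s (C.d j (g.f j b)) - B.d j b)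
        (by rw [map_sub, hs, g.comm, sub_self])
      refine ⟨a, finj _ _ _ ?_⟩
      rw [f.comm, ha]
      simp only [LinearMap.comp_apply]
      rw [key _ (C.dd _ _), map_sub, B.dd, sub_zero])
  have δmk : ∀ v hv, δ (hc C j v hv) = hc A (j+1) (r (B.d (j+1) (s v))) _ :=
    fun v hv => hlift_mk _ _ _ _ _
  refine ⟨δ, ?_, ?_, ?_, ?_, ?_, ?_⟩
  · intro x hx
    obtain ⟨v, hv, rfl⟩ := hmk_surj B j x
    rw [hmap_hc] at hx
    obtain ⟨w, hw⟩ := (hc_eq_zero _ _ _ _).1 hx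
    obtain ⟨b, rfl⟩ := h.surj j w
    obtain ⟨a, ha⟩ := h.exact (j+1) (v - B.d j b) (by
      rw [map_sub, sub_eq_zero, g.comm]; exact hw.symm)
    have ha0 : A.d (j+1) a = 0 := h.inj _ _ (by rw [f.comm, ha, map_sub, hv, B.dd, sub_zero])
    refine ⟨hc A j a ha0, ?_⟩
    rw [hmap_hc, hc_eq]
    exact ⟨-b, by simp [ha]⟩
  · intro x
    obtain ⟨v, hv, rfl⟩ := hmk_surj A j x
    rw [hmap_hc, hmap_hc, hc_eq_zero]
    exact ⟨0, by rw [map_zero, h.zero]⟩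
  · intro x hx
    obtain ⟨v, hv, rfl⟩ := hmk_surj C j x
    rw [δmk, hc_eq_zero] at hx
    obtain ⟨a, ha⟩ := hx
    have hb : B.d (j+1) (s v - f.f _ a) = 0 := by
      rw [map_sub, ← f.comm, ha, key v hv, sub_self]
    refine ⟨hc B j _ hb, ?_⟩
    rw [hmap_hc, hc_eq]
    exact ⟨0, by simp [hs, h.zero]⟩
  · intro x
    obtain ⟨v, hv, rfl⟩ := hmk_surj B j x
    rw [hmap_hc, δmk, hc_eq_zero]
    obtain ⟨a, ha⟩ := h.exact (j+1) (s (g.f _ v) - v) (by rw [map_sub, hs, sub_self])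
    refine ⟨a, finj _ _ _ ?_⟩
    rw [f.comm, ha, key _ (by rw [← g.comm, hv, map_zero]), map_sub, hv, sub_zero]
  · intro x hx
    obtain ⟨v, hv, rfl⟩ := hmk_surj A _ x
    rw [hmap_hc, hc_eq_zero] at hx
    obtain ⟨b, hb⟩ := hx
    have hcc : C.d (j+1) (g.f _ b) = 0 := by rw [← g.comm, hb, h.zero]
    refine ⟨hc C j (g.f _ b) hcc, ?_⟩
    rw [δmk, hc_eq]
    obtain ⟨a, ha⟩ := h.exact (j+1) (s (g.f _ b) - b) (by rw [map_sub, hs, sub_self])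
    refine ⟨a, finj _ _ _ ?_⟩
    rw [f.comm, ha, map_sub, map_sub, key _ hcc, hb]
  · intro x
    obtain ⟨v, hv, rfl⟩ := hmk_surj C j x
    rw [δmk, hmap_hc, hc_eq_zero]
    exact ⟨s v, (key v hv).symm⟩

end LES

section Lin
variable {X Y W : Type} [AddCommGroup X] [Module K X] [AddCommGroup Y] [Module K Y]
  [AddCommGroup W] [Module K W]

lemma fin_mid (f : X →ₗ[K] Y) (g : Y →ₗ[K] W) (h : ∀ x, g x = 0 → ∃ y, f y = x)
    [FiniteDimensional K X] [FiniteDimensional K W] : FiniteDimensional K Y := by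
  have h1 : (LinearMap.ker g).FG := by
    have : LinearMap.ker g ≤ LinearMap.range f := fun x hx => h x hx
    have h2 : FiniteDimensional K (LinearMap.range f) := inferInstance
    exact (Submodule.fg_iff_finiteDimensional _).2 (Submodule.finiteDimensional_of_le this)
  have h2 : (Submodule.map g ⊤).FG := by
    exact (Submodule.fg_iff_finiteDimensional _).2 inferInstance
  exact ⟨Submodule.fg_of_fg_map_of_fg_inf_ker g h2 (by simpa using h1)⟩

lemma zero_mid (f : X →ₗ[K] Y) (g : Y →ₗ[K] W) (h : ∀ x, g x = 0 → ∃ y, f y = x)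
    (hX : ∀ x : X, x = 0) (hW : ∀ x : W, x = 0) (y : Y) : y = 0 := by
  obtain ⟨x, rfl⟩ := h y (hW _)
  rw [hX x, map_zero]
lemma ex_rank (f : X →ₗ[K] Y) (g : Y →ₗ[K] W) (h : ∀ x, g x = 0 → ∃ y, f y = x)
    (h' : ∀ x, g (f x) = 0) :
    finrank K (LinearMap.ker g) = finrank K (LinearMap.range f) := by
  have : LinearMap.ker g = LinearMap.range f :=
    le_antisymm (fun x hx => h x hx) (by rintro _ ⟨x, rfl⟩; exact h' x)
  rw [this]

lemma rk_nul (f : X →ₗ[K] Y) [FiniteDimensional K X] :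
    finrank K (LinearMap.range f) + finrank K (LinearMap.ker f) = finrank K X :=
  LinearMap.finrank_range_add_finrank_ker f
end Lin

/-- Dimension of `H^{j+1}`. -/
def hd (A : Cpx K) (j : ℤ) : ℕ := finrank K (Hm A j)

/-- Finite total cohomology. -/
structure FH (A : Cpx K) : Prop where
  fin : ∀ j, FiniteDimensional K (Hm A j)
  supp : {j | hd A j ≠ 0}.Finite

lemma Z_of_hd {A : Cpx K} {j : ℤ} (h : FiniteDimensional K (Hm A j)) : Z A j ↔ hd A j = 0 := by
  rw [Z_iff]
  unfold hd
  rw [Module.finrank_zero_iff]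
  exact ⟨fun h => ⟨fun a b => by rw [h a, h b]⟩, fun h x => Subsingleton.elim _ _⟩

lemma hd_of_Z {A : Cpx K} {j : ℤ} (h : Z A j) : hd A j = 0 := by
  rw [Z_iff] at h
  have : Subsingleton (Hm A j) := ⟨fun a b => by rw [h a, h b]⟩
  exact Module.finrank_zero_of_subsingleton

section LES2
variable {A B C : Cpx K} {f : Hom A B} {g : Hom B C}

lemma SES.Z_mid (h : SES f g) (j : ℤ) (hA : Z A j) (hC : Z C j) : Z B j := by
  rw [Z_iff] at *
  obtain ⟨δ, h1, -⟩ := LES h j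
  exact zero_mid _ _ h1 hA hC

lemma SES.Z_right (h : SES f g) (j : ℤ) (hB : Z B j) (hA : Z A (j+1)) : Z C j := by
  rw [Z_iff] at *
  obtain ⟨δ, -, -, h1, -⟩ := LES h j
  exact zero_mid _ _ h1 hB hA

lemma SES.Z_left (h : SES f g) (j : ℤ) (hC : Z C j) (hB : Z B (j+1)) : Z A (j+1) := by
  rw [Z_iff] at *
  obtain ⟨δ, -, -, -, -, h1, -⟩ := LES h j
  exact zero_mid _ _ h1 hC hB

lemma SES.fin_mid (h : SES f g) (j : ℤ) (hA : FiniteDimensional K (Hm A j))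
    (hC : FiniteDimensional K (Hm C j)) : FiniteDimensional K (Hm B j) := by
  obtain ⟨δ, h1, -⟩ := LES h j
  exact SB.fin_mid _ _ h1

lemma SES.fin_right (h : SES f g) (j : ℤ) (hB : FiniteDimensional K (Hm B j))
    (hA : FiniteDimensional K (Hm A (j+1))) : FiniteDimensional K (Hm C j) := by
  obtain ⟨δ, -, -, h1, -⟩ := LES h j
  exact SB.fin_mid _ _ h1

lemma SES.fin_left (h : SES f g) (j : ℤ) (hC : FiniteDimensional K (Hm C j))
    (hB : FiniteDimensional K (Hm B (j+1))) : FiniteDimensional K (Hm A (j+1)) := by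
  obtain ⟨δ, -, -, -, -, h1, -⟩ := LES h j
  exact SB.fin_mid _ _ h1

lemma Z_of_notmem {A : Cpx K} (hA : FH A) {j : ℤ} (h : j ∉ {j | hd A j ≠ 0}) : Z A j :=
  (Z_of_hd (hA.fin j)).2 (by simpa using h)

lemma FH.of_ex {A : Cpx K} (S : Set ℤ) (hS : S.Finite) (h1 : ∀ j, FiniteDimensional K (Hm A j))
    (h2 : ∀ j ∉ S, Z A j) : FH A :=
  ⟨h1, hS.subset fun j hj => by
    by_contra hc; exact hj (hd_of_Z (h2 j hc))⟩

lemma FH_mid (h : SES f g) (hA : FH A) (hC : FH C) : FH B :=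
  FH.of_ex _ (hA.supp.union hC.supp) (fun j => h.fin_mid j (hA.fin j) (hC.fin j))
    (fun j hj => h.Z_mid j (Z_of_notmem hA fun hh => hj (Or.inl hh))
      (Z_of_notmem hC fun hh => hj (Or.inr hh)))

lemma FH_right (h : SES f g) (hA : FH A) (hB : FH B) : FH C := by
  refine FH.of_ex _ (hB.supp.union (hA.supp.preimage (f := fun j => j + 1)
      (fun a _ b _ hab => by simpa using hab)))
    (fun j => ?_) (fun j hj => ?_)
  · exact h.fin_right j (hB.fin j) (hA.fin (j+1))
  · exact h.Z_right j (Z_of_notmem hB fun hh => hj (Or.inl hh))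
      (Z_of_notmem hA fun hh => hj (Or.inr hh))

lemma FH_left (h : SES f g) (hB : FH B) (hC : FH C) : FH A := by
  refine FH.of_ex _ (hB.supp.union (hC.supp.preimage (f := fun j => j - 1)
      (fun a _ b _ hab => by simpa using hab)))
    (fun j => ?_)
    (fun j hj => ?_)
  · obtain ⟨j, rfl⟩ : ∃ i, j = i + 1 := ⟨j - 1, by ring⟩
    exact h.fin_left j (hC.fin j) (hB.fin (j+1))
  · obtain ⟨j, rfl⟩ : ∃ i, j = i + 1 := ⟨j - 1, by ring⟩
    exact h.Z_left j (Z_of_notmem hC fun hh => hj (Or.inr (by simpa using hh)))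
      (Z_of_notmem hB fun hh => hj (Or.inl hh))

def sg (j : ℤ) : ℤ := (j.negOnePow : ℤ)

lemma sg_succ (j : ℤ) : sg (j+1) = - sg j := by simp [sg, Int.negOnePow_succ]

/-- The numerical content of the long exact sequence. -/
lemma hd_numbers (h : SES f g) (hA : ∀ j, FiniteDimensional K (Hm A j))
    (hC : ∀ j, FiniteDimensional K (Hm C j)) :
    ∃ k : ℤ → ℕ, (∀ j, k j ≤ hd A j) ∧ (∀ j, k (j+1) ≤ hd C j) ∧
      ∀ j, hd B j + k j + k (j+1) = hd A j + hd C j := by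
  have hB : ∀ j, FiniteDimensional K (Hm B j) := fun j => h.fin_mid j (hA j) (hC j)
  have hh : ∀ j, ∃ x : ℕ, x ≤ hd C j ∧ x = finrank K (LinearMap.ker (hmap f (j+1))) ∧
      hd B j + finrank K (LinearMap.ker (hmap f j)) + x = hd A j + hd C j := by
    intro j
    obtain ⟨δ, h1, h2, h3, h4, h5, h6⟩ := LES h j
    have e1 := ex_rank _ _ h1 h2
    have e2 := ex_rank _ _ h3 h4
    have e3 := ex_rank _ _ h5 h6
    have r1 := rk_nul (hmap f j)
    have r2 := rk_nul (hmap g j)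
    have r3 := rk_nul δ
    refine ⟨_, ?_, e3.symm, ?_⟩
    · unfold hd; omega
    · unfold hd; omega
  refine ⟨fun j => finrank K (LinearMap.ker (hmap f j)), fun j => ?_, fun j => ?_, fun j => ?_⟩
  · have := rk_nul (hmap f j)
    unfold hd; dsimp only; omega
  · obtain ⟨x, h1, h2, h3⟩ := hh j
    dsimp only
    omega
  · obtain ⟨x, h1, h2, h3⟩ := hh j
    dsimp only
    omega

def chi (A : Cpx K) : ℤ := ∑ᶠ j, sg j * (hd A j : ℤ)

lemma FH.supp' (hA : FH A) : (Function.support fun j => sg j * (hd A j : ℤ)).Finite :=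
  hA.supp.subset fun j hj => by
    intro h0
    simp [h0] at hj

lemma chi_add (h : SES f g) (hA : FH A) (hC : FH C) : chi B = chi A + chi C := by
  have hB := FH_mid h hA hC
  obtain ⟨k, hk1, hk2, hk⟩ := hd_numbers h hA.fin hC.fin
  have fk : (Function.support fun j => sg j * (k j : ℤ)).Finite :=
    hA.supp.subset fun j hj => by
      intro h0
      have := hk1 j
      have h1 : k j = 0 := by omega
      simp [h1] at hj
  have fk' : (Function.support fun j => sg j * (k (j+1) : ℤ)).Finite :=
    hC.supp.subset fun j hj => by
      intro h0
      have := hk2 j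
      have h1 : k (j+1) = 0 := by omega
      simp [h1] at hj
  have e1 : ∑ᶠ j, (sg j * (hd B j : ℤ) + (sg j * (k j : ℤ) + sg j * (k (j+1) : ℤ)))
      = ∑ᶠ j, (sg j * (hd A j : ℤ) + sg j * (hd C j : ℤ)) := by
    apply finsum_congr
    intro j
    have := hk j
    rw [← mul_add, ← mul_add, ← mul_add]
    congr 1
    exact_mod_cast by omega
  rw [finsum_add_distrib hB.supp' ((fk.union fk').subset (Function.support_add _ _)),
    finsum_add_distrib fk fk', finsum_add_distrib hA.supp' hC.supp'] at e1
  have e2 : ∑ᶠ j, sg j * (k j : ℤ) = ∑ᶠ j, sg (j+1) * (k (j+1) : ℤ) :=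
    (finsum_comp_equiv (f := fun j => sg j * (k j : ℤ)) (Equiv.addRight (1:ℤ))).symm
  have e3 : ∑ᶠ j, sg (j+1) * (k (j+1) : ℤ) = - ∑ᶠ j, sg j * (k (j+1) : ℤ) := by
    rw [← finsum_neg_distrib]
    exact finsum_congr fun j => by rw [sg_succ]; ring
  unfold chi
  rw [e2, e3] at e1
  linarith

end LES2

/-! Shift and cone. -/

abbrev shift (A : Cpx K) : Cpx K where
  V j := A.V (j+1)
  d j := - A.d (j+1)
  dd j v := by simp [A.dd]

lemma shift_d (A : Cpx K) (j : ℤ) (v : A.V (j+1)) :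
    (shift A).d j v = (- (A.d (j+1) v) : A.V (j+1+1)) := rfl

lemma shift_d0 (A : Cpx K) (j : ℤ) (v : A.V (j+1)) :
    (shift A).d j v = 0 ↔ A.d (j+1) v = 0 := neg_eq_zero

lemma shift_dn (A : Cpx K) (j : ℤ) (v : A.V (j+1)) :
    (shift A).d j (-v : A.V (j+1)) = A.d (j+1) v := by
  rw [shift_d, map_neg, neg_neg]

lemma Z_shift {A : Cpx K} {j : ℤ} : Z (shift A) j ↔ Z A (j+1) := by
  constructor
  · intro h v hv
    obtain ⟨w, hw⟩ := h v ((shift_d0 A (j+1) v).2 hv)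
    exact ⟨(-w : A.V (j+1)), (map_neg (A.d (j+1)) w).trans hw⟩
  · intro h v hv
    obtain ⟨w, hw⟩ := h v ((shift_d0 A (j+1) v).1 hv)
    exact ⟨(-w : A.V (j+1)), (shift_dn A j w).trans hw⟩

/-- An isomorphism on cohomology (across an index shift). -/
lemma hd_shift (A : Cpx K) (j : ℤ) :
    ∃ φ : Hm (shift A) j ≃ₗ[K] Hm A (j+1), True := by
  let φ : Hm (shift A) j →ₗ[K] Hm A (j+1) := hlift (A := shift A) (B := A) LinearMap.id
    (fun v hv => (shift_d0 A (j+1) v).1 hv) (fun w => ⟨(-w : A.V (j+1)), map_neg (A.d (j+1)) w⟩)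
  have hφ : ∀ v hv, φ (hc (shift A) j v hv) = hc A (j+1) v ((shift_d0 A (j+1) v).1 hv) :=
    fun v hv => rfl
  refine ⟨LinearEquiv.ofBijective φ ⟨?_, ?_⟩, trivial⟩
  · rw [← LinearMap.ker_eq_bot, LinearMap.ker_eq_bot']
    intro x hx
    obtain ⟨v, hv, rfl⟩ := hmk_surj _ _ x
    rw [hφ] at hx
    obtain ⟨w, hw⟩ := (hc_eq_zero _ _ _ _).1 hx
    exact (hc_eq_zero _ _ _ _).2 ⟨(-w : A.V (j+1)), (shift_dn A j w).trans hw⟩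
  · intro x
    obtain ⟨v, hv, rfl⟩ := hmk_surj _ _ x
    exact ⟨hc (shift A) j v ((shift_d0 A (j+1) v).2 hv), rfl⟩

lemma FH_shift {A : Cpx K} (h : FH A) : FH (shift A) := by
  refine FH.of_ex _ (h.supp.preimage (f := fun j => j + 1)
      (fun a _ b _ hab => by simpa using hab)) (fun j => ?_) (fun j hj => ?_)
  · obtain ⟨φ, -⟩ := hd_shift A j
    have := h.fin (j+1)
    exact Module.Finite.equiv φ.symm
  · rw [Z_shift]
    exact Z_of_notmem h hj

lemma hd_shift_eq (A : Cpx K) (j : ℤ) : hd (shift A) j = hd A (j+1) := by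
  obtain ⟨φ, -⟩ := hd_shift A j
  exact φ.finrank_eq

lemma FH_of_shift {A : Cpx K} (h : FH (shift A)) : FH A := by
  refine FH.of_ex _ (h.supp.preimage (f := fun j => j - 1)
      (fun a _ b _ hab => by simpa using hab)) (fun j => ?_) (fun j hj => ?_)
  · obtain ⟨j, rfl⟩ : ∃ i, j = i + 1 := ⟨j - 1, by ring⟩
    obtain ⟨φ, -⟩ := hd_shift A j
    have := h.fin j
    exact Module.Finite.equiv φ
  · obtain ⟨j, rfl⟩ : ∃ i, j = i + 1 := ⟨j - 1, by ring⟩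
    rw [← Z_shift]
    exact Z_of_notmem h (by simpa using hj)

lemma chi_shift (A : Cpx K) : chi (shift A) = - chi A := by
  unfold chi
  rw [← finsum_comp_equiv (f := fun j => sg j * (hd A j : ℤ)) (Equiv.addRight (1:ℤ)),
    ← finsum_neg_distrib]
  refine finsum_congr fun j => ?_
  rw [hd_shift_eq]
  simp [sg_succ]

abbrev cone {A B : Cpx K} (f : Hom A B) : Cpx K where
  V j := A.V (j+1) × B.V j
  d j := LinearMap.prod (- A.d (j+1) ∘ₗ LinearMap.fst K _ _)
    (B.d j ∘ₗ LinearMap.snd K _ _ + f.f (j+1) ∘ₗ LinearMap.fst K _ _)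
  dd j v := by
    simp [A.dd, B.dd, f.comm]

lemma cone_d {A B : Cpx K} (f : Hom A B) (j : ℤ) (v) :
    (cone f).d j v = (- A.d (j+1) v.1, B.d j v.2 + f.f (j+1) v.1) := rfl

def coneIn {A B : Cpx K} (f : Hom A B) : Hom B (cone f) where
  f j := LinearMap.inr K _ _
  comm j v := by simp [cone_d]

def coneOut {A B : Cpx K} (f : Hom A B) : Hom (cone f) (shift A) where
  f j := LinearMap.fst K _ _
  comm j v := by simp [cone_d, shift]

lemma coneSES {A B : Cpx K} (f : Hom A B) : SES (coneIn f) (coneOut f) where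
  inj j v h := by
    have := congrArg Prod.snd h
    exact this
  surj j v := ⟨(v, 0), rfl⟩
  zero j v := rfl
  exact j v h := ⟨v.2, by
    have h1 : v.1 = 0 := h
    exact Prod.ext h1.symm rfl⟩

lemma Z_cone {A B : Cpx K} (f : Hom A B) {j : ℤ} (hA : Z A (j+1)) (hB : Z B j) : Z (cone f) j :=
  (coneSES f).Z_mid j hB (Z_shift.2 hA)

lemma FH_cone {A B : Cpx K} (f : Hom A B) (hA : FH A) (hB : FH B) : FH (cone f) :=
  FH_mid (coneSES f) hB (FH_shift hA)

lemma chi_cone {A B : Cpx K} (f : Hom A B) (hA : FH A) (hB : FH B) :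
    chi (cone f) = chi B - chi A := by
  rw [chi_add (coneSES f) hB (FH_shift hA), chi_shift]; ring

lemma FH_of_Z {A : Cpx K} (h : ∀ j, Z A j) : FH A := by
  refine FH.of_ex ∅ Set.finite_empty (fun j => ?_) (fun j _ => h j)
  have := (Z_iff A j).1 (h j)
  have : Subsingleton (Hm A j) := ⟨fun a b => by rw [this a, this b]⟩
  infer_instance

lemma chi_of_Z {A : Cpx K} (h : ∀ j, Z A j) : chi A = 0 := by
  unfold chi
  rw [finsum_congr (g := fun _ => 0) (fun j => by rw [hd_of_Z (h j)]; simp), finsum_zero]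

/-- cohomology of a cone vs. injectivity on cohomology -/
lemma cone_inj {A B : Cpx K} (f : Hom A B) {j : ℤ} (h : Z (cone f) j) (hB : Z B (j+1)) :
    Z A (j+1) := by
  rw [← Z_shift]
  exact (coneSES f).Z_right j h hB

lemma cone_surj {A B : Cpx K} (f : Hom A B) {j : ℤ} (h : Z (cone f) (j+1)) (hA : Z A (j+1)) :
    Z B (j+1) :=
  (coneSES f).Z_left j (Z_shift.2 hA) h

/-- Euler characteristic of a bounded complex of finite-dimensional spaces. -/
lemma chi_fd {A : Cpx K} (S : Finset ℤ) (hf : ∀ j, FiniteDimensional K (A.V j))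
    (hS : ∀ j ∉ S, finrank K (A.V j) = 0) :
    FH A ∧ chi A = - ∑ j ∈ S, sg j * (finrank K (A.V j) : ℤ) := by
  have hfin : ∀ j, FiniteDimensional K (Hm A j) := fun j => inferInstance
  have hk : ∀ j, hd A j + finrank K (LinearMap.range (A.d j)) +
      finrank K (LinearMap.range (A.d (j+1))) = finrank K (A.V (j+1)) := by
    intro j
    have h1 := LinearMap.finrank_range_add_finrank_ker (A.d (j+1))
    have h2 := Submodule.finrank_quotient_add_finrank
      ((LinearMap.range (A.d j)).comap (LinearMap.ker (A.d (j+1))).subtype)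
    have h3 : finrank K ((LinearMap.range (A.d j)).comap (LinearMap.ker (A.d (j+1))).subtype)
        = finrank K (LinearMap.range (A.d j)) := by
      refine (Submodule.comapSubtypeEquivOfLe ?_).finrank_eq
      rintro _ ⟨x, rfl⟩
      exact A.dd _ _
    unfold hd Hm
    omega
  have hle : ∀ j, hd A j ≤ finrank K (A.V (j+1)) := fun j => by have := hk j; omega
  have hle2 : ∀ j, finrank K (LinearMap.range (A.d j)) ≤ finrank K (A.V (j+1)) := fun j => by
    have := hk j; omega
  have fF : FH A := by
    refine ⟨hfin, (S.finite_toSet.preimage (f := fun j => j + 1)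
      (fun a _ b _ hab => by simpa using hab)).subset fun j hj => ?_⟩
    by_contra hc
    have := hle j
    have h2 := hS (j+1) hc
    have : hd A j = 0 := by omega
    exact hj this
  refine ⟨fF, ?_⟩
  have hr : (Function.support fun j => sg j * (finrank K (LinearMap.range (A.d j)) : ℤ)).Finite := by
    refine (S.finite_toSet.preimage (f := fun j => j + 1)
      (fun a _ b _ hab => by simpa using hab)).subset fun j hj => ?_
    by_contra hc
    have := hle2 j
    have h2 := hS (j+1) hc
    have h3 : finrank K (LinearMap.range (A.d j)) = 0 := by omega
    simp [h3] at hj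
  have hr' : (Function.support fun j =>
      sg j * (finrank K (LinearMap.range (A.d (j+1))) : ℤ)).Finite := by
    refine (S.finite_toSet.preimage (f := fun j => j + 1)
      (fun a _ b _ hab => by simpa using hab)).subset fun j hj => ?_
    by_contra hc
    have := hk j
    have h2 := hS (j+1) hc
    have h3 : finrank K (LinearMap.range (A.d (j+1))) = 0 := by omega
    simp [h3] at hj
  have e1 : ∑ᶠ j, (sg j * (hd A j : ℤ) + (sg j * (finrank K (LinearMap.range (A.d j)) : ℤ) +
      sg j * (finrank K (LinearMap.range (A.d (j+1))) : ℤ)))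
      = ∑ᶠ j, sg j * (finrank K (A.V (j+1)) : ℤ) := by
    apply finsum_congr
    intro j
    have := hk j
    rw [← mul_add, ← mul_add]
    congr 1
    exact_mod_cast by omega
  rw [finsum_add_distrib fF.supp' ((hr.union hr').subset (Function.support_add _ _)),
    finsum_add_distrib hr hr'] at e1
  have e2 : ∑ᶠ j, sg j * (finrank K (LinearMap.range (A.d j)) : ℤ) = ∑ᶠ j, sg (j+1) *
      (finrank K (LinearMap.range (A.d (j+1))) : ℤ) :=
    (finsum_comp_equiv (f := fun j => sg j * (finrank K (LinearMap.range (A.d j)) : ℤ))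
      (Equiv.addRight (1:ℤ))).symm
  have e3 : ∑ᶠ j, sg (j+1) * (finrank K (LinearMap.range (A.d (j+1))) : ℤ) =
      - ∑ᶠ j, sg j * (finrank K (LinearMap.range (A.d (j+1))) : ℤ) := by
    rw [← finsum_neg_distrib]
    exact finsum_congr fun j => by rw [sg_succ]; ring
  have e4 : ∑ᶠ j, sg j * (finrank K (A.V (j+1)) : ℤ) = - ∑ j ∈ S, sg j * (finrank K (A.V j) : ℤ) := by
    rw [← finsum_eq_sum_of_support_subset (s := S) (fun j => sg j * (finrank K (A.V j) : ℤ)) (by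
      intro j hj
      by_contra hc
      simp [hS j hc] at hj), ← finsum_comp_equiv
        (f := fun j => sg j * (finrank K (A.V j) : ℤ)) (Equiv.addRight (1:ℤ)), ← finsum_neg_distrib]
    refine finsum_congr fun j => ?_
    change sg j * (finrank K (A.V (j+1)) : ℤ) = -(sg (j+1) * (finrank K (A.V (j+1)) : ℤ))
    rw [sg_succ]; ring
  unfold chi
  rw [e2, e3, e4] at e1
  linarith

end SB

namespace SB
variable {K : Type} [Field K]

/-- A graded family of complexes with commuting degree one operators. -/
structure OpC (K : Type) [Field K] where
  c : ℤ → Cpx K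
  op : ℕ → ∀ t, Hom (c t) (c (t+1))
  comm : ∀ i k t j (v : (c t).V j),
    (op i (t+1)).f j ((op k t).f j v) = (op k (t+1)).f j ((op i t).f j v)

structure OHom (A B : OpC K) where
  f : ∀ t, Hom (A.c t) (B.c t)
  comm : ∀ i t j v, (f (t+1)).f j ((A.op i t).f j v) = (B.op i t).f j ((f t).f j v)

def OHom.comp {A B C : OpC K} (g : OHom B C) (f : OHom A B) : OHom A C :=
  ⟨fun t => (g.f t).comp (f.f t), fun i t j v => by simp [Hom.comp, f.comm, g.comm]⟩

def oSES {A B C : OpC K} (f : OHom A B) (g : OHom B C) : Prop := ∀ t, SES (f.f t) (g.f t)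

abbrev shiftHom {A B : Cpx K} (f : Hom A B) : Hom (shift A) (shift B) :=
  ⟨fun j => f.f (j+1), fun j v => by simp [f.comm]⟩

abbrev coneMap {A B A' B' : Cpx K} (f : Hom A B) (f' : Hom A' B') (a : Hom A A') (b : Hom B B')
    (h : ∀ j v, b.f j (f.f j v) = f'.f j (a.f j v)) : Hom (cone f) (cone f') :=
  ⟨fun j => LinearMap.prodMap (a.f (j+1)) (b.f j), fun j v => by
    simp [a.comm, b.comm, h]⟩

abbrev oShift (D : OpC K) : OpC K where
  c t := shift (D.c t)
  op i t := shiftHom (D.op i t)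
  comm i k t j v := D.comm i k t (j+1) v

abbrev oShiftHom {A B : OpC K} (f : OHom A B) : OHom (oShift A) (oShift B) :=
  ⟨fun t => shiftHom (f.f t), fun i t j v => f.comm i t (j+1) v⟩

lemma shiftSES {A B C : Cpx K} {f : Hom A B} {g : Hom B C} (h : SES f g) :
    SES (shiftHom f) (shiftHom g) :=
  ⟨fun j => h.inj (j+1), fun j => h.surj (j+1), fun j => h.zero (j+1), fun j => h.exact (j+1)⟩

abbrev oCone {A B : OpC K} (f : OHom A B) : OpC K where
  c t := cone (f.f t)
  op i t := coneMap _ _ (A.op i t) (B.op i t) (fun j v => (f.comm i t j v).symm)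
  comm i k t j v := by
    simp [A.comm i k, B.comm i k]

abbrev oConeIn {A B : OpC K} (f : OHom A B) : OHom B (oCone f) :=
  ⟨fun t => coneIn (f.f t), fun i t j v => by simp [coneIn]⟩

abbrev oConeOut {A B : OpC K} (f : OHom A B) : OHom (oCone f) (oShift A) :=
  ⟨fun t => coneOut (f.f t), fun i t j v => by simp [coneOut]⟩

lemma oConeSES {A B : OpC K} (f : OHom A B) : oSES (oConeIn f) (oConeOut f) := fun t => coneSES _

abbrev oDrop (D : OpC K) : OpC K where
  c := D.c
  op i := D.op (i+1)
  comm i k := D.comm (i+1) (k+1)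

abbrev oTw (D : OpC K) : OpC K where
  c t := D.c (t+1)
  op i t := D.op i (t+1)
  comm i k t := D.comm i k (t+1)

abbrev x0 (D : OpC K) : OHom (oDrop D) (oTw (oDrop D)) :=
  ⟨fun t => D.op 0 t, fun i t j v => D.comm _ _ _ _ _⟩

abbrev coneOp (D : OpC K) : OpC K := oCone (x0 D)

abbrev coneOpHom {A B : OpC K} (f : OHom A B) : OHom (coneOp A) (coneOp B) :=
  ⟨fun t => coneMap _ _ (f.f t) (f.f (t+1)) (fun j v => f.comm 0 t j v), fun i t j v => by
    simp [f.comm]⟩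

lemma coneMapSES {A B C A' B' C' : Cpx K} {f : Hom A B} {g : Hom B C} {f' : Hom A' B'}
    {g' : Hom B' C'} (h : SES f g) (h' : SES f' g') (a : Hom A A') (b : Hom B B') (c : Hom C C')
    (h1 : ∀ j v, f'.f j (a.f j v) = b.f j (f.f j v))
    (h2 : ∀ j v, g'.f j (b.f j v) = c.f j (g.f j v)) :
    SES (coneMap a b f f' h1) (coneMap b c g g' h2) where
  inj j v hv := by
    have e1 := congrArg Prod.fst hv
    have e2 := congrArg Prod.snd hv
    exact Prod.ext (h.inj _ _ e1) (h'.inj _ _ e2)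
  surj j v := by
    obtain ⟨w1, h1⟩ := h.surj _ v.1
    obtain ⟨w2, h2⟩ := h'.surj _ v.2
    exact ⟨(w1, w2), Prod.ext h1 h2⟩
  zero j v := Prod.ext (h.zero _ _) (h'.zero _ _)
  exact j v hv := by
    obtain ⟨w1, h1⟩ := h.exact _ v.1 (congrArg Prod.fst hv)
    obtain ⟨w2, h2⟩ := h'.exact _ v.2 (congrArg Prod.snd hv)
    exact ⟨(w1, w2), Prod.ext h1 h2⟩

lemma coneOpSES {A B C : OpC K} {f : OHom A B} {g : OHom B C} (h : oSES f g) :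
    oSES (coneOpHom f) (coneOpHom g) := fun t =>
  coneMapSES (h t) (h (t+1)) _ _ _ (fun j v => f.comm 0 t j v) (fun j v => g.comm 0 t j v)

def kos : ℕ → OpC K → OpC K
  | 0, D => D
  | N+1, D => kos N (coneOp D)

lemma kos_SES (N : ℕ) : ∀ {A B C : OpC K} {f : OHom A B} {g : OHom B C}, oSES f g →
    ∃ (f' : OHom (kos N A) (kos N B)) (g' : OHom (kos N B) (kos N C)), oSES f' g' := by
  induction N with
  | zero => intro A B C f g h; exact ⟨f, g, h⟩
  | succ N ih => intro A B C f g h; exact ih (coneOpSES h)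

lemma kos_add (M N : ℕ) : ∀ D : OpC K, kos (M + N) D = kos N (kos M D) := by
  induction M with
  | zero => intro D; simp [kos]
  | succ M ih => intro D; rw [Nat.succ_add]; exact ih _

structure Piece (N : ℕ) (D : OpC K) where
  op_zero : ∀ i, N ≤ i → ∀ t j v, (D.op i t).f j v = 0
  h : ℕ → ∀ t, Hom (D.c (t+1)) (D.c t)
  hcomm : ∀ i k t j v, (D.op k t).f j ((h i t).f j v) = (h i (t+1)).f j ((D.op k (t+1)).f j v)
  sum : ∀ t j v, ∑ i ∈ Finset.range N, (h i t).f j ((D.op i t).f j v) = v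

structure PieceH (N : ℕ) (D : OpC K) where
  h : ℕ → ∀ t, Hom (D.c (t+1)) (D.c t)
  hcomm : ∀ i k t j v, (D.op k t).f j ((h i t).f j v) = (h i (t+1)).f j ((D.op k (t+1)).f j v)
  s : ∀ t j, (D.c t).V (j+1) →ₗ[K] (D.c t).V j
  scomm : ∀ k t j v, (D.op k t).f j (s t j v) = s (t+1) j ((D.op k t).f (j+1) v)
  sum : ∀ t j v, (D.c t).d j (s t j v) + s t (j+1) ((D.c t).d (j+1) v) +
    ∑ i ∈ Finset.range N, (h i t).f (j+1) ((D.op i t).f (j+1) v) = v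

def Piece.toH {N : ℕ} {D : OpC K} (p : Piece N D) : PieceH N D where
  h := p.h
  hcomm := p.hcomm
  s t j := 0
  scomm k t j v := by simp
  sum t j v := by simpa using p.sum t (j+1) v

def PieceH.step {N : ℕ} {D : OpC K} (p : PieceH (N+1) D) : PieceH N (coneOp D) where
  h i t := coneMap _ _ (p.h (i+1) t) (p.h (i+1) (t+1)) (fun j v => (p.hcomm _ _ _ _ _).symm)
  hcomm i k t j v := by simp [p.hcomm]
  s t j := LinearMap.prod (-(p.s t (j+1)) ∘ₗ LinearMap.fst K _ _ +
      (p.h 0 t).f (j+1) ∘ₗ LinearMap.snd K _ _) (p.s (t+1) j ∘ₗ LinearMap.snd K _ _)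
  scomm k t j v := by
    simp [p.scomm, p.hcomm]
  sum t j v := by
    have e1 := p.sum t (j+1) v.1
    have e2 := p.sum (t+1) j v.2
    rw [Finset.sum_range_succ'] at e1 e2
    refine Prod.ext ?_ ?_
    · rw [Prod.fst_add, Prod.fst_add, Prod.fst_sum]
      simp only [LinearMap.prod_apply, Function.prod, LinearMap.add_apply,
        LinearMap.neg_apply, LinearMap.comp_apply, LinearMap.fst_apply, LinearMap.snd_apply,
        LinearMap.prodMap_apply, map_add, map_neg, neg_add_rev, neg_neg]
      rw [(p.h 0 t).comm]
      rw [← add_assoc] at e1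
      refine Eq.trans ?_ e1
      abel
    · rw [Prod.snd_add, Prod.snd_add, Prod.snd_sum]
      simp only [LinearMap.prod_apply, Function.prod, LinearMap.add_apply,
        LinearMap.neg_apply, LinearMap.comp_apply, LinearMap.fst_apply, LinearMap.snd_apply,
        LinearMap.prodMap_apply, map_add, map_neg, neg_add_rev, neg_neg]
      rw [p.hcomm, p.scomm]
      rw [← add_assoc] at e2
      refine Eq.trans ?_ e2
      abel

lemma PieceH.exact (N : ℕ) : ∀ {D : OpC K} (p : PieceH N D) (t j : ℤ), Z ((kos N D).c t) j := by
  induction N with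
  | zero =>
    intro D p t j v hv
    have := p.sum t j v
    refine ⟨p.s t j v, ?_⟩
    simp only [Finset.range_zero, Finset.sum_empty, add_zero] at this
    change (D.c t).d (j+1) v = 0 at hv
    rw [hv, map_zero, add_zero] at this
    exact this
  | succ N ih =>
    intro D p t j
    exact ih p.step t j

inductive Good (N : ℕ) : OpC K → Prop
  | piece (D : OpC K) (p : Piece N D) : Good N D
  | ext (A B C : OpC K) (f : OHom A B) (g : OHom B C) (h : oSES f g) (hA : Good N A)
      (hC : Good N C) : Good N B

lemma Good.exact {N : ℕ} {D : OpC K} (h : Good N D) : ∀ t j, Z ((kos N D).c t) j := by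
  induction h with
  | piece D p => exact p.toH.exact
  | ext A B C f g h hA hC ihA ihC =>
    intro t j
    obtain ⟨f', g', h'⟩ := kos_SES N h
    exact (h' t).Z_mid j (ihA t j) (ihC t j)

lemma Good.shift {N : ℕ} {D : OpC K} (h : Good N D) : Good N (oShift D) := by
  induction h with
  | piece D p =>
    exact Good.piece _ ⟨fun i hi t j v => p.op_zero i hi t (j+1) v, fun i t => shiftHom (p.h i t),
      fun i k t j v => p.hcomm i k t (j+1) v, fun t j v => p.sum t (j+1) v⟩
  | ext A B C f g h hA hC ihA ihC =>
    exact Good.ext _ _ _ (oShiftHom f) (oShiftHom g) (fun t => shiftSES (h t)) ihA ihC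

lemma Good.cone {N : ℕ} {A B : OpC K} (f : OHom A B) (hA : Good N A) (hB : Good N B) :
    Good N (oCone f) :=
  Good.ext _ _ _ (oConeIn f) (oConeOut f) (oConeSES f) hB hA.shift

lemma Z_coneOp {D : OpC K} {t j : ℤ} (h1 : Z (D.c t) (j+1)) (h2 : Z (D.c (t+1)) j) :
    Z ((coneOp D).c t) j := Z_cone _ h1 h2

/-- `D` has vanishing cohomology for large twists above `a`, for small twists below `b`. -/
structure Van (D : OpC K) (a b : ℤ) : Prop where
  hi : ∃ T, ∀ t, T ≤ t → ∀ j, a < j → Z (D.c t) j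
  lo : ∃ T, ∀ t, t ≤ T → ∀ j, j ≤ b → Z (D.c t) j

lemma Van.coneOp {D : OpC K} {a b : ℤ} (h : Van D a b) : Van (coneOp D) a (b-1) := by
  obtain ⟨⟨T, hT⟩, ⟨T', hT'⟩⟩ := h
  refine ⟨⟨T, fun t ht j hj => Z_coneOp (hT t ht _ (by omega)) (hT _ (by omega) _ hj)⟩,
    ⟨T'-1, fun t ht j hj => Z_coneOp (hT' t (by omega) _ (by omega)) (hT' _ (by omega) _ (by omega))⟩⟩

lemma conc (N : ℕ) : ∀ (D : OpC K) (a : ℤ), (∀ t j, Z ((kos N D).c t) j) →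
    Van D a (a + N - 2) → ∀ t j, (j < a ∨ a + N ≤ j) → Z (D.c t) j := by
  induction N with
  | zero => intro D a h _ t j _; exact h t j
  | succ N ih =>
    intro D a h hv t j hj
    have h1 := ih (SB.coneOp D) a h (by
      have := hv.coneOp
      convert this using 1
      push_cast; ring)
    obtain ⟨⟨T, hT⟩, ⟨T', hT'⟩⟩ := hv
    push_cast at hj hT'
    obtain ⟨j, rfl⟩ : ∃ i, j = i + 1 := ⟨j - 1, by ring⟩
    rcases hj with hj | hj
    · have key : ∀ k : ℕ, ∀ t, t ≤ T' + k → Z (D.c t) (j+1) := by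
        intro k
        induction k with
        | zero => intro t ht; exact hT' t (by simpa using ht) _ (by omega)
        | succ k ihk =>
          intro t ht
          obtain ⟨t, rfl⟩ : ∃ i, t = i + 1 := ⟨t - 1, by ring⟩
          push_cast at ht
          exact cone_surj (D.op 0 t) (h1 t (j+1) (Or.inl hj)) (ihk t (by omega))
      exact key (t - T').toNat t (by omega)
    · have key : ∀ k : ℕ, ∀ t, T - k ≤ t → Z (D.c t) (j+1) := by
        intro k
        induction k with
        | zero => intro t ht; exact hT t (by simpa using ht) _ (by omega)
        | succ k ihk =>
          intro t ht
          push_cast at ht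
          exact cone_inj (D.op 0 t) (h1 t j (Or.inr (by omega))) (ihk (t+1) (by omega))
      exact key (T - t).toNat t (by omega)

lemma kos_van (p : ℕ) : ∀ {D : OpC K} {a b : ℤ}, Van D a b → Van (kos p D) a (b - p) := by
  induction p with
  | zero => intro D a b h; simpa [kos] using h
  | succ p ih =>
    intro D a b h
    have := ih h.coneOp
    have e : b - ((p+1 : ℕ) : ℤ) = b - 1 - p := by push_cast; ring
    rw [e]
    exact this

lemma kos_Z (p : ℕ) : ∀ {D : OpC K} {t j : ℤ}, (∀ i : ℕ, i ≤ p → Z (D.c (t + p - i)) (j + i)) →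
    Z ((kos p D).c t) j := by
  induction p with
  | zero => intro D t j h; simpa [kos] using h 0 le_rfl
  | succ p ih =>
    intro D t j h
    refine ih (D := coneOp D) fun i hi => ?_
    apply Z_coneOp
    · have := h (i+1) (by omega)
      convert this using 1
      · congr 1; push_cast; ring
      · push_cast; ring
    · have := h i (by omega)
      convert this using 2
      push_cast; ring

def X (D : OpC K) (t : ℤ) : ℤ := chi (D.c t)

lemma kos_FH (p : ℕ) : ∀ {D : OpC K}, (∀ t, FH (D.c t)) → ∀ t, FH ((kos p D).c t) := by
  induction p with
  | zero => intro D h; exact h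
  | succ p ih =>
    intro D h
    exact ih (D := coneOp D) fun t => FH_cone _ (h t) (h (t+1))

lemma kos_X (p : ℕ) : ∀ {D : OpC K}, (∀ t, FH (D.c t)) → X (kos p D) = (fwdDiff (1:ℤ))^[p] (X D) := by
  induction p with
  | zero => intro D h; rfl
  | succ p ih =>
    intro D h
    have := ih (D := coneOp D) fun t => FH_cone _ (h t) (h (t+1))
    rw [Function.iterate_succ_apply]
    refine this.trans ?_
    congr 1
    funext t
    exact chi_cone _ (h t) (h (t+1))

lemma chi_two {A : Cpx K} (a : ℤ) (h : ∀ j, j ≠ a → j ≠ a + 1 → Z A j) :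
    chi A = sg a * ((hd A a : ℤ) - hd A (a+1)) := by
  unfold chi
  rw [finsum_eq_sum_of_support_subset (s := {a, a+1})]
  · rw [Finset.sum_pair (by omega), sg_succ]; ring
  · intro j hj
    by_contra hc
    simp only [coe_insert, coe_singleton, Set.mem_insert_iff, Set.mem_singleton_iff, not_or] at hc
    have := hd_of_Z (h j hc.1 hc.2)
    simp [this] at hj

theorem curve_step {D : OpC K} (p : ℕ) (a : ℤ) (hg : Good (p+2) D) (hF : ∀ t, FH (D.c t))
    (hv : Van D a (a + p)) (t : ℤ) :
    ((∀ i : ℕ, i ≤ p → Z (D.c (t + p - i)) (a + i)) →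
      sg a * (fwdDiff (1:ℤ))^[p] (X D) t ≤ 0) ∧
    ((∀ i : ℕ, i ≤ p → Z (D.c (t + p - i)) (a + 1 + i)) →
      0 ≤ sg a * (fwdDiff (1:ℤ))^[p] (X D) t) := by
  have h1 := conc 2 (kos p D) a (by
    rw [← kos_add]; exact hg.exact) (by
      have := kos_van p hv
      convert this using 1
      push_cast; ring)
  have h2 := chi_two (A := (kos p D).c t) a (fun j h3 h4 => h1 t j (by push_cast; omega))
  have hs : sg a * sg a = 1 := by
    unfold sg
    rw [← Units.val_mul, ← Int.negOnePow_add, Int.negOnePow_even _ (Even.add_self a)]; rfl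
  rw [← kos_X p hF]
  unfold X
  rw [h2, ← mul_assoc, hs, one_mul]
  constructor
  · intro h
    have := hd_of_Z (kos_Z p h)
    omega
  · intro h
    have := hd_of_Z (kos_Z p h)
    omega

end SB

namespace SB
variable {K : Type} [Field K]

/-- Sequences in a complex. -/
abbrev fn (A : Cpx K) : Cpx K where
  V j := ℕ → A.V j
  d j := (A.d j).compLeft ℕ
  dd j v := by funext i; simp [A.dd]

abbrev fnMap {A B : Cpx K} (f : Hom A B) : Hom (fn A) (fn B) :=
  ⟨fun j => (f.f j).compLeft ℕ, fun j v => by funext i; simp [f.comm]⟩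

def shl (V : Type) [AddCommGroup V] [Module K V] : (ℕ → V) →ₗ[K] (ℕ → V) where
  toFun f i := f (i+1)
  map_add' _ _ := rfl
  map_smul' _ _ := rfl

def shr (V : Type) [AddCommGroup V] [Module K V] : (ℕ → V) →ₗ[K] (ℕ → V) where
  toFun f i := match i with | 0 => 0 | i+1 => f i
  map_add' _ _ := by funext i; cases i <;> simp
  map_smul' _ _ := by funext i; cases i <;> simp

/-- Extension by zero to the integers. -/
def exz {V : Type} [AddCommGroup V] (f : ℕ → V) (i : ℤ) : V := if 0 ≤ i then f i.toNat else 0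

def sig (V : Type) [AddCommGroup V] [Module K V] (s : ℤ) : (ℕ → V) →ₗ[K] (ℕ → V) where
  toFun f i := exz f (i + s)
  map_add' f g := by funext i; simp only [exz, Pi.add_apply]; split_ifs <;> simp
  map_smul' a f := by funext i; simp only [exz, Pi.smul_apply, RingHom.id_apply]; split_ifs <;> simp

section
variable {V W : Type} [AddCommGroup V] [Module K V] [AddCommGroup W] [Module K W]

@[simp] lemma shl_apply (f : ℕ → V) (i) : shl (K := K) V f i = f (i+1) := rfl
@[simp] lemma shr_zero (f : ℕ → V) : shr (K := K) V f 0 = 0 := rfl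
@[simp] lemma shr_succ (f : ℕ → V) (i) : shr (K := K) V f (i+1) = f i := rfl
@[simp] lemma sig_apply (s : ℤ) (f : ℕ → V) (i) : sig (K := K) V s f i = exz f (i + s) := rfl

lemma exz_map (g : V →ₗ[K] W) (f : ℕ → V) (i : ℤ) :
    exz (fun k => g (f k)) i = g (exz f i) := by
  unfold exz; split_ifs <;> simp

lemma exz_shr (f : ℕ → V) (i : ℤ) : exz (shr (K := K) V f) i = exz f (i-1) := by
  unfold exz
  by_cases h : 0 ≤ i
  · obtain ⟨k, rfl⟩ := Int.eq_ofNat_of_zero_le h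
    cases k with
    | zero => simp
    | succ k => 
      have e : ((k+1 : ℕ) : ℤ) - 1 = k := by push_cast; ring
      rw [e]
      simp
      intro h; omega
  · rw [if_neg h, if_neg (by omega)]

lemma exz_add (f g : ℕ → V) (i : ℤ) : exz (fun k => f k + g k) i = exz f i + exz g i := by
  unfold exz; split_ifs <;> simp

lemma shr_map (g : V →ₗ[K] W) (f : ℕ → V) :
    shr (K := K) W (fun k => g (f k)) = fun k => g (shr (K := K) V f k) := by
  funext k; cases k <;> simp
end

abbrev fnY (A : Cpx K) : Hom (fn A) (fn A) :=
  ⟨fun j => shl _, fun j v => by funext i; simp⟩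
abbrev fnZ (A : Cpx K) : Hom (fn A) (fn A) :=
  ⟨fun j => shr _, fun j v => by funext i; cases i <;> simp⟩
abbrev fnS (A : Cpx K) (s : ℤ) : Hom (fn A) (fn A) :=
  ⟨fun j => sig _ s, fun j v => by
    funext i
    simp only [sig_apply, LinearMap.compLeft_apply, Function.comp_apply]
    exact exz_map _ _ _⟩

abbrev Hom.add {A B : Cpx K} (f g : Hom A B) : Hom A B :=
  ⟨fun j => f.f j + g.f j, fun j v => by simp [f.comm, g.comm]⟩
abbrev Hom.sub {A B : Cpx K} (f g : Hom A B) : Hom A B :=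
  ⟨fun j => f.f j - g.f j, fun j v => by simp [f.comm, g.comm]⟩
abbrev Hom.zero (A B : Cpx K) : Hom A B := ⟨fun j => 0, fun j v => by simp⟩

/-- The previous operator. -/
def xm (D : OpC K) : ℕ → ∀ t, Hom (D.c t) (D.c (t+1))
  | 0, t => Hom.zero _ _
  | i+1, t => D.op i t

lemma xm_comm1 (D : OpC K) (i k t j) (v : (D.c t).V j) :
    (D.op i (t+1)).f j ((xm D k t).f j v) = (xm D k (t+1)).f j ((D.op i t).f j v) := by
  cases k with
  | zero => simp [xm]
  | succ k => exact D.comm _ _ _ _ _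

lemma xm_comm2 (D : OpC K) (i k t j) (v : (D.c t).V j) :
    (xm D i (t+1)).f j ((xm D k t).f j v) = (xm D k (t+1)).f j ((xm D i t).f j v) := by
  cases i with
  | zero => simp [xm]
  | succ i => exact xm_comm1 D i k t j v

abbrev pOp (D : OpC K) (i : ℕ) (t : ℤ) : Hom (fn (D.c t)) (fn (D.c (t+1))) :=
  Hom.add (fnMap (D.op i t)) ((fnZ _).comp (fnMap (xm D i t)))

abbrev qOp (D : OpC K) (i : ℕ) (t : ℤ) : Hom (fn (D.c t)) (fn (D.c (t+1))) :=
  Hom.add ((fnY _).comp (fnMap (D.op i t))) (fnMap (xm D i t))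

lemma pOp_zero (D : OpC K) (i t j) (v : (fn (D.c t)).V j) :
    (pOp D i t).f j v 0 = (D.op i t).f j (v 0) := by simp [Hom.comp]
lemma pOp_succ (D : OpC K) (i t j) (v : (fn (D.c t)).V j) (k) :
    (pOp D i t).f j v (k+1) = (D.op i t).f j (v (k+1)) + (xm D i t).f j (v k) := by simp [Hom.comp]
lemma qOp_apply (D : OpC K) (i t j) (v : (fn (D.c t)).V j) (k) :
    (qOp D i t).f j v k = (D.op i t).f j (v (k+1)) + (xm D i t).f j (v k) := by simp [Hom.comp]

lemma pOp_comm (D : OpC K) (i k t j) (v : (fn (D.c t)).V j) :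
    (pOp D i (t+1)).f j ((pOp D k t).f j v) = (pOp D k (t+1)).f j ((pOp D i t).f j v) := by
  funext l
  rcases l with _ | _ | l
  · rw [pOp_zero, pOp_zero, pOp_zero, pOp_zero, D.comm i k]
  · rw [pOp_succ, pOp_succ, pOp_zero, pOp_succ, pOp_succ, pOp_zero, map_add, map_add, D.comm i k,
      xm_comm1 D i k, xm_comm1 D k i]
    abel
  · rw [pOp_succ, pOp_succ, pOp_succ, pOp_succ, pOp_succ, pOp_succ, map_add, map_add, map_add,
      map_add, D.comm i k, xm_comm1 D i k, xm_comm1 D k i, xm_comm2 D i k]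
    abel

lemma qOp_comm (D : OpC K) (i k t j) (v : (fn (D.c t)).V j) :
    (qOp D i (t+1)).f j ((qOp D k t).f j v) = (qOp D k (t+1)).f j ((qOp D i t).f j v) := by
  funext l
  rw [qOp_apply, qOp_apply, qOp_apply, qOp_apply, qOp_apply, qOp_apply, map_add, map_add, map_add,
      map_add, D.comm i k, xm_comm1 D i k, xm_comm1 D k i, xm_comm2 D i k]
  abel

abbrev oP (D : OpC K) : OpC K where
  c t := fn (D.c t)
  op i t := pOp D i t
  comm i k t j v := pOp_comm D i k t j v

abbrev oQ (D : OpC K) : OpC K where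
  c t := fn (D.c t)
  op i t := qOp D i t
  comm i k t j v := qOp_comm D i k t j v

abbrev oSig (D : OpC K) (z : ℤ) : OHom (oP D) (oQ D) where
  f t := fnS (D.c t) (t - z)
  comm i t j v := by
    funext k
    rw [qOp_apply]
    simp only [sig_apply]
    have e : ((pOp D i t).f j v) = fun k => (D.op i t).f j (v k) +
        (shr (K := K) _ (fun k => (xm D i t).f j (v k))) k := by
      funext k; cases k <;> simp [Hom.comp, fnMap]
    rw [e, exz_add, exz_map, exz_shr, exz_map]
    congr 3 <;> push_cast <;> ring

/-- Inserting the root `z`. -/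
abbrev ins (D : OpC K) (z : ℤ) : OpC K := oCone (oSig D z)

lemma fnSES {A B C : Cpx K} {f : Hom A B} {g : Hom B C} (h : SES f g) :
    SES (fnMap f) (fnMap g) where
  inj j v hv := by
    funext i; exact h.inj _ _ (congrFun hv i)
  surj j v := by
    choose w hw using fun i => h.surj j (v i)
    exact ⟨w, funext hw⟩
  zero j v := by funext i; exact h.zero _ _
  exact j v hv := by
    choose w hw using fun i => h.exact j (v i) (congrFun hv i)
    exact ⟨w, funext hw⟩

lemma OHom.xm {A B : OpC K} (f : OHom A B) (i t j v) :
    (f.f (t+1)).f j ((xm A i t).f j v) = (xm B i t).f j ((f.f t).f j v) := by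
  cases i with
  | zero => simp [SB.xm]
  | succ i => exact f.comm _ _ _ _

abbrev oPHom {A B : OpC K} (f : OHom A B) : OHom (oP A) (oP B) where
  f t := fnMap (f.f t)
  comm i t j v := by
    funext k
    cases k <;> simp [Hom.comp, f.comm, f.xm]

abbrev oQHom {A B : OpC K} (f : OHom A B) : OHom (oQ A) (oQ B) where
  f t := fnMap (f.f t)
  comm i t j v := by
    funext k
    simp [Hom.comp, f.comm, f.xm]

section pieceP
variable {N : ℕ} {D : OpC K} (p : Piece N D)

def hP : ℕ → ℕ → ∀ t, Hom (fn (D.c (t+1))) (fn (D.c t))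
  | 0, i, t => Hom.zero _ _
  | k+1, i, t => Hom.sub (fnMap (p.h i t)) ((fnZ _).comp (hP k (i+1) t))

def hQ : ℕ → ∀ t, Hom (fn (D.c (t+1))) (fn (D.c t))
  | 0, t => Hom.zero _ _
  | i+1, t => Hom.sub (fnMap (p.h i t)) ((fnY _).comp (hQ i t))

lemma hP_Z (k) : ∀ i t j v, (hP p k i t).f j (shr (K := K) _ v) = shr (K := K) _ ((hP p k i t).f j v) := by
  induction k with
  | zero => intro i t j v; simp [hP]
  | succ k ih =>
    intro i t j v
    funext l
    cases l with
    | zero => simp [hP, Hom.comp, ih]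
    | succ l => cases l <;> simp [hP, Hom.comp, ih]

lemma hQ_Y (i) : ∀ t j v, (hQ p i t).f j (shl (K := K) _ v) = shl (K := K) _ ((hQ p i t).f j v) := by
  induction i with
  | zero => intro t j v; simp [hQ]
  | succ k ih =>
    intro t j v
    funext l
    simp [hQ, Hom.comp, ih]

/-- A family of homs commuting with `hP` -/
lemma hP_op (k) : ∀ i (g : ∀ t, Hom (D.c t) (D.c (t+1))), (∀ i t j v, (g t).f j ((p.h i t).f j v)
      = (p.h i (t+1)).f j ((g (t+1)).f j v)) → ∀ t j v,
    (fnMap (g t)).f j ((hP p k i t).f j v) = (hP p k i (t+1)).f j ((fnMap (g (t+1))).f j v) := by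
  induction k with
  | zero => intro i g hg t j v; funext l; exact ((g t).f j).map_zero
  | succ k ih =>
    intro i g hg t j v
    have h1 := ih (i+1) g hg t j v
    funext l
    cases l with
    | zero => simp [hP, Hom.comp, hg]
    | succ l => 
      have h2 := congrFun h1 l
      simp [hP, Hom.comp, hg] at h2 ⊢
      rw [h2]

lemma hQ_op (i) : ∀ (g : ∀ t, Hom (D.c t) (D.c (t+1))), (∀ i t j v, (g t).f j ((p.h i t).f j v)
      = (p.h i (t+1)).f j ((g (t+1)).f j v)) → ∀ t j v,
    (fnMap (g t)).f j ((hQ p i t).f j v) = (hQ p i (t+1)).f j ((fnMap (g (t+1))).f j v) := by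
  induction i with
  | zero => intro g hg t j v; funext l; exact ((g t).f j).map_zero
  | succ k ih =>
    intro g hg t j v
    have h1 := ih g hg t j v
    funext l
    have h2 := congrFun h1 (l+1)
    simp [hQ, Hom.comp, hg] at h2 ⊢
    rw [h2]

lemma xm_h (k i t j v) : (xm D k t).f j ((p.h i t).f j v)
      = (p.h i (t+1)).f j ((xm D k (t+1)).f j v) := by
  cases k with
  | zero => simp [xm]
  | succ k => exact p.hcomm _ _ _ _ _

def Piece.P : Piece (N+1) (oP D) where
  op_zero i hi t j v := by
    obtain ⟨i, rfl⟩ : ∃ k, i = k + 1 := ⟨i - 1, by omega⟩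
    funext l
    cases l with
    | zero => rw [pOp_zero, p.op_zero _ (by omega)]; rfl
    | succ l => rw [pOp_succ, p.op_zero _ (by omega), xm, p.op_zero _ (by omega)]; exact add_zero _
  h i t := hP p (N - i) i t
  hcomm i k t j v := by
    have h1 := hP_op p (N-i) i (fun t => D.op k t) (fun i t j v => p.hcomm _ _ _ _ _) t j v
    have h2 := hP_op p (N-i) i (fun t => xm D k t) (fun i t j v => xm_h p _ _ _ _ _) t j v
    simp only [LinearMap.add_apply, map_add, Hom.comp, LinearMap.comp_apply]
    rw [h1, h2, hP_Z]
  sum t j v := by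
    simp only [LinearMap.add_apply, map_add, Hom.comp, LinearMap.comp_apply]
    rw [Finset.sum_add_distrib, Finset.sum_range_succ, Finset.sum_range_succ' (n := N)]
    have e0 : ∀ w, (hP p (N - N) N t).f j w = 0 := by
      intro w; rw [Nat.sub_self]; rfl
    have e1 : (hP p (N - 0) 0 t).f j (shr (K := K) _ ((fnMap (xm D 0 t)).f j v)) = 0 := by
      have : (fnMap (xm D 0 t)).f j v = 0 := rfl
      rw [this, map_zero, map_zero]
    rw [e0, e1, add_zero, add_zero, ← Finset.sum_add_distrib]
    have e2 : ∀ i ∈ Finset.range N, (hP p (N - i) i t).f j ((fnMap (D.op i t)).f j v) +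
      (hP p (N - (i+1)) (i+1) t).f j (shr (K := K) _ ((fnMap (xm D (i+1) t)).f j v)) =
      (fnMap (p.h i t)).f j ((fnMap (D.op i t)).f j v) := by
      intro i hi
      have hi := Finset.mem_range.1 hi
      rw [hP_Z]
      obtain ⟨k, hk⟩ : ∃ k, N - i = k + 1 := ⟨N - i - 1, by omega⟩
      have hk' : N - (i+1) = k := by omega
      rw [hk, hk']
      exact sub_add_cancel _ _
    rw [Finset.sum_congr rfl e2]
    funext l
    simpa using p.sum t j (v l)

def Piece.Q : Piece (N+1) (oQ D) where
  op_zero i hi t j v := by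
    obtain ⟨i, rfl⟩ : ∃ k, i = k + 1 := ⟨i - 1, by omega⟩
    funext l
    rw [qOp_apply, p.op_zero _ (by omega), xm, p.op_zero _ (by omega)]; exact add_zero _
  h i t := hQ p i t
  hcomm i k t j v := by
    have h1 := hQ_op p i (fun t => D.op k t) (fun i t j v => p.hcomm _ _ _ _ _) t j v
    have h2 := hQ_op p i (fun t => xm D k t) (fun i t j v => xm_h p _ _ _ _ _) t j v
    simp only [LinearMap.add_apply, map_add, Hom.comp, LinearMap.comp_apply]
    rw [h1, h2, hQ_Y]
  sum t j v := by
    simp only [LinearMap.add_apply, map_add, Hom.comp, LinearMap.comp_apply]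
    rw [Finset.sum_add_distrib, Finset.sum_range_succ, Finset.sum_range_succ' (n := N)]
    have e0 : (fnMap (D.op N t)).f j v = 0 := by
      funext l; exact p.op_zero N le_rfl _ _ _
    have e1 : (fnMap (xm D 0 t)).f j v = 0 := rfl
    rw [e0, e1, map_zero, map_zero, map_zero, add_zero, add_zero, ← Finset.sum_add_distrib]
    have e2 : ∀ i ∈ Finset.range N, (hQ p i t).f j (shl (K := K) _ ((fnMap (D.op i t)).f j v)) +
      (hQ p (i+1) t).f j ((fnMap (xm D (i+1) t)).f j v) =
      (fnMap (p.h i t)).f j ((fnMap (D.op i t)).f j v) := by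
      intro i hi
      rw [hQ_Y]
      exact add_sub_cancel _ _
    rw [Finset.sum_congr rfl e2]
    funext l
    simpa using p.sum t j (v l)
end pieceP

lemma Good.P {N : ℕ} {D : OpC K} (h : Good N D) : Good (N+1) (oP D) := by
  induction h with
  | piece D p => exact Good.piece _ p.P
  | ext A B C f g h hA hC ihA ihC =>
    exact Good.ext _ _ _ (oPHom f) (oPHom g) (fun t => fnSES (h t)) ihA ihC

lemma Good.Q {N : ℕ} {D : OpC K} (h : Good N D) : Good (N+1) (oQ D) := by
  induction h with
  | piece D p => exact Good.piece _ p.Q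
  | ext A B C f g h hA hC ihA ihC =>
    exact Good.ext _ _ _ (oQHom f) (oQHom g) (fun t => fnSES (h t)) ihA ihC

lemma Good.ins {N : ℕ} {D : OpC K} (h : Good N D) (z : ℤ) : Good (N+1) (ins D z) :=
  Good.cone _ h.P h.Q

/-! Cohomology of the insertion. -/

abbrev cS (A : Cpx K) (s : ℤ) : Cpx K := cone (fnS A s)

abbrev cSin (A : Cpx K) (s : ℤ) : Hom A (cS A s) where
  f j := LinearMap.inr K _ _ ∘ₗ LinearMap.single K (fun _ : ℕ => A.V j) 0
  comm j v := by
    refine Prod.ext ?_ ?_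
    · simp
    · funext i
      cases i <;> simp

abbrev cSout (A : Cpx K) (s : ℤ) : Hom (cS A s) (cS A (s+1)) :=
  coneMap _ _ (Hom.id _) (fnY A) (fun j v => by
    funext i
    simp only [shl_apply, sig_apply, Hom.id, LinearMap.id_apply]
    congr 1; push_cast; ring)

lemma cS_SES (A : Cpx K) (s : ℤ) : SES (cSin A s) (cSout A s) where
  inj j v hv := by
    have := congrFun (congrArg Prod.snd hv) 0
    simpa using this
  surj j v := ⟨(v.1, shr (K := K) _ v.2), by
    refine Prod.ext rfl ?_
    funext i; rfl⟩
  zero j v := by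
    refine Prod.ext ?_ ?_
    · simp
    · funext i; simp
  exact j v hv := by
    refine ⟨v.2 0, ?_⟩
    have e1 : v.1 = 0 := congrArg Prod.fst hv
    have e2 : ∀ i, v.2 (i+1) = 0 := fun i => congrFun (congrArg Prod.snd hv) i
    refine Prod.ext ?_ ?_
    · simp [e1]
    · funext i
      cases i with
      | zero => simp
      | succ i => simp [e2]

lemma cS_zero (A : Cpx K) (j : ℤ) : Z (cS A 0) j := by
  intro v hv
  have e2 := congrArg Prod.snd hv
  have e3 : ∀ w : ℕ → A.V (j+1+1), sig (K := K) _ 0 w = w := by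
    intro w; funext i; simp [exz]
  have e4 : ∀ w : ℕ → A.V (j+1), sig (K := K) _ 0 w = w := by
    intro w; funext i; simp [exz]
  have e5 : (fn A).d (j+1) v.2 + v.1 = 0 := by
    rw [← e3 v.1]; exact e2
  refine ⟨(v.2, 0), ?_⟩
  refine Prod.ext ?_ ?_
  · change - (fn A).d (j+1) v.2 = v.1
    exact neg_eq_of_add_eq_zero_right e5
  · change (fn A).d j 0 + sig (K := K) _ 0 v.2 = v.2
    rw [e4, map_zero, zero_add]

lemma cS_pos (A : Cpx K) (j : ℤ) (h : Z A (j+1)) (s : ℕ) : Z (cS A s) j := by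
  induction s with
  | zero => exact cS_zero A j
  | succ s ih =>
    rw [Nat.cast_succ]
    exact (cS_SES A s).Z_right j ih h

lemma cS_neg (A : Cpx K) (j : ℤ) (h : Z A j) (s : ℕ) : Z (cS A (-s)) j := by
  induction s with
  | zero => exact cS_zero A j
  | succ s ih =>
    refine (cS_SES A _).Z_mid j h ?_
    have e : -((s+1 : ℕ) : ℤ) + 1 = - s := by push_cast; ring
    rw [e]; exact ih

lemma cS_FH (A : Cpx K) (h : FH A) (s : ℤ) : FH (cS A s) ∧ chi (cS A s) = - s * chi A := by
  induction s using Int.induction_on with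
  | zero => exact ⟨FH_of_Z (cS_zero A), by rw [chi_of_Z (cS_zero A)]; simp⟩
  | succ s ih =>
    refine ⟨FH_right (cS_SES A s) h ih.1, ?_⟩
    have := chi_add (cS_SES A s) h (FH_right (cS_SES A s) h ih.1)
    rw [ih.2] at this
    linarith
  | pred s ih =>
    have e : -(s:ℤ) - 1 + 1 = -s := by ring
    have hs := cS_SES A (-(s:ℤ)-1)
    have ih1 : FH (cS A (-(s:ℤ)-1+1)) := by rw [e]; exact ih.1
    refine ⟨FH_mid hs h ih1, ?_⟩
    have := chi_add hs h ih1
    rw [this, e, ih.2]; ring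

lemma ins_gt {D : OpC K} {z t j : ℤ} (ht : z < t) (h : Z (D.c t) (j+1)) : Z ((ins D z).c t) j := by
  have := cS_pos (D.c t) j h (t-z).toNat
  rw [Int.toNat_of_nonneg (by omega)] at this
  exact this

lemma ins_lt {D : OpC K} {z t j : ℤ} (ht : t < z) (h : Z (D.c t) j) : Z ((ins D z).c t) j := by
  have := cS_neg (D.c t) j h (z-t).toNat
  rw [Int.toNat_of_nonneg (by omega), neg_sub] at this
  exact this

lemma ins_eq {D : OpC K} {z j : ℤ} : Z ((ins D z).c z) j := by
  have := cS_zero (D.c z) j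
  rw [← sub_self z] at this
  exact this

lemma ins_van {D : OpC K} {a b : ℤ} (h : Van D a b) (z : ℤ) : Van (ins D z) (a-1) b := by
  obtain ⟨⟨T, hT⟩, ⟨T', hT'⟩⟩ := h
  refine ⟨⟨max T (z+1), fun t ht j hj => ?_⟩, ⟨min T' (z-1), fun t ht j hj => ?_⟩⟩
  · have := le_max_left T (z+1)
    have := le_max_right T (z+1)
    exact ins_gt (by omega) (hT t (by omega) _ (by omega))
  · have := min_le_left T' (z-1)
    have := min_le_right T' (z-1)
    exact ins_lt (by omega) (hT' t (by omega) _ (by omega))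

/-- Vanishing at nodes. -/
def Node (a : ℤ) (D : OpC K) (S : Finset ℤ) : Prop :=
  ∀ z ∈ S, Z (D.c z) (a + (S.filter (z < ·)).card)

lemma ins_node {a : ℤ} {D : OpC K} {S : Finset ℤ} (h : Node a D S) {z : ℤ} (hz : z ∉ S) :
    Node (a-1) (ins D z) (insert z S) := by
  intro w hw
  rcases Finset.mem_insert.1 hw with rfl | hw'
  · exact ins_eq
  · have h1 := h w hw'
    rcases lt_trichotomy w z with hlt | rfl | hgt
    · apply ins_lt hlt
      rw [Finset.filter_insert, if_pos hlt, Finset.card_insert_of_notMem (by intro hh; exact hz (Finset.mem_filter.1 hh).1)]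
      convert h1 using 1
      push_cast; ring
    · exact absurd hw' hz
    · apply ins_gt hgt
      rw [Finset.filter_insert, if_neg (by omega)]
      convert h1 using 1
      push_cast; ring

/-- Insert all elements of a finite set. -/
lemma ins_many {N : ℕ} {D : OpC K} {a b c : ℤ} (hg : Good N D) (hF : ∀ t, FH (D.c t))
    (hv : Van D a b) {S : Finset ℤ} (hn : Node c D S) (L : Finset ℤ) (hL : Disjoint L S) :
    ∃ D' : OpC K, Good (N + L.card) D' ∧ (∀ t, FH (D'.c t)) ∧ Van D' (a - L.card) b ∧
      Node (c - L.card) D' (L ∪ S) ∧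
      ∀ t, sg (a - L.card) * X D' t = sg a * (X D t * ∏ z ∈ L, (t - z)) := by
  induction L using Finset.induction_on with
  | empty => exact ⟨D, by simpa using hg, hF, by simpa using hv, by simpa using hn, by simp⟩
  | insert z L hz ih =>
    rw [Finset.disjoint_insert_left] at hL
    obtain ⟨D', h1, h2, h3, h4, h5⟩ := ih hL.2
    refine ⟨ins D' z, ?_, ?_, ?_, ?_, ?_⟩
    · rw [Finset.card_insert_of_notMem hz, ← add_assoc]
      exact h1.ins z
    · intro t; exact (cS_FH _ (h2 t) _).1
    · rw [Finset.card_insert_of_notMem hz]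
      convert ins_van h3 z using 1
      push_cast; ring
    · rw [Finset.card_insert_of_notMem hz, Finset.insert_union]
      convert ins_node h4 (z := z) (by simp [hz, hL.1]) using 1
      push_cast; ring
    · intro t
      rw [Finset.card_insert_of_notMem hz, Finset.prod_insert hz]
      have e := (cS_FH _ (h2 t) (t - z)).2
      have e2 : X (ins D' z) t = -(t-z) * X D' t := e
      rw [e2]
      have e3 : sg (a - L.card) = - sg (a - (L.card + 1 : ℕ)) := by
        rw [← sg_succ]; congr 1; push_cast; ring
      have h6 := h5 t
      rw [e3] at h6
      linear_combination (t - z) * h6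

/-- The main abstract inequality. -/
theorem main_ineq {m : ℕ} {D : OpC K} {a : ℤ} (hg : Good (m+1) D)
    (hF : ∀ t, FH (D.c t)) (hv : Van D a (a + m - 1)) (S : Finset ℤ) (hS : S.card = m)
    (lo : ℤ) (p : ℕ) (hlo : S ⊆ Finset.Icc lo (lo + p)) :
    (Node a D S → sg a * (fwdDiff (1:ℤ))^[p]
      (fun t => X D t * ∏ z ∈ Finset.Icc lo (lo+p) \ S, (t - z)) lo ≤ 0) ∧
    (Node (a+1) D S → 0 ≤ sg a * (fwdDiff (1:ℤ))^[p]
      (fun t => X D t * ∏ z ∈ Finset.Icc lo (lo+p) \ S, (t - z)) lo) := by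
  set L := Finset.Icc lo (lo+p) \ S with hL
  have hdis : Disjoint L S := Finset.sdiff_disjoint
  have hU : L ∪ S = Finset.Icc lo (lo+p) := Finset.sdiff_union_of_subset hlo
  have hcard : L.card + m = p + 1 := by
    rw [← hS, ← Finset.card_union_of_disjoint hdis, hU]
    simp; omega
  have cnt : ∀ i : ℕ, i ≤ p →
      ((Finset.Icc lo (lo+p)).filter ((lo + p - i) < ·)).card = i := by
    intro i hi
    have : (Finset.Icc lo (lo+p)).filter ((lo + p - i) < ·) = Finset.Ioc (lo + p - i) (lo + p) := by
      ext x; simp; omega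
    rw [this]; simp
  have lin : ∀ (D' : OpC K) (b : ℤ), (∀ t, sg b * X D' t = sg a * (X D t * ∏ z ∈ L, (t - z))) →
      sg b * (fwdDiff (1:ℤ))^[p] (X D') lo = sg a * (fwdDiff (1:ℤ))^[p]
      (fun t => X D t * ∏ z ∈ L, (t - z)) lo := by
    intro D' b h
    have e1 := congrFun (fwdDiff_iter_const_smul (h := (1:ℤ)) (sg b) (X D') p) lo
    have e2 := congrFun (fwdDiff_iter_const_smul (h := (1:ℤ)) (sg a)
      (fun t => X D t * ∏ z ∈ L, (t - z)) p) lo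
    simp only [Pi.smul_apply, smul_eq_mul] at e1 e2
    rw [← e1, ← e2]
    have e3 : sg b • X D' = sg a • fun t => X D t * ∏ z ∈ L, (t - z) := funext h
    rw [e3]
  constructor
  · intro hn
    obtain ⟨D', h1, h2, h3, h4, h5⟩ := ins_many hg hF hv hn L hdis
    rw [← lin D' _ h5]
    refine (curve_step p (a - L.card) ?_ h2 ?_ lo).1 ?_
    · convert h1 using 1; omega
    · convert h3 using 1; omega
    · intro i hi
      have := h4 (lo + p - i) (by rw [hU]; simp; omega)
      rwa [hU, cnt i hi] at this
  · intro hn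
    obtain ⟨D', h1, h2, h3, h4, h5⟩ := ins_many hg hF hv hn L hdis
    rw [← lin D' _ h5]
    refine (curve_step p (a - L.card) ?_ h2 ?_ lo).2 ?_
    · convert h1 using 1; omega
    · convert h3 using 1; omega
    · intro i hi
      have := h4 (lo + p - i) (by rw [hU]; simp; omega)
      rw [hU, cnt i hi] at this
      convert this using 1
      ring

end SB

namespace SB
variable {K : Type} [Field K]

/-- Isomorphic cohomology. -/
def QE (A B : Cpx K) : Prop := ∀ j, Nonempty (Hm A j ≃ₗ[K] Hm B j)

lemma QE.trans {A B C : Cpx K} (h : QE A B) (h' : QE B C) : QE A C := fun j => by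
  obtain ⟨e⟩ := h j
  obtain ⟨e'⟩ := h' j
  exact ⟨e.trans e'⟩

lemma SES.QE {A B C : Cpx K} {f : Hom A B} {g : Hom B C} (h : SES f g) (hA : ∀ j, Z A j) :
    QE B C := fun j => by
  obtain ⟨δ, h1, h2, h3, h4, h5, h6⟩ := LES h j
  refine ⟨LinearEquiv.ofBijective (hmap g j) ⟨?_, ?_⟩⟩
  · rw [← LinearMap.ker_eq_bot, LinearMap.ker_eq_bot']
    intro x hx
    obtain ⟨y, rfl⟩ := h1 x hx
    rw [(Z_iff A j).1 (hA j) y, map_zero]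
  · intro x
    exact h3 x ((Z_iff A (j+1)).1 (hA _) _)

lemma QE.hd {A B : Cpx K} (h : QE A B) (j) : hd A j = hd B j := by
  obtain ⟨e⟩ := h j
  exact e.finrank_eq

lemma QE.Z {A B : Cpx K} (h : QE A B) (j) : Z A j ↔ Z B j := by
  obtain ⟨e⟩ := h j
  rw [Z_iff, Z_iff]
  constructor
  · intro h x
    rw [← e.apply_symm_apply x, h (e.symm x), map_zero]
  · intro h x
    rw [← e.symm_apply_apply x, h (e x), map_zero]

lemma QE.FH {A B : Cpx K} (h : QE A B) (hB : FH B) : FH A := by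
  refine FH.of_ex _ hB.supp (fun j => ?_) (fun j hj => ?_)
  · obtain ⟨e⟩ := h j
    have := hB.fin j
    exact Module.Finite.equiv e.symm
  · rw [h.Z]
    exact Z_of_notmem hB hj

lemma QE.chi {A B : Cpx K} (h : QE A B) : chi A = chi B := by
  unfold SB.chi
  exact finsum_congr fun j => by rw [h.hd]

lemma Z_cone_id (A : Cpx K) (j) : Z (cone (Hom.id A)) j := by
  intro v hv
  have e2 : A.d (j+1) v.2 + v.1 = 0 := congrArg Prod.snd hv
  refine ⟨(v.2, 0), ?_⟩
  refine Prod.ext ?_ ?_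
  · change - A.d (j+1) v.2 = v.1
    exact neg_eq_of_add_eq_zero_right e2
  · change A.d j 0 + v.2 = v.2
    rw [map_zero, zero_add]

lemma res_step {N : ℕ} {A B A' R' : OpC K} {f : OHom A B} {g : OHom B A'} (h : oSES f g)
    (hB : Good N B) (hR : Good N R') (ι' : OHom A' R') :
    ∃ (R : OpC K) (ι : OHom (oShift A) R), Good N R ∧
      ∀ t, QE (cone (ι.f t)) (cone (ι'.f t)) := by
  let φ : OHom B R' := ι'.comp g
  let ι : OHom (oShift A) (oCone φ) :=
    { f := fun t =>
        { f := fun j => LinearMap.inl K _ _ ∘ₗ (f.f t).f (j+1)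
          comm := fun j v => by
            refine Prod.ext ?_ ?_
            · change (f.f t).f (j+1+1) (-(A.c t).d (j+1) v) = -(B.c t).d (j+1) ((f.f t).f (j+1) v)
              rw [map_neg, (f.f t).comm]
            · change 0 = (R'.c t).d j 0 + (ι'.f t).f (j+1) ((g.f t).f (j+1) ((f.f t).f (j+1) v))
              rw [(h t).zero, map_zero, map_zero, add_zero] }
      comm := fun i t j v => by
        refine Prod.ext ?_ ?_
        · exact f.comm i t (j+1) v
        · exact (map_zero ((R'.op i t).f j)).symm }
  refine ⟨oCone φ, ι, Good.cone _ hB hR, fun t => ?_⟩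
  let a : Hom (cone (Hom.id (shift (A.c t)))) (cone (ι.f t)) :=
    coneMap _ _ (Hom.id _) (ι.f t) (fun j v => rfl)
  let b : Hom (cone (ι.f t)) (cone (ι'.f t)) :=
    { f := fun j => LinearMap.prodMap ((g.f t).f (j+1)) LinearMap.id ∘ₗ LinearMap.snd K _ _
      comm := fun j v => by
        obtain ⟨v, b, r⟩ := v
        refine Prod.ext ?_ ?_
        · change (g.f t).f (j+1+1) (-(B.c t).d (j+1) b + (f.f t).f (j+1+1) v) =
            - (A'.c t).d (j+1) ((g.f t).f (j+1) b)
          rw [map_add, (h t).zero, add_zero, map_neg, (g.f t).comm]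
        · change ((R'.c t).d j r + (ι'.f t).f (j+1) ((g.f t).f (j+1) b)) + 0 = 
            (R'.c t).d j r + (ι'.f t).f (j+1) ((g.f t).f (j+1) b)
          rw [add_zero] }
  have hs : SES a b := by
    refine ⟨?_, ?_, ?_, ?_⟩
    · rintro j ⟨v, w⟩ hv
      have e1 : v = 0 := congrArg Prod.fst hv
      have e2 : (f.f t).f (j+1) w = 0 := congrArg (fun x => x.2.1) hv
      exact Prod.ext e1 ((h t).inj _ _ e2)
    · rintro j ⟨v, w⟩
      obtain ⟨b, hb⟩ := (h t).surj (j+1) v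
      exact ⟨(0, (b, w)), Prod.ext hb rfl⟩
    · rintro j ⟨v, w⟩
      exact Prod.ext ((h t).zero _ _) rfl
    · rintro j ⟨v, b, r⟩ hv
      have e1 : (g.f t).f (j+1) b = 0 := congrArg Prod.fst hv
      have e2 : r = 0 := congrArg Prod.snd hv
      obtain ⟨w, hw⟩ := (h t).exact _ _ e1
      exact ⟨(v, w), Prod.ext rfl (Prod.ext hw e2.symm)⟩
  exact hs.QE (Z_cone_id _)

def sh : ℕ → OpC K → OpC K
  | 0, A => A
  | n+1, A => oShift (sh n A)

def shHom {A B : OpC K} (f : OHom A B) : ∀ n, OHom (sh n A) (sh n B)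
  | 0 => f
  | n+1 => oShiftHom (shHom f n)

lemma shSES {A B C : OpC K} {f : OHom A B} {g : OHom B C} (h : oSES f g) (n) :
    oSES (shHom f n) (shHom g n) := by
  induction n with
  | zero => exact h
  | succ n ih => exact fun t => shiftSES (ih t)

lemma Good.sh {N : ℕ} {A : OpC K} (h : Good N A) (n) : Good N (sh n A) := by
  induction n with
  | zero => exact h
  | succ n ih => exact ih.shift

lemma hd_sh (A : OpC K) (n : ℕ) : ∀ (t j), hd ((sh n A).c t) j = hd (A.c t) (j+n) := by
  induction n with
  | zero => intro t j; simp [sh]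
  | succ n ih =>
    intro t j
    have := hd_shift_eq ((sh n A).c t) j
    rw [ih] at this
    refine this.trans ?_
    congr 1; push_cast; ring

lemma Z_sh (A : OpC K) (n : ℕ) : ∀ (t j), Z ((sh n A).c t) j ↔ Z (A.c t) (j+n) := by
  induction n with
  | zero => intro t j; simp [sh]
  | succ n ih =>
    intro t j
    have := Z_shift (A := (sh n A).c t) (j := j)
    rw [ih] at this
    refine this.trans ?_
    rw [show j + 1 + (n:ℤ) = j + (n+1 : ℕ) by push_cast; ring]

lemma FH_sh (A : OpC K) (n : ℕ) (t) (h : FH (A.c t)) : FH ((sh n A).c t) := by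
  induction n with
  | zero => exact h
  | succ n ih => exact FH_shift ih

lemma chi_sh (A : OpC K) (n : ℕ) (t) : chi ((sh n A).c t) = (-1)^n * chi (A.c t) := by
  induction n with
  | zero => simp [sh]
  | succ n ih => 
    have := chi_shift ((sh n A).c t)
    rw [ih] at this
    refine this.trans ?_
    ring

abbrev zCpx (K : Type) [Field K] : Cpx K where
  V _ := PUnit
  d _ := 0
  dd _ _ := rfl

abbrev zOpC (K : Type) [Field K] : OpC K where
  c _ := zCpx K
  op _ _ := Hom.zero _ _
  comm _ _ _ _ _ := rfl

lemma zGood (N : ℕ) : Good N (zOpC K) :=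
  Good.piece _ ⟨fun _ _ _ _ _ => rfl, fun _ _ => Hom.zero _ _, fun _ _ _ _ _ => rfl, fun _ _ _ => rfl⟩

lemma res_exists {N : ℕ} (n : ℕ) : ∀ (A B : ℕ → OpC K) (f : ∀ k, OHom (A k) (B k))
    (g : ∀ k, OHom (B k) (A (k+1))), (∀ k, k < n → oSES (f k) (g k)) → (∀ k, k < n → Good N (B k)) →
    ∃ (R : OpC K) (ι : OHom (sh n (A 0)) R), Good N R ∧
      ∀ t, QE (cone (ι.f t)) (shift ((A n).c t)) := by
  induction n with
  | zero =>
    intro A B f g _ _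
    refine ⟨zOpC K, ⟨fun t => Hom.zero _ _, fun _ _ _ _ => rfl⟩, zGood N, fun t => ?_⟩
    exact (coneSES _).QE (fun j v _ => ⟨0, rfl⟩)
  | succ n ih =>
    intro A B f g hs hB
    obtain ⟨R', ι', hR', hq⟩ := ih (fun k => A (k+1)) (fun k => B (k+1)) (fun k => f (k+1))
      (fun k => g (k+1)) (fun k hk => hs (k+1) (by omega)) (fun k hk => hB (k+1) (by omega))
    obtain ⟨R, ι, hR, hq2⟩ := res_step (shSES (hs 0 (by omega)) n) ((hB 0 (by omega)).sh n) hR' ι'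
    exact ⟨R, ι, hR, fun t => (hq2 t).trans (hq t)⟩

/-- Resolving `C` by good complexes modulo `E`. -/
theorem res_main {N n : ℕ} (A B : ℕ → OpC K) (f : ∀ k, OHom (A k) (B k))
    (g : ∀ k, OHom (B k) (A (k+1))) (hs : ∀ k, k < n → oSES (f k) (g k))
    (hB : ∀ k, k < n → Good N (B k)) :
    ∃ R : OpC K, Good N R ∧
      (∀ t j, Z ((A 0).c t) (j+n) → Z ((A n).c t) (j+1) → Z (R.c t) j) ∧
      (∀ t, FH ((A 0).c t) → FH ((A n).c t) → FH (R.c t) ∧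
        chi (R.c t) = (-1)^n * chi ((A 0).c t) - chi ((A n).c t)) ∧
      (∀ t j, FH ((A 0).c t) → FH ((A n).c t) → Z ((A 0).c t) (j+n) → Z (R.c t) (j+1) →
        hd ((A n).c t) (j+1) ≤ hd ((A 0).c t) (j+n+1) → Z (R.c t) j) := by
  obtain ⟨R, ι, hR, hq⟩ := res_exists n A B f g hs hB
  have hFH : ∀ t, FH ((A 0).c t) → FH ((A n).c t) → FH (R.c t) := fun t h0 h1 =>
    FH_left (coneSES (ι.f t)) ((hq t).FH (FH_shift h1)) (FH_shift (FH_sh _ n t h0))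
  refine ⟨R, hR, ?_, ?_, ?_⟩
  · intro t j h1 h2
    obtain ⟨j, rfl⟩ : ∃ i, j = i + 1 := ⟨j - 1, by ring⟩
    refine (coneSES (ι.f t)).Z_left j ?_ ?_
    · rw [Z_shift, Z_sh]; exact h1
    · rw [(hq t).Z, Z_shift]; exact h2
  · intro t h0 h1
    have h2 := hFH t h0 h1
    have h3 := chi_add (coneSES (ι.f t)) h2 (FH_shift (FH_sh _ n t h0))
    rw [(hq t).chi, chi_shift, chi_shift, chi_sh] at h3
    exact ⟨h2, by linarith⟩
  · intro t j h0 h1 hz hz' hle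
    have h2 := hFH t h0 h1
    have h3 := FH_shift (FH_sh (A 0) n t h0)
    obtain ⟨k, hk1, hk2, hk⟩ := hd_numbers (coneSES (ι.f t)) h2.fin h3.fin
    have e1 := hk j
    rw [(hq t).hd, hd_shift_eq, hd_shift_eq, hd_sh] at e1
    have e2 := hk1 (j+1)
    rw [hd_of_Z hz'] at e2
    have e3 := hk2 (j-1)
    rw [hd_shift_eq, hd_sh, sub_add_cancel, hd_of_Z hz] at e3
    apply (Z_of_hd (h2.fin j)).2
    have : j + 1 + (n:ℤ) = j + n + 1 := by ring
    rw [this] at e1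
    omega

end SB

namespace SB
variable {K : Type} [Field K] {n : ℕ}

/-- A graded module over the polynomial ring. -/
structure GM (K : Type) [Field K] (n : ℕ) where
  M : Type
  [acg : AddCommGroup M]
  [mods : Module (PolyS K n) M]
  [modk : Module K M]
  [tow : IsScalarTower K (PolyS K n) M]
  gr : ℤ → Submodule K M
  X_mem : ∀ i t m, m ∈ gr t → (MvPolynomial.X i : PolyS K n) • m ∈ gr (t+1)

attribute [instance] GM.acg GM.mods GM.modk GM.tow

lemma homogZ_neg {z : ℤ} (h : z < 0) : homogZ K n z = ⊥ := by
  unfold homogZ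
  exact iSup_neg (by omega)

lemma homogZ_nat (z : ℕ) : homogZ K n z = homogeneousSubmodule (Fin n) K z := by
  unfold homogZ
  simp

lemma mem_homogZ {z : ℤ} {a : PolyS K n} :
    a ∈ homogZ K n z ↔ ∀ e, MvPolynomial.coeff e a ≠ 0 → (e.degree : ℤ) = z := by
  rcases lt_or_ge z 0 with h | h
  · rw [homogZ_neg h, Submodule.mem_bot]
    constructor
    · rintro rfl e he; simp at he
    · intro H
      by_contra hne
      obtain ⟨e, he⟩ := MvPolynomial.ne_zero_iff.1 hne
      have := H e he
      omega
  · obtain ⟨k, rfl⟩ := Int.eq_ofNat_of_zero_le h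
    rw [homogZ_nat, mem_homogeneousSubmodule]
    constructor
    · intro H e he
      have := H he
      rw [← this, Finsupp.degree_eq_weight_one]; rfl
    · intro H e he
      have := H e he
      rw [← Nat.cast_inj (R := ℤ), ← this, Finsupp.degree_eq_weight_one]; rfl

lemma GM.mon_mem (G : GM K n) (e : Fin n →₀ ℕ) : ∀ (t : ℤ) (m : G.M), m ∈ G.gr t →
    (monomial e (1:K) : PolyS K n) • m ∈ G.gr (t + (e.degree : ℤ)) := by
  induction e using Finsupp.induction_linear with
  | zero => 
    intro t m hm
    have : (monomial 0 (1:K) : PolyS K n) = 1 := rfl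
    rw [this]; simpa using hm
  | add e f he hf =>
    intro t m hm
    have : (monomial (e+f) (1:K) : PolyS K n) = monomial e 1 * monomial f 1 := by
      rw [monomial_mul, one_mul]
    rw [this, mul_smul]
    have := he _ _ (hf t m hm)
    convert this using 2
    rw [map_add]; push_cast; ring
  | single i k =>
    induction k with
    | zero => 
      intro t m hm
      have : (monomial (Finsupp.single i 0) (1:K) : PolyS K n) = 1 := by
        rw [Finsupp.single_zero]; rfl
      rw [this]; simpa using hm
    | succ k ih =>
      intro t m hm
      have : (monomial (Finsupp.single i (k+1)) (1:K) : PolyS K n) =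
          monomial (Finsupp.single i k) 1 * MvPolynomial.X i := by
        rw [MvPolynomial.X, monomial_mul, one_mul, Finsupp.single_add]
      rw [this, mul_smul]
      have := ih _ _ (G.X_mem i t m hm)
      convert this using 2
      simp only [Finsupp.degree_single]
      push_cast; ring

lemma GM.smul_mem (G : GM K n) {z t : ℤ} {a : PolyS K n} (ha : a ∈ homogZ K n z) {m : G.M}
    (hm : m ∈ G.gr t) : a • m ∈ G.gr (t + z) := by
  rw [mem_homogZ] at ha
  rw [← MvPolynomial.support_sum_monomial_coeff a, Finset.sum_smul]
  refine Submodule.sum_mem _ fun e he => ?_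
  have h1 := ha e (MvPolynomial.mem_support_iff.1 he)
  have : (monomial e (MvPolynomial.coeff e a) : PolyS K n) =
      (MvPolynomial.coeff e a) • monomial e (1:K) := by
    rw [smul_monomial, smul_eq_mul, mul_one]
  rw [this, smul_assoc, ← h1]
  exact Submodule.smul_mem _ _ (G.mon_mem e t m hm)

section tens
variable (E : CoComplex K n)

def rkZ : ℤ → ℕ
  | Int.ofNat i => E.rk i
  | Int.negSucc _ => 0

def dgZ : (j : ℤ) → Fin (rkZ E j) → ℤ
  | Int.ofNat i => E.deg i
  | Int.negSucc _ => fun p => p.elim0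

def ddZ : (j : ℤ) → Matrix (Fin (rkZ E (j+1))) (Fin (rkZ E j)) (PolyS K n)
  | Int.ofNat i => E.dd i
  | Int.negSucc _ => 0

lemma ddZ_homog (j : ℤ) (p q) : ddZ E j p q ∈ homogZ K n (dgZ E j q - dgZ E (j+1) p) := by
  cases j with
  | ofNat i => exact E.isHomog i p q
  | negSucc i => exact q.elim0

lemma ddZ_comp (j : ℤ) : ddZ E (j+1) * ddZ E j = 0 := by
  cases j with
  | ofNat i => exact E.isComplex i
  | negSucc i => ext p q; exact q.elim0

variable (G : GM K n)

/-- The graded pieces of the tensor product of the complex with a module. -/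
abbrev TV (j t : ℤ) : Type := ∀ p : Fin (rkZ E j), G.gr (t - dgZ E j p)

def td (t j : ℤ) : TV E G j t →ₗ[K] TV E G (j+1) t :=
  LinearMap.pi fun q => LinearMap.codRestrict _
    (∑ p, (Algebra.lsmul K K G.M (ddZ E j q p)) ∘ₗ (G.gr (t - dgZ E j p)).subtype ∘ₗ LinearMap.proj p)
    (fun v => by
      rw [LinearMap.sum_apply]
      refine Submodule.sum_mem _ fun p _ => ?_
      have := G.smul_mem (ddZ_homog E j q p) (v p).2
      simp only [LinearMap.comp_apply, LinearMap.proj_apply, Submodule.subtype_apply,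
        Algebra.lsmul_coe]
      convert this using 2
      ring)

lemma td_apply (t j : ℤ) (v : TV E G j t) (q) :
    (td E G t j v q : G.M) = ∑ p, ddZ E j q p • (v p : G.M) := by
  simp [td]

def tx (i : ℕ) (t j : ℤ) : TV E G j t →ₗ[K] TV E G j (t+1) :=
  if hi : i < n then
    LinearMap.pi fun q => LinearMap.codRestrict _
      ((Algebra.lsmul K K G.M (MvPolynomial.X ⟨i, hi⟩ : PolyS K n)) ∘ₗ
        (G.gr (t - dgZ E j q)).subtype ∘ₗ LinearMap.proj q)
      (fun v => by
        have := G.X_mem ⟨i, hi⟩ _ _ (v q).2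
        simp only [LinearMap.comp_apply, LinearMap.proj_apply, Submodule.subtype_apply,
          Algebra.lsmul_coe]
        convert this using 2
        ring)
  else 0

/-- The variable, or zero. -/
def xv (K : Type) [Field K] (n i : ℕ) : PolyS K n := if hi : i < n then MvPolynomial.X ⟨i, hi⟩ else 0

lemma tx_apply (i : ℕ) (t j : ℤ) (v : TV E G j t) (q) :
    (tx E G i t j v q : G.M) = xv K n i • (v q : G.M) := by
  unfold tx xv
  split_ifs with h
  · simp
  · simp

lemma TV_ext {j t : ℤ} {v w : TV E G j t} (h : ∀ p, (v p : G.M) = w p) : v = w :=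
  funext fun p => Subtype.ext (h p)

abbrev tens : OpC K where
  c t :=
    { V := fun j => TV E G j t
      d := fun j => td E G t j
      dd := fun j v => by
        refine TV_ext E G fun q => ?_
        rw [td_apply]
        simp only [td_apply, Finset.smul_sum]
        rw [Finset.sum_comm]
        have h := ddZ_comp E j
        have : ∀ p, ∑ x, ddZ E (j+1) q x • ddZ E j x p • (v p : G.M) = 0 := by
          intro p
          have := congrFun (congrFun h q) p
          rw [Matrix.mul_apply] at this
          simp only [smul_smul]
          rw [← Finset.sum_smul, this]
          simp
        rw [Finset.sum_congr rfl fun p _ => this p]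
        simp }
  op i t :=
    { f := fun j => tx E G i t j
      comm := fun j v => by
        refine TV_ext E G fun q => ?_
        rw [tx_apply, td_apply, td_apply, Finset.smul_sum]
        refine Finset.sum_congr rfl fun p _ => ?_
        rw [tx_apply, smul_smul, smul_smul, mul_comm] }
  comm i k t j v := by
    refine TV_ext E G fun q => ?_
    change (tx E G i (t+1) j (tx E G k t j v) q : G.M) = (tx E G k (t+1) j (tx E G i t j v) q : G.M)
    rw [tx_apply, tx_apply, tx_apply, tx_apply, smul_smul, smul_smul, mul_comm]

variable {G} {G' : GM K n}

structure GHom (G G' : GM K n) where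
  f : G.M →ₗ[PolyS K n] G'.M
  mem : ∀ t m, m ∈ G.gr t → f m ∈ G'.gr t
  ksmul : ∀ (a : K) m, f (a • m) = a • f m

def tf (φ : GHom G G') (t j : ℤ) : TV E G j t →ₗ[K] TV E G' j t where
  toFun v p := ⟨φ.f (v p), φ.mem _ _ (v p).2⟩
  map_add' v w := by
    refine TV_ext E G' fun p => ?_
    simp
  map_smul' a w := by
    refine TV_ext E G' fun p => ?_
    simp [φ.ksmul]

lemma tf_apply (φ : GHom G G') (t j : ℤ) (v : TV E G j t) (p) : (tf E φ t j v p : G'.M) = φ.f (v p) := rfl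

abbrev tensHom (φ : GHom G G') : OHom (tens E G) (tens E G') where
  f t :=
    { f := fun j => tf E φ t j
      comm := fun j v => by
        refine TV_ext E G' fun q => ?_
        rw [tf_apply, td_apply, td_apply, map_sum]
        simp [tf_apply] }
  comm i t j v := by
    refine TV_ext E G' fun q => ?_
    change φ.f (tx E G i t j v q : G.M) = (tx E G' i t j (tf E φ t j v) q : G'.M)
    rw [tx_apply, tx_apply, map_smul, tf_apply]

structure GSES {G G' G'' : GM K n} (φ : GHom G G') (ψ : GHom G' G'') : Prop where
  inj : ∀ t m, m ∈ G.gr t → φ.f m = 0 → m = 0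
  surj : ∀ t m, m ∈ G''.gr t → ∃ w ∈ G'.gr t, ψ.f w = m
  zero : ∀ t m, m ∈ G.gr t → ψ.f (φ.f m) = 0
  exact : ∀ t m, m ∈ G'.gr t → ψ.f m = 0 → ∃ w ∈ G.gr t, φ.f w = m

lemma tensSES {G'' : GM K n} {φ : GHom G G'} {ψ : GHom G' G''} (h : GSES φ ψ) :
    oSES (tensHom E φ) (tensHom E ψ) := fun t => by
  refine ⟨?_, ?_, ?_, ?_⟩
  · intro j v hv
    refine TV_ext E G fun p => ?_
    exact h.inj _ _ (v p).2 (congrArg Subtype.val (congrFun hv p))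
  · intro j v
    choose w hw hw' using fun p => h.surj _ _ (v p).2
    exact ⟨fun p => ⟨w p, hw p⟩, TV_ext E G'' hw'⟩
  · intro j v
    exact TV_ext E G'' fun p => h.zero _ _ (v p).2
  · intro j v hv
    choose w hw hw' using fun p => h.exact _ _ (v p).2 (congrArg Subtype.val (congrFun hv p))
    exact ⟨fun p => ⟨w p, hw p⟩, TV_ext E G' hw'⟩

/-- A module on which a variable is invertible gives a good complex. -/
lemma tensGood (k : Fin n) (y : G.M →ₗ[PolyS K n] G.M) (hk : ∀ (a : K) m, y (a • m) = a • y m)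
    (hy : ∀ t m, m ∈ G.gr (t+1) → y m ∈ G.gr t)
    (hxy : ∀ t m, m ∈ G.gr t → y ((MvPolynomial.X k : PolyS K n) • m) = m) :
    Good n (tens E G) := by
  let yh : ∀ t j, TV E G j (t+1) →ₗ[K] TV E G j t := fun t j =>
    { toFun := fun v p => ⟨y (v p), hy _ _ (by
        have e : t - dgZ E j p + 1 = t + 1 - dgZ E j p := by ring
        rw [e]
        exact (v p).2)⟩
      map_add' := fun v w => TV_ext E G fun p => by simp
      map_smul' := fun a w => TV_ext E G fun p => by simp [hk] }
  have yh_apply : ∀ t j v p, (yh t j v p : G.M) = y (v p) := fun _ _ _ _ => rfl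
  refine Good.piece _ ⟨?_, fun i t => if i = k then ⟨fun j => yh t j, ?_⟩ else Hom.zero _ _, ?_, ?_⟩
  · intro i hi t j v
    refine TV_ext E G fun p => ?_
    refine (tx_apply E G i t j v p).trans ?_
    rw [xv, dif_neg (by omega), zero_smul]
    rfl
  · intro j v
    refine TV_ext E G fun q => ?_
    rw [yh_apply, td_apply, td_apply, map_sum]
    simp [yh_apply]
  · intro i l t j v
    split_ifs with h
    · refine TV_ext E G fun q => ?_
      change (tx E G l t j (yh t j v) q : G.M) = y (tx E G l (t+1) j v q)
      rw [tx_apply, tx_apply, map_smul, yh_apply]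
    · simp
  · intro t j v
    rw [Finset.sum_eq_single (k : ℕ)]
    · rw [if_pos rfl]
      refine TV_ext E G fun q => ?_
      change y (tx E G k t j v q) = _
      rw [tx_apply, xv, dif_pos k.2]
      exact hxy _ _ (v q).2
    · intro b _ hb
      rw [if_neg hb]; rfl
    · intro h
      exact absurd (Finset.mem_range.2 k.2) h

end tens
end SB

namespace SB
variable {K : Type} [Field K] {n : ℕ}

/-- Laurent polynomials. -/
abbrev Lr (K : Type) [Field K] (n : ℕ) : Type := AddMonoidAlgebra K (Fin n → ℤ)

/-- Laurent monomials. -/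
def lm (e : Fin n → ℤ) : Lr K n := AddMonoidAlgebra.single e 1

lemma lm_mul (e f : Fin n → ℤ) : (lm e : Lr K n) * lm f = lm (e + f) := by
  simp [lm, AddMonoidAlgebra.single_mul_single]

lemma lm_zero : (lm 0 : Lr K n) = 1 := rfl

def iot : PolyS K n →ₐ[K] Lr K n := MvPolynomial.aeval fun i => lm (Pi.single i 1)

instance : Module (PolyS K n) (Lr K n) := Module.compHom _ (iot (K := K) (n := n)).toRingHom

lemma lr_smul (a : PolyS K n) (w : Lr K n) : a • w = iot a * w := rfl

instance : IsScalarTower K (PolyS K n) (Lr K n) := ⟨fun a b c => by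
  rw [lr_smul, lr_smul, map_smul, smul_mul_assoc]⟩

lemma X_smul (i : Fin n) (w : Lr K n) : (MvPolynomial.X i : PolyS K n) • w = lm (Pi.single i 1) * w := by
  rw [lr_smul, iot, aeval_X]

lemma iot_monomial (e : Fin n →₀ ℕ) (c : K) :
    iot (monomial e c) = AddMonoidAlgebra.single (fun i => (e i : ℤ)) c := by
  have h1 : ∀ e : Fin n →₀ ℕ, iot (monomial e (1:K)) = lm (fun i => (e i : ℤ)) := by
    intro e
    induction e using Finsupp.induction_linear with
    | zero =>
      have : (monomial 0 (1:K) : PolyS K n) = 1 := rfl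
      rw [this, map_one]; rfl
    | add e f he hf =>
      have : (monomial (e+f) (1:K) : PolyS K n) = monomial e 1 * monomial f 1 := by
        rw [monomial_mul, one_mul]
      rw [this, map_mul, he, hf, lm_mul]
      congr 1
    | single i k =>
      have : (monomial (Finsupp.single i k) (1:K) : PolyS K n) = MvPolynomial.X i ^ k := by
        rw [MvPolynomial.X_pow_eq_monomial]
      rw [this, map_pow, iot, aeval_X]
      have h2 : ∀ k : ℕ, (lm (Pi.single i 1) : Lr K n) ^ k = lm (Pi.single i (k:ℤ)) := by
        intro k
        induction k with
        | zero => simp [lm_zero]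
        | succ k ih =>
          rw [pow_succ, ih, lm_mul, ← Pi.single_add]
          push_cast; rfl
      rw [h2]
      congr 1
      funext j
      by_cases h : j = i
      · subst h; simp
      · rw [Pi.single_eq_of_ne h, Finsupp.single_eq_of_ne h]; rfl
  have : (monomial e c : PolyS K n) = c • monomial e 1 := by
    rw [smul_monomial, smul_eq_mul, mul_one]
  rw [this, map_smul, h1, lm, AddMonoidAlgebra.smul_single, smul_eq_mul, mul_one]

lemma lm_mul_coeff (e f : Fin n → ℤ) (w : Lr K n) : (lm e * w).coeff (e + f) = w.coeff f := by
  rw [lm, AddMonoidAlgebra.coeff_single_mul_eq_mul_coeff f (by simp), one_mul]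

lemma lm_mul_coeff' (e f : Fin n → ℤ) (w : Lr K n) : (lm e * w).coeff f = w.coeff (f - e) := by
  rw [← lm_mul_coeff e (f - e) w, add_sub_cancel]

/-- Elements supported in a set. -/
def sp (K : Type) [Field K] {n : ℕ} (T : Set (Fin n → ℤ)) : Submodule K (Lr K n) where
  carrier := {w | ∀ e, e ∉ T → w.coeff e = 0}
  add_mem' {a b} ha hb e he := by
    rw [AddMonoidAlgebra.coeff_add, Finsupp.add_apply, ha e he, hb e he, add_zero]
  zero_mem' e he := by simp
  smul_mem' c a ha e he := by
    rw [AddMonoidAlgebra.coeff_smul, Finsupp.smul_apply, ha e he, smul_zero]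

lemma mem_sp {T : Set (Fin n → ℤ)} {w : Lr K n} : w ∈ sp K T ↔ ∀ e, e ∉ T → w.coeff e = 0 := Iff.rfl

lemma sp_mono {T T' : Set (Fin n → ℤ)} (h : T ⊆ T') : sp K T ≤ sp K T' :=
  fun w hw e he => hw e fun h' => he (h h')

lemma sp_lm {T T' : Set (Fin n → ℤ)} {a : Fin n → ℤ} (h : ∀ e ∈ T, a + e ∈ T') {w : Lr K n}
    (hw : w ∈ sp K T) : lm a * w ∈ sp K T' := by
  intro e he
  rw [lm_mul_coeff']
  apply hw
  intro h'
  apply he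
  simpa using h _ h'

/-- Restriction of the support. -/
def rs (T : Set (Fin n → ℤ)) (w : Lr K n) : Lr K n :=
  open Classical in AddMonoidAlgebra.ofCoeff (w.coeff.filter (· ∈ T))

lemma rs_coeff (T : Set (Fin n → ℤ)) (w : Lr K n) (e) [Decidable (e ∈ T)] :
    (rs T w).coeff e = if e ∈ T then w.coeff e else 0 := by
  classical
  unfold rs
  rw [AddMonoidAlgebra.coeff_ofCoeff, Finsupp.filter_apply]
  congr

/-- Exponents with a nonnegative entry among the first `k`. -/
def Tk (n k : ℕ) : Set (Fin n → ℤ) := {e | ∃ i : Fin n, (i:ℕ) < k ∧ 0 ≤ e i}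

/-- Exponents, nonnegative from `k` on, of given sum. -/
def Us (n k : ℕ) (t : ℤ) : Set (Fin n → ℤ) := {e | (∀ i : Fin n, k ≤ (i:ℕ) → 0 ≤ e i) ∧ ∑ i, e i = t}

def Wk (K : Type) [Field K] (n k : ℕ) : Submodule (PolyS K n) (Lr K n) where
  carrier := sp K (Tk n k)
  add_mem' := (sp K (Tk n k)).add_mem
  zero_mem' := (sp K (Tk n k)).zero_mem
  smul_mem' a w hw := by
    induction a using MvPolynomial.induction_on with
    | C a => 
      have : (MvPolynomial.C a : PolyS K n) • w = a • w := by
        rw [← algebraMap_smul (PolyS K n) a w]; rfl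
      rw [this]; exact (sp K (Tk n k)).smul_mem _ hw
    | add p q hp hq => rw [add_smul]; exact (sp K (Tk n k)).add_mem hp hq
    | mul_X p i hp => 
      rw [mul_comm, mul_smul, X_smul]
      refine sp_lm ?_ hp
      rintro e ⟨l, hl, h0⟩
      refine ⟨l, hl, ?_⟩
      have : 0 ≤ (Pi.single i 1 : Fin n → ℤ) l := by
        by_cases h : l = i
        · subst h; simp
        · rw [Pi.single_eq_of_ne h]
      simp only [Pi.add_apply]; omega

lemma mem_Wk {k : ℕ} {w : Lr K n} : w ∈ Wk K n k ↔ w ∈ sp K (Tk n k) := Iff.rfl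

abbrev Qk (K : Type) [Field K] (n k : ℕ) : Type := Lr K n ⧸ Wk K n k

def mkk (K : Type) [Field K] (n k : ℕ) : Lr K n →ₗ[PolyS K n] Qk K n k := (Wk K n k).mkQ

def mkK (K : Type) [Field K] (n k : ℕ) : Lr K n →ₗ[K] Qk K n k :=
  (mkk K n k).restrictScalars K

lemma sum_X (i : Fin n) (c : ℤ) (e : Fin n → ℤ) : ∑ j, ((Pi.single i c : Fin n → ℤ) + e) j = ∑ j, e j + c := by
  simp only [Pi.add_apply, Finset.sum_add_distrib]
  have : ∑ x, (Pi.single i c : Fin n → ℤ) x = c := by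
    rw [Finset.sum_eq_single i] <;> simp +contextual [Pi.single_apply]
  rw [this, add_comm]

abbrev gmk (K : Type) [Field K] (n k k' : ℕ) : GM K n where
  M := Qk K n k
  gr t := (sp K (Us n k' t)).map (mkK K n k)
  X_mem i t m hm := by
    obtain ⟨w, hw, rfl⟩ := hm
    refine ⟨lm (Pi.single i 1) * w, sp_lm ?_ hw, ?_⟩
    · rintro e ⟨h1, h2⟩
      refine ⟨fun l hl => ?_, ?_⟩
      · have : 0 ≤ (Pi.single i 1 : Fin n → ℤ) l := by
          by_cases h : l = i
          · subst h; simp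
          · rw [Pi.single_eq_of_ne h]
        have := h1 l hl
        simp only [Pi.add_apply]; omega
      · rw [sum_X, h2]
    · rw [← X_smul]
      exact map_smul (mkk K n k) _ _

lemma Tk_mono {k l : ℕ} (h : k ≤ l) : Tk n k ⊆ Tk n l := fun _ ⟨i, hi, h0⟩ => ⟨i, by omega, h0⟩
lemma Us_mono {k l : ℕ} (h : k ≤ l) (t) : Us n k t ⊆ Us n l t := fun _ ⟨h1, h2⟩ =>
  ⟨fun i hi => h1 i (by omega), h2⟩

def gin (K : Type) [Field K] (n k : ℕ) : GHom (gmk K n k k) (gmk K n k (k+1)) where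
  f := LinearMap.id
  mem t m hm := Submodule.map_mono (sp_mono (Us_mono (by omega) t)) hm
  ksmul _ _ := rfl

def gout (K : Type) [Field K] (n k : ℕ) : GHom (gmk K n k (k+1)) (gmk K n (k+1) (k+1)) where
  f := Submodule.factor (sp_mono (Tk_mono (by omega)) : Wk K n k ≤ Wk K n (k+1))
  mem t m hm := by
    obtain ⟨w, hw, rfl⟩ := hm
    exact ⟨w, hw, rfl⟩
  ksmul a m := by
    rw [← algebraMap_smul (PolyS K n) a m, map_smul, algebraMap_smul]

lemma gout_mk (k : ℕ) (w : Lr K n) : (gout K n k).f (mkK K n k w) = mkK K n (k+1) w := rfl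

lemma mkK_eq_zero {k : ℕ} {w : Lr K n} : mkK K n k w = 0 ↔ w ∈ sp K (Tk n k) :=
  Submodule.Quotient.mk_eq_zero (Wk K n k)

/-- Splitting an element of the kernel. -/
lemma split_ker {k : ℕ} (t : ℤ) (w : Lr K n) (hw : w ∈ sp K (Us n (k+1) t))
    (h0 : w ∈ sp K (Tk n (k+1))) : ∃ w' ∈ sp K (Us n k t), mkK K n k w' = mkK K n k w := by
  classical
  refine ⟨rs (Us n k t) w, ?_, ?_⟩
  · intro e he
    rw [rs_coeff, if_neg he]
  · rw [← sub_eq_zero, ← map_sub, mkK_eq_zero]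
    intro e he
    rw [AddMonoidAlgebra.coeff_sub, Finsupp.sub_apply, rs_coeff]
    split_ifs with h
    · rw [sub_self]
    · rw [zero_sub, neg_eq_zero]
      by_contra hne
      have h1 : e ∈ Us n (k+1) t := by by_contra hh; exact hne (hw e hh)
      have h2 : e ∈ Tk n (k+1) := by by_contra hh; exact hne (h0 e hh)
      apply h
      refine ⟨fun i hi => ?_, h1.2⟩
      obtain ⟨l, hl, hl0⟩ := h2
      have : ¬ ((l:ℕ) < k) := fun hh => he ⟨l, hh, hl0⟩
      rcases Nat.lt_or_ge k i with hlt | hge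
      · exact h1.1 i hlt
      · have : i = l := Fin.ext (by omega)
        rw [this]; exact hl0

lemma gses (k : ℕ) (hk : k < n) : GSES (gin K n k) (gout K n k) where
  inj t m _ h := h
  surj t m hm := by
    obtain ⟨w, hw, rfl⟩ := hm
    exact ⟨mkK K n k w, ⟨w, hw, rfl⟩, rfl⟩
  zero t m hm := by
    obtain ⟨w, hw, rfl⟩ := hm
    change mkK K n (k+1) w = 0
    rw [mkK_eq_zero]
    intro e he
    by_contra hne
    have h1 : e ∈ Us n k t := by by_contra hh; exact hne (hw e hh)
    exact he ⟨⟨k, hk⟩, Nat.lt_succ_self k, h1.1 ⟨k, hk⟩ le_rfl⟩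
  exact t m hm h := by
    obtain ⟨w, hw, rfl⟩ := hm
    change mkK K n (k+1) w = 0 at h
    rw [mkK_eq_zero] at h
    obtain ⟨w', h1, h2⟩ := split_ker t w hw h
    exact ⟨mkK K n k w', ⟨w', h1, rfl⟩, h2⟩

lemma iot_coeff (a : PolyS K n) (e : Fin n →₀ ℕ) :
    (iot a).coeff (fun i => (e i : ℤ)) = MvPolynomial.coeff e a := by
  classical
  induction a using MvPolynomial.induction_on' with
  | monomial f c =>
    rw [iot_monomial, AddMonoidAlgebra.coeff_single, Finsupp.single_apply, coeff_monomial]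
    have : ((fun i => (f i : ℤ)) = (fun i => (e i : ℤ))) ↔ f = e := by
      constructor
      · intro h
        ext i
        exact_mod_cast congrFun h i
      · rintro rfl; rfl
    simp only [this]
  | add p q hp hq =>
    rw [map_add, AddMonoidAlgebra.coeff_add, Finsupp.add_apply, hp, hq, MvPolynomial.coeff_add]

lemma iot_coeff_neg (a : PolyS K n) (e : Fin n → ℤ) (i : Fin n) (h : e i < 0) :
    (iot a).coeff e = 0 := by
  classical
  induction a using MvPolynomial.induction_on' with
  | monomial f c =>
    rw [iot_monomial, AddMonoidAlgebra.coeff_single, Finsupp.single_apply, if_neg]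
    rintro rfl
    simp at h; omega
  | add p q hp hq =>
    rw [map_add, AddMonoidAlgebra.coeff_add, Finsupp.add_apply, hp, hq, add_zero]

lemma nonneg_lift (e : Fin n → ℤ) (h : ∀ i, 0 ≤ e i) :
    ∃ f : Fin n →₀ ℕ, e = fun i => (f i : ℤ) :=
  ⟨Finsupp.equivFunOnFinite.symm fun i => (e i).toNat, by
    funext i; simp [h i]⟩

lemma degree_cast (f : Fin n →₀ ℕ) : ((f.degree : ℕ) : ℤ) = ∑ i, (f i : ℤ) := by
  rw [Finsupp.degree_eq_sum]; push_cast; rfl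

lemma iot_mem (a : PolyS K n) (t : ℤ) : iot a ∈ sp K (Us n 0 t) ↔ a ∈ homogZ K n t := by
  rw [mem_homogZ]
  constructor
  · intro h e he
    rw [degree_cast]
    by_contra hne
    apply he
    rw [← iot_coeff]
    exact h _ fun h' => hne h'.2
  · intro h e he
    by_cases hp : ∀ i, 0 ≤ e i
    · obtain ⟨f, rfl⟩ := nonneg_lift e hp
      rw [iot_coeff]
      by_contra hne
      exact he ⟨fun i _ => hp i, by rw [← degree_cast]; exact h f hne⟩
    · push Not at hp
      obtain ⟨i, hi⟩ := hp
      exact iot_coeff_neg a e i hi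

lemma iot_surj (w : Lr K n) (t : ℤ) (h : w ∈ sp K (Us n 0 t)) : ∃ a ∈ homogZ K n t, iot a = w := by
  have : ∃ a, iot a = w := by
    have hw : w = ∑ e ∈ w.coeff.support, AddMonoidAlgebra.single e (w.coeff e) :=
      (AddMonoidAlgebra.sum_coeff_single w).symm
    refine ⟨∑ e ∈ w.coeff.support, monomial (Finsupp.equivFunOnFinite.symm fun i => (e i).toNat)
      (w.coeff e), ?_⟩
    rw [map_sum]
    refine Eq.trans (Finset.sum_congr rfl fun e he => ?_) hw.symm
    rw [iot_monomial]
    congr 1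
    funext i
    have : 0 ≤ e i := by
      have : e ∈ Us n 0 t := by
        by_contra hh
        exact (Finsupp.mem_support_iff.1 he) (h e hh)
      exact this.1 i (Nat.zero_le _)
    simp [this]
  obtain ⟨a, rfl⟩ := this
  exact ⟨a, (iot_mem a t).1 h, rfl⟩

lemma sp_Tk0 {w : Lr K n} (h : w ∈ sp K (Tk n 0)) : w = 0 := by
  apply AddMonoidAlgebra.ext
  ext e
  exact h e (fun ⟨i, hi, _⟩ => by omega)

/-- The polynomial ring as a graded module. -/
abbrev sGM (K : Type) [Field K] (n : ℕ) : GM K n where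
  M := PolyS K n
  gr t := homogZ K n t
  X_mem i t m hm := by
    rw [← iot_mem] at hm ⊢
    rw [smul_eq_mul, map_mul, iot, aeval_X]
    refine sp_lm ?_ hm
    rintro e ⟨h1, h2⟩
    refine ⟨fun l hl => ?_, ?_⟩
    · have : 0 ≤ (Pi.single i 1 : Fin n → ℤ) l := by
        by_cases h : l = i
        · subst h; simp
        · rw [Pi.single_eq_of_ne h]
      have := h1 l hl
      simp only [Pi.add_apply]; omega
    · rw [sum_X, h2]

def sinn (K : Type) [Field K] (n : ℕ) : GHom (sGM K n) (gmk K n 0 1) where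
  f := (mkk K n 0) ∘ₗ
    { toFun := fun a => iot a
      map_add' := map_add _
      map_smul' := fun a b => by
        rw [smul_eq_mul, map_mul]; rfl }
  mem t m hm := ⟨iot m, sp_mono (Us_mono (by omega) t) ((iot_mem m t).2 hm), rfl⟩
  ksmul a m := by
    change mkK K n 0 (iot (a • m)) = a • mkK K n 0 (iot m)
    rw [map_smul, map_smul]

lemma sses (hk : 0 < n) : GSES (sinn K n) (gout K n 0) where
  inj t m _ h := by
    have h : mkK K n 0 (iot m) = 0 := h
    rw [mkK_eq_zero] at h
    have h := sp_Tk0 h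
    ext e
    rw [← iot_coeff, h]; simp
  surj := (gses 0 hk).surj
  zero t m hm := (gses 0 hk).zero t (mkK K n 0 (iot m)) ⟨iot m, (iot_mem m t).2 hm, rfl⟩
  exact t m hm h := by
    obtain ⟨w, ⟨w', hw', rfl⟩, rfl⟩ := (gses 0 hk).exact t m hm h
    obtain ⟨a, ha, rfl⟩ := iot_surj w' t hw'
    exact ⟨a, ha, rfl⟩

/-- The modules in the resolution. -/
abbrev Gk (K : Type) [Field K] (n : ℕ) : ℕ → GM K n
  | 0 => sGM K n
  | k+1 => gmk K n (k+1) (k+1)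

def Gin (K : Type) [Field K] (n : ℕ) : (k : ℕ) → GHom (Gk K n k) (gmk K n k (k+1))
  | 0 => sinn K n
  | k+1 => gin K n (k+1)

def Gout (K : Type) [Field K] (n : ℕ) (k : ℕ) : GHom (gmk K n k (k+1)) (Gk K n (k+1)) := gout K n k

lemma Gses (k : ℕ) (hk : k < n) : GSES (Gin K n k) (Gout K n k) := by
  cases k with
  | zero => exact sses hk
  | succ k => exact gses _ hk

/-- Multiplication by an inverse variable. -/
def yinv0 (K : Type) [Field K] (n k : ℕ) (hk : k < n) : Lr K n →ₗ[PolyS K n] Lr K n where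
  toFun w := lm (Pi.single ⟨k, hk⟩ (-1)) * w
  map_add' a b := mul_add _ _ _
  map_smul' a b := by
    rw [lr_smul, RingHom.id_apply, lr_smul]; ring

def yinv (K : Type) [Field K] (n k : ℕ) (hk : k < n) : Qk K n k →ₗ[PolyS K n] Qk K n k :=
  (Wk K n k).mapQ (Wk K n k) (yinv0 K n k hk) (by
    intro w hw
    refine sp_lm ?_ hw
    rintro e ⟨i, hi, h0⟩
    refine ⟨i, hi, ?_⟩
    rw [Pi.add_apply, Pi.single_eq_of_ne (by intro h; subst h; simp at hi), zero_add]
    exact h0)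

lemma yinv_mk (k : ℕ) (hk : k < n) (w : Lr K n) : yinv K n k hk (mkK K n k w) =
    mkK K n k (lm (Pi.single ⟨k, hk⟩ (-1)) * w) := rfl

lemma gmkGood (E : CoComplex K n) (k : ℕ) (hk : k < n) : Good n (tens E (gmk K n k (k+1))) := by
  refine tensGood E ⟨k, hk⟩ (yinv K n k hk) ?_ ?_ ?_
  · intro a m
    rw [← algebraMap_smul (PolyS K n) a m, map_smul, algebraMap_smul]
  · rintro t m ⟨w, hw, rfl⟩
    refine ⟨_, sp_lm ?_ hw, (yinv_mk k hk w).symm⟩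
    rintro e ⟨h1, h2⟩
    refine ⟨fun l hl => ?_, ?_⟩
    · rw [Pi.add_apply, Pi.single_eq_of_ne (by intro h; subst h; simp at hl), zero_add]
      exact h1 l hl
    · rw [sum_X, h2]; ring
  · rintro t m ⟨w, hw, rfl⟩
    have : (MvPolynomial.X ⟨k, hk⟩ : PolyS K n) • (mkK K n k w) =
      mkK K n k (lm (Pi.single ⟨k, hk⟩ 1) * w) := by
      rw [← X_smul]
      exact (map_smul (mkk K n k) _ _).symm
    refine (congrArg (yinv K n k hk) this).trans ?_
    rw [yinv_mk, ← mul_assoc, lm_mul, ← Pi.single_add]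
    simp [lm_zero]

end SB

namespace SB
variable {K : Type} [Field K] {n : ℕ}

def HFn (n : ℕ) (s : ℤ) : ℕ := (Us n 0 s).ncard

lemma sp_eq (T : Set (Fin n → ℤ)) : sp K T = AddMonoidAlgebra.supported K K T := by
  ext w
  rw [mem_sp, AddMonoidAlgebra.mem_supported]
  constructor
  · intro h e he
    by_contra hh
    exact (Finsupp.mem_support_iff.1 he) (h e hh)
  · intro h e he
    by_contra hh
    exact he (h (Finsupp.mem_support_iff.2 hh))

lemma sp_fin {T : Set (Fin n → ℤ)} (hT : T.Finite) :
    FiniteDimensional K (sp K T) ∧ finrank K (sp K T) = T.ncard := by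
  rw [sp_eq]
  haveI := hT.to_subtype
  haveI : FiniteDimensional K (T →₀ K) := by
    haveI := Fintype.ofFinite T
    infer_instance
  refine ⟨(AddMonoidAlgebra.supportedEquivFinsupp (R := K) (S := K) T).symm.finiteDimensional, ?_⟩
  rw [(AddMonoidAlgebra.supportedEquivFinsupp (R := K) (S := K) T).finrank_eq]
  haveI := Fintype.ofFinite T
  rw [Module.finrank_finsupp_self, ← Nat.card_eq_fintype_card, Nat.card_coe_set_eq]

lemma Us_image (k : ℕ) : Us n 0 (k : ℤ) = (fun (f : Fin n →₀ ℕ) => (fun i => (f i : ℤ))) ''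
    ((Finset.univ : Finset (Fin n)).finsuppAntidiag k : Set (Fin n →₀ ℕ)) := by
  ext e
  constructor
  · rintro ⟨h1, h2⟩
    obtain ⟨f, rfl⟩ := nonneg_lift e fun i => h1 i (Nat.zero_le _)
    refine ⟨f, ?_, rfl⟩
    rw [Finset.mem_coe, Finset.mem_finsuppAntidiag]
    exact ⟨by have h3 : ∑ i, (f i : ℤ) = k := h2
              exact_mod_cast h3, by simp⟩
  · rintro ⟨f, hf, rfl⟩
    rw [Finset.mem_coe, Finset.mem_finsuppAntidiag] at hf
    exact ⟨fun i _ => by simp, by show ∑ i, (f i : ℤ) = k; exact_mod_cast hf.1⟩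

lemma Us_neg {s : ℤ} (h : s < 0) : Us n 0 s = ∅ := by
  ext e
  simp only [Set.mem_empty_iff_false, iff_false]
  rintro ⟨h1, h2⟩
  have : 0 ≤ ∑ i, e i := Finset.sum_nonneg fun i _ => h1 i (Nat.zero_le _)
  omega

lemma Us_fin (s : ℤ) : (Us n 0 s).Finite := by
  rcases lt_or_ge s 0 with h | h
  · rw [Us_neg h]; exact Set.finite_empty
  · obtain ⟨k, rfl⟩ := Int.eq_ofNat_of_zero_le h
    rw [Us_image]
    exact (Finset.finite_toSet _).image _

lemma HFn_neg {s : ℤ} (h : s < 0) : HFn n s = 0 := by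
  rw [HFn, Us_neg h, Set.ncard_empty]

lemma HFn_nat (m k : ℕ) : HFn (m+1) k = (k+m).choose m := by
  rw [HFn, Us_image, Set.ncard_image_of_injective, Set.ncard_coe_finset,
    Finset.card_finsuppAntidiag_nat_eq_choose]
  · rw [Finset.card_univ, Fintype.card_fin]
    rw [show m + 1 + k - 1 = k + m by omega, Nat.choose_symm_add]
  · intro f g h
    ext i
    have h3 : (f i : ℤ) = g i := congrFun h i
    exact_mod_cast h3

lemma homogZ_fin (s : ℤ) : FiniteDimensional K (homogZ K n s) ∧ finrank K (homogZ K n s) = HFn n s := by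
  have hi : Function.Injective (iot (K := K) (n := n)).toLinearMap := by
    intro a b h
    ext e
    rw [← iot_coeff, ← iot_coeff]
    exact congrArg (fun w : Lr K n => w.coeff (fun i => (e i : ℤ))) h
  have hm : (homogZ K n s).map (iot (K := K) (n := n)).toLinearMap = sp K (Us n 0 s) := by
    ext w
    constructor
    · rintro ⟨a, ha, rfl⟩
      exact (iot_mem a s).2 ha
    · intro h
      obtain ⟨a, ha, rfl⟩ := iot_surj w s h
      exact ⟨a, ha, rfl⟩
  have e := (homogZ K n s).equivMapOfInjective _ hi
  rw [hm] at e
  obtain ⟨h1, h2⟩ := sp_fin (K := K) (Us_fin (n := n) s)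
  exact ⟨e.symm.finiteDimensional, e.finrank_eq.trans h2⟩

instance (s : ℤ) : FiniteDimensional K (homogZ K n s) := (homogZ_fin s).1

lemma gmk_fin (s : ℤ) : FiniteDimensional K ((gmk K n n n).gr s) ∧
    finrank K ((gmk K n n n).gr s) = HFn n (-s-n) := by
  classical
  set N : Set (Fin n → ℤ) := {e | (∀ i, e i < 0) ∧ ∑ i, e i = s} with hN
  have hb : N = (fun e : Fin n → ℤ => fun i => -1 - e i) '' Us n 0 (-s-n) := by
    ext e
    constructor
    · rintro ⟨h1, h2⟩
      refine ⟨fun i => -1 - e i, ⟨fun i _ => by have := h1 i; show 0 ≤ -1 - e i; omega, ?_⟩, ?_⟩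
      · rw [Finset.sum_sub_distrib, h2]; simp; ring
      · funext i; ring
    · rintro ⟨f, ⟨h1, h2⟩, rfl⟩
      refine ⟨fun i => by have := h1 i (Nat.zero_le _); show -1 - f i < 0; omega, ?_⟩
      rw [Finset.sum_sub_distrib, h2]; simp; ring
  have hfin : N.Finite := by rw [hb]; exact (Us_fin _).image _
  have hcard : N.ncard = HFn n (-s-n) := by
    rw [hb, Set.ncard_image_of_injective]
    · rfl
    · intro f g h
      funext i
      have := congrFun h i
      simp only at this
      omega
  have hm : (gmk K n n n).gr s = (sp K N).map (mkK K n n) := by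
    apply le_antisymm
    · rintro _ ⟨w, hw, rfl⟩
      refine ⟨rs N w, fun e he => by rw [rs_coeff, if_neg he], ?_⟩
      rw [← sub_eq_zero, ← map_sub, mkK_eq_zero]
      intro e he
      rw [AddMonoidAlgebra.coeff_sub, Finsupp.sub_apply, rs_coeff]
      split_ifs with h
      · rw [sub_self]
      · rw [zero_sub, neg_eq_zero]
        apply hw
        intro h'
        apply h
        refine ⟨fun i => ?_, h'.2⟩
        by_contra hh
        exact he ⟨i, i.2, by omega⟩
    · refine Submodule.map_mono (sp_mono ?_)
      rintro e ⟨h1, h2⟩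
      exact ⟨fun i hi => absurd i.2 (by omega), h2⟩
  have hinj : Function.Injective ((mkK K n n).domRestrict (sp K N)) := by
    rw [← LinearMap.ker_eq_bot, LinearMap.ker_eq_bot']
    rintro ⟨w, hw⟩ h
    have h : mkK K n n w = 0 := h
    rw [mkK_eq_zero] at h
    apply Subtype.ext
    change w = 0
    apply AddMonoidAlgebra.ext
    ext e
    by_cases he : e ∈ N
    · exact h e (fun ⟨i, _, h0⟩ => by have := he.1 i; omega)
    · exact hw e he
  have e := LinearEquiv.ofInjective _ hinj
  rw [LinearMap.range_domRestrict, ← hm] at e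
  obtain ⟨h1, h2⟩ := sp_fin (K := K) hfin
  exact ⟨e.finiteDimensional, e.symm.finrank_eq.trans (h2.trans hcard)⟩

lemma genHilb_eval (m : ℕ) (a t : ℤ) : (genHilb (m+1) a).eval (t : ℚ) =
    (HFn (m+1) (t-a) : ℚ) + (-1)^m * (HFn (m+1) (-(t-a)-(m+1:ℕ)) : ℚ) := by
  have h0 : (genHilb (m+1) a).eval (t : ℚ) = ((m.factorial : ℚ))⁻¹ *
      ∏ k ∈ Finset.range m, (((t - a : ℤ) : ℚ) + ((k:ℚ) + 1)) := by
    unfold genHilb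
    rw [if_neg (by omega)]
    simp [Polynomial.eval_prod]
  have key : ∀ k : ℕ, ((m.factorial : ℚ))⁻¹ * ∏ i ∈ Finset.range m, ((k : ℚ) + ((i:ℚ) + 1)) =
      ((k+m).choose m : ℚ) := by
    intro k
    have h1 : ∏ i ∈ Finset.range m, ((k : ℚ) + ((i:ℚ) + 1)) = ((k+1).ascFactorial m : ℚ) := by
      rw [Nat.ascFactorial_eq_prod_range]
      push_cast
      exact Finset.prod_congr rfl fun i _ => by ring
    rw [h1, Nat.ascFactorial_eq_factorial_mul_choose]
    have : (m.factorial : ℚ) ≠ 0 := by exact_mod_cast Nat.factorial_ne_zero m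
    push_cast
    field_simp
  rw [h0]
  generalize t - a = x
  rcases lt_or_ge x 0 with hx | hx
  · rw [HFn_neg hx]
    rcases lt_or_ge (-x - (m+1:ℕ)) 0 with hy | hy
    · rw [HFn_neg hy]
      have : ∏ k ∈ Finset.range m, ((x : ℚ) + ((k:ℚ) + 1)) = 0 := by
        obtain ⟨k, hk⟩ := Int.eq_ofNat_of_zero_le (show 0 ≤ -x - 1 by omega)
        refine Finset.prod_eq_zero (i := k) (Finset.mem_range.2 (by push_cast at hy; omega)) ?_
        have : x = -(k:ℤ) - 1 := by omega
        rw [this]; push_cast; ring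
      rw [this]; simp
    · obtain ⟨y, hy'⟩ := Int.eq_ofNat_of_zero_le hy
      rw [hy', HFn_nat, ← key]
      have : ∏ k ∈ Finset.range m, ((x : ℚ) + ((k:ℚ) + 1)) =
          (-1)^m * ∏ i ∈ Finset.range m, ((y : ℚ) + ((i:ℚ) + 1)) := by
        rw [← Finset.prod_range_reflect (fun i => ((y : ℚ) + ((i:ℚ) + 1)))]
        have hc : ((-1 : ℚ))^m = ∏ i ∈ Finset.range m, (-1 : ℚ) := by simp
        rw [hc, ← Finset.prod_mul_distrib]
        refine Finset.prod_congr rfl fun i hi => ?_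
        have hi := Finset.mem_range.1 hi
        have h1 : ((m - 1 - i : ℕ) : ℚ) = m - 1 - i := by
          rw [Nat.cast_sub (by omega), Nat.cast_sub (by omega)]; simp
        have h2 : (x : ℚ) = -(y : ℚ) - (m + 1) := by
          have : x = -(y:ℤ) - (m+1) := by push_cast at hy'; omega
          rw [this]; push_cast; ring
        rw [h1, h2]; ring
      rw [this]; push_cast; ring
  · obtain ⟨k, rfl⟩ := Int.eq_ofNat_of_zero_le hx
    rw [HFn_nat, HFn_neg (by push_cast; omega), ← key]
    push_cast; ring
end SB

namespace SB
variable {K : Type} [Field K] {n : ℕ}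

/-! Numerics -/

lemma fd_poly (W : Polynomial ℚ) (p : ℕ) (h : W.natDegree ≤ p) (x : ℚ) :
    (fwdDiff (1:ℚ))^[p] W.eval x = p.factorial * W.coeff p := by
  rcases h.lt_or_eq with h | h
  · rw [Polynomial.fwdDiff_iter_eq_zero_of_degree_lt h, Polynomial.coeff_eq_zero_of_natDegree_lt h]
    simp
  · subst h
    rw [Polynomial.fwdDiff_iter_degree_eq_factorial]
    simp [mul_comm]

lemma num {m : ℕ} (hm : 0 < m) (Q : Polynomial ℚ) (hQ : Q.natDegree ≤ m) (S : Finset ℤ)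
    (hS : S.card = m) (lo : ℤ) (p : ℕ) (hlo : S ⊆ Finset.Icc lo (lo + p)) (f : ℤ → ℤ)
    (hf : ∀ t, (f t : ℚ) = Q.eval (t : ℚ)) :
    (((fwdDiff (1:ℤ))^[p] (fun t => f t * ∏ z ∈ Finset.Icc lo (lo+p) \ S, (t - z)) lo : ℤ) : ℚ) =
      p.factorial * (Q.coeff (m-1) + Q.coeff m * ∑ z ∈ S, (z : ℚ)) := by
  set L := Finset.Icc lo (lo+p) \ S with hL
  have hcard : L.card + m = p + 1 := by
    have hdis : Disjoint L S := Finset.sdiff_disjoint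
    have hU : L ∪ S = Finset.Icc lo (lo+p) := Finset.sdiff_union_of_subset hlo
    rw [← hS, ← Finset.card_union_of_disjoint hdis, hU]
    simp; omega
  set PS : Polynomial ℚ := ∏ z ∈ S, (Polynomial.X - Polynomial.C (z : ℚ)) with hPS
  set PL : Polynomial ℚ := ∏ z ∈ L, (Polynomial.X - Polynomial.C (z : ℚ)) with hPL
  set V : Polynomial ℚ := Q - Polynomial.C (Q.coeff m) * PS with hV
  have hPSd : PS.natDegree = m := by rw [hPS, Polynomial.natDegree_finsetProd_X_sub_C_eq_card, hS]
  have hPLd : PL.natDegree = L.card := by rw [hPL, Polynomial.natDegree_finsetProd_X_sub_C_eq_card]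
  have hPSm : PS.Monic := Polynomial.monic_prod_of_monic _ _ fun z _ => Polynomial.monic_X_sub_C _
  have hPLm : PL.Monic := Polynomial.monic_prod_of_monic _ _ fun z _ => Polynomial.monic_X_sub_C _
  have hV1 : V.coeff (m-1) = Q.coeff (m-1) + Q.coeff m * ∑ z ∈ S, (z : ℚ) := by
    have := Polynomial.prod_X_sub_C_coeff_card_pred S (fun z : ℤ => (z : ℚ)) (by omega)
    rw [hS] at this
    rw [hV, Polynomial.coeff_sub, Polynomial.coeff_C_mul, hPS, this]; ring
  have hVd : V.natDegree ≤ m - 1 := by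
    rw [Polynomial.natDegree_le_iff_coeff_eq_zero]
    intro N hN
    rw [hV, Polynomial.coeff_sub, Polynomial.coeff_C_mul]
    rcases (show m ≤ N by omega).lt_or_eq with h | h
    · rw [Polynomial.coeff_eq_zero_of_natDegree_lt (by omega),
        Polynomial.coeff_eq_zero_of_natDegree_lt (p := PS) (by omega)]; simp
    · subst h
      have : PS.coeff m = 1 := by rw [← hPSd]; exact hPSm.coeff_natDegree
      rw [this]; ring
  have hW1 : (PL * V).coeff p = V.coeff (m-1) := by
    have : p = L.card + (m-1) := by omega
    rw [this, Polynomial.coeff_mul_add_eq_of_natDegree_le hPLd.le hVd, ← hPLd, hPLm.coeff_natDegree, one_mul]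
  have hWd : (PL * V).natDegree ≤ p := by
    refine Polynomial.natDegree_mul_le.trans ?_
    omega
  have h1 := fd_poly (PL * V) p hWd lo
  rw [hW1, hV1] at h1
  rw [← h1, fwdDiff_iter_eq_sum_shift, fwdDiff_iter_eq_sum_shift]
  push_cast
  refine Finset.sum_congr rfl fun k hk => ?_
  have hk := Finset.mem_range.1 hk
  have hmem : lo + k ∈ Finset.Icc lo (lo+p) := Finset.mem_Icc.2 ⟨by omega, by omega⟩
  have hz : (PL * PS).eval ((lo : ℚ) + k) = 0 := by
    rw [hPL, hPS, ← Finset.prod_union Finset.sdiff_disjoint, Finset.sdiff_union_of_subset hlo,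
      Polynomial.eval_prod]
    refine Finset.prod_eq_zero hmem ?_
    simp
  have e1 : (PL * V).eval ((lo : ℚ) + k) = (PL * Q).eval ((lo:ℚ) + k) := by
    have : PL * V = PL * Q - Polynomial.C (Q.coeff m) * (PL * PS) := by rw [hV]; ring
    rw [this, Polynomial.eval_sub, Polynomial.eval_mul (p := Polynomial.C _), hz]; simp
  have e2 := hf (lo + k)
  push_cast at e2
  simp only [nsmul_eq_mul, mul_one, zsmul_eq_mul, smul_eq_mul]
  rw [e1, Polynomial.eval_mul, ← e2, hPL, Polynomial.eval_prod]
  simp only [Polynomial.eval_sub, Polynomial.eval_X, Polynomial.eval_C]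
  push_cast
  ring

/-! Euler characteristics -/

lemma sg_nat (i : ℕ) : sg (i : ℤ) = (-1)^i := by
  induction i with
  | zero => simp [sg]
  | succ i ih => push_cast; rw [sg_succ, ih, pow_succ]; ring

lemma rkZ_out (E : CoComplex K n) (j : ℤ) (h : j < 0 ∨ (E.len : ℤ) < j) : rkZ E j = 0 := by
  cases j with
  | ofNat i => exact E.rk_eq_zero i (by simp at h; omega)
  | negSucc i => rfl

lemma chi_tens (E : CoComplex K n) (G : GM K n) (w : ℤ → ℕ)
    (hG : ∀ s, FiniteDimensional K (G.gr s) ∧ finrank K (G.gr s) = w s) (t : ℤ) :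
    FH ((tens E G).c t) ∧ chi ((tens E G).c t) =
      - ∑ i ∈ Finset.range (E.len + 1), (-1)^i * ∑ p : Fin (E.rk i), (w (t - E.deg i p) : ℤ) := by
  haveI : ∀ s, FiniteDimensional K (G.gr s) := fun s => (hG s).1
  have hfd : ∀ j, FiniteDimensional K (TV E G j t) := fun j => inferInstance
  have h := chi_fd (A := (tens E G).c t) ((Finset.range (E.len + 1)).map Nat.castEmbedding)
    hfd (by
      intro j hj
      change finrank K (TV E G j t) = 0
      have : rkZ E j = 0 := by
        apply rkZ_out
        by_contra hc
        push Not at hc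
        apply hj
        obtain ⟨i, rfl⟩ := Int.eq_ofNat_of_zero_le hc.1
        simp only [Finset.mem_map, Finset.mem_range]
        exact ⟨i, by omega, rfl⟩
      rw [Module.finrank_pi_fintype]
      have hE : IsEmpty (Fin (rkZ E j)) := by rw [this]; infer_instance
      simp)
  refine ⟨h.1, h.2.trans ?_⟩
  rw [Finset.sum_map]
  congr 1
  refine Finset.sum_congr rfl fun i _ => ?_
  rw [Nat.castEmbedding_apply, sg_nat]
  congr 1
  change ((finrank K (TV E G (i:ℤ) t) : ℕ) : ℤ) = _
  rw [Module.finrank_pi_fintype]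
  push_cast
  refine Finset.sum_congr rfl fun p _ => ?_
  rw [(hG _).2]
  rfl

/-- The Hilbert polynomial attached to the complex. -/
def PE (E : CoComplex K n) : Polynomial ℚ :=
  ∑ i ∈ Finset.range (E.len + 1),
    Polynomial.C ((-1 : ℚ) ^ i) * ∑ p : Fin (E.rk i), genHilb n (E.deg i p)

abbrev CC (E : CoComplex K n) : OpC K := tens E (sGM K n)
abbrev EE (E : CoComplex K n) : OpC K := tens E (gmk K n n n)

lemma FH_CC (E : CoComplex K n) (t : ℤ) : FH ((CC E).c t) :=
  (chi_tens E (sGM K n) (HFn n) (fun s => homogZ_fin s) t).1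

lemma FH_EE (E : CoComplex K n) (t : ℤ) : FH ((EE E).c t) :=
  (chi_tens E (gmk K n n n) (fun s => HFn n (-s-n)) (fun s => gmk_fin s) t).1

lemma PE_eval {m : ℕ} (E : CoComplex K (m+1)) (t : ℤ) : (PE E).eval (t : ℚ) =
    ((- chi ((CC E).c t) - (-1)^m * chi ((EE E).c t) : ℤ) : ℚ) := by
  rw [(chi_tens E (sGM K (m+1)) (HFn (m+1)) (fun s => homogZ_fin s) t).2,
    (chi_tens E (gmk K (m+1) (m+1) (m+1)) (fun s => HFn (m+1) (-s-(m+1:ℕ))) (fun s => gmk_fin s) t).2]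
  rw [PE, Polynomial.eval_finset_sum]
  push_cast
  rw [neg_neg, mul_neg, sub_neg_eq_add, Finset.mul_sum, ← Finset.sum_add_distrib]
  refine Finset.sum_congr rfl fun i _ => ?_
  rw [Polynomial.eval_mul, Polynomial.eval_finset_sum, Polynomial.eval_C]
  simp only [genHilb_eval]
  rw [Finset.sum_add_distrib, ← Finset.mul_sum]
  push_cast
  ring

lemma Z_of_empty (E : CoComplex K n) (G : GM K n) (t j : ℤ) (h : j + 1 < 0) : Z ((tens E G).c t) j := by
  intro v _
  refine ⟨0, ?_⟩
  refine TV_ext E G fun p => ?_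
  have : rkZ E (j+1) = 0 := rkZ_out E _ (Or.inl h)
  exact absurd p.2 (by omega)

lemma Z_of_bot (E : CoComplex K n) (G : GM K n) (t j : ℤ)
    (h : ∀ (i : ℕ) p, G.gr (t - E.deg i p) = ⊥) : Z ((tens E G).c t) j := by
  intro v _
  refine ⟨0, ?_⟩
  refine TV_ext E G fun p => ?_
  have hb : G.gr (t - dgZ E (j+1) p) = ⊥ := by
    clear * - h
    revert p
    generalize j + 1 = j'
    intro p
    cases j' with
    | ofNat i => exact h i p
    | negSucc i => exact p.elim0
  have h0 : (v p : G.M) = 0 := (Submodule.mem_bot K).1 (hb.le (v p).2)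
  refine Eq.trans ?_ h0.symm
  rw [LinearMap.map_zero]; rfl

lemma deg_bdd (E : CoComplex K n) : ∃ B : ℤ, ∀ (i : ℕ) p, |E.deg i p| ≤ B := by
  refine ⟨∑ i ∈ Finset.range (E.len + 1), ∑ p, |E.deg i p|, fun i p => ?_⟩
  have hi : i < E.len + 1 := by
    by_contra h
    have := E.rk_eq_zero i (by omega)
    exact absurd p.2 (by omega)
  refine le_trans ?_ (Finset.single_le_sum (f := fun i => ∑ p, |E.deg i p|)
    (fun i _ => Finset.sum_nonneg fun p _ => abs_nonneg _) (Finset.mem_range.2 hi))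
  exact Finset.single_le_sum (f := fun p => |E.deg i p|) (fun p _ => abs_nonneg _) (Finset.mem_univ p)

lemma gmk_bot (s : ℤ) (h : -(n:ℤ) < s) : (gmk K n n n).gr s = ⊥ := by
  haveI := (gmk_fin (K := K) (n := n) s).1
  rw [← Submodule.finrank_eq_zero (R := K), (gmk_fin s).2, HFn_neg (by omega)]

theorem core {m : ℕ} (hm : 0 < m) (E : CoComplex K (m+1))
    (hhi : ∃ T, ∀ t, T ≤ t → ∀ j, 0 ≤ j → Z ((CC E).c t) j) (S : Finset ℤ) (hS : S.card = m) :
    ((∀ z ∈ S, Z ((CC E).c z) ((S.filter (z < ·)).card - 1)) →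
      (PE E).coeff (m-1) + (PE E).coeff m * ∑ z ∈ S, (z : ℚ) ≤ 0) ∧
    ((∀ z ∈ S, Z ((CC E).c z) (S.filter (z < ·)).card ∧
        ((S.filter (z < ·)).card = m - 1 → hd ((EE E).c z) (-1) ≤ hd ((CC E).c z) m)) →
      0 ≤ (PE E).coeff (m-1) + (PE E).coeff m * ∑ z ∈ S, (z : ℚ)) := by
  obtain ⟨B, hB⟩ := deg_bdd E
  obtain ⟨R, hR, h1, h2, h3⟩ := res_main (N := m+1) (n := m+1) (fun k => tens E (Gk K (m+1) k))
    (fun k => tens E (gmk K (m+1) k (k+1))) (fun k => tensHom E (Gin K (m+1) k))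
    (fun k => tensHom E (Gout K (m+1) k)) (fun k hk => tensSES E (Gses k hk))
    (fun k hk => gmkGood E k hk)
  change ∀ t j, Z ((CC E).c t) (j+(m+1:ℕ)) → Z ((EE E).c t) (j+1) → Z (R.c t) j at h1
  change ∀ t, FH ((CC E).c t) → FH ((EE E).c t) → FH (R.c t) ∧
        chi (R.c t) = (-1)^(m+1) * chi ((CC E).c t) - chi ((EE E).c t) at h2
  change ∀ t j, FH ((CC E).c t) → FH ((EE E).c t) → Z ((CC E).c t) (j+(m+1:ℕ)) → Z (R.c t) (j+1) →
        hd ((EE E).c t) (j+1) ≤ hd ((CC E).c t) (j+(m+1:ℕ)+1) → Z (R.c t) j at h3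
  have hFR : ∀ t, FH (R.c t) := fun t => (h2 t (FH_CC E t) (FH_EE E t)).1
  set a : ℤ := -1 - (m+1:ℕ) with ha
  have hsg : sg a = (-1)^m := by
    have h5 : sg (a + 1) = - sg a := sg_succ a
    have h6 : sg ((a + 1) + (m+1:ℕ)) = 1 := by
      have : a + 1 + (m+1:ℕ) = 0 := by rw [ha]; ring
      rw [this]; simp [sg]
    have : ∀ (k : ℕ) (x : ℤ), sg (x + k) = (-1)^k * sg x := by
      intro k x
      induction k with
      | zero => simp
      | succ k ih => push_cast; rw [← add_assoc, sg_succ, ih, pow_succ]; ring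
    rw [this, h5] at h6
    have h7 : ((-1 : ℤ)^m) * (-1)^m = 1 := by rw [← mul_pow]; simp
    rw [pow_succ] at h6
    calc sg a = ((-1)^m * (-1)^m) * sg a := by rw [h7, one_mul]
      _ = (-1)^m * ((-1) ^ m * -1 * -sg a) := by ring
      _ = _ := by rw [h6, mul_one]
  have hv : Van R a (a + m - 1) := by
    constructor
    · obtain ⟨T, hT⟩ := hhi
      refine ⟨max T (B+1), fun t ht j hj => h1 t j (hT t ((le_max_left _ _).trans ht) _ (by omega)) ?_⟩
      refine Z_of_bot E _ t _ fun i p => gmk_bot _ ?_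
      have := le_trans (le_abs_self _) (hB i p)
      have := (le_max_right _ _).trans ht
      push_cast; omega
    · refine ⟨-B-1, fun t ht j hj => h1 t j ?_ (Z_of_empty E _ t _ (by omega))⟩
      refine Z_of_bot E _ t _ fun i p => homogZ_neg ?_
      have := (abs_le.1 (hB i p)).1
      omega
  have hcn : ∀ t, Z (R.c t) (-1) := fun t => conc (m+1) R a hR.exact (by
    convert hv using 1; push_cast; ring) t (-1) (Or.inr (by rw [ha]; omega))
  obtain ⟨lo, hi, hlo⟩ : ∃ lo : ℤ, ∃ p : ℕ, S ⊆ Finset.Icc lo (lo + p) := by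
    obtain ⟨b, hb⟩ := S.bddBelow
    obtain ⟨c, hc⟩ := S.bddAbove
    refine ⟨b, (c - b).toNat, fun z hz => ?_⟩
    have h1 := hb hz
    have h2 := hc hz
    exact Finset.mem_Icc.2 ⟨h1, by omega⟩
  have hPEd : (PE E).natDegree ≤ m := by
    refine Polynomial.natDegree_sum_le_of_forall_le _ _ fun i _ => ?_
    refine (Polynomial.natDegree_C_mul_le _ _).trans ?_
    refine Polynomial.natDegree_sum_le_of_forall_le _ _ fun p _ => ?_
    unfold genHilb
    rw [if_neg (by omega)]
    refine (Polynomial.natDegree_C_mul_le _ _).trans ?_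
    refine (Polynomial.natDegree_prod_le _ _).trans ?_
    refine (Finset.sum_le_card_nsmul _ _ 1 fun k _ => ?_).trans (by simp)
    compute_degree
  have hnum := num hm (PE E) hPEd S hS lo hi hlo (fun t => sg a * X R t) (by
    intro t
    rw [PE_eval, X, (h2 t (FH_CC E t) (FH_EE E t)).2, hsg]
    have h7 : ((-1 : ℤ)^m) * (-1)^m = 1 := by rw [← mul_pow]; simp
    congr 1
    rw [pow_succ]
    linear_combination (-chi ((CC E).c t)) * h7)
  have hfe : (fwdDiff (1:ℤ))^[hi] (fun t => sg a * X R t * ∏ z ∈ Finset.Icc lo (lo+hi) \ S, (t - z)) lo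
      = sg a * (fwdDiff (1:ℤ))^[hi] (fun t => X R t * ∏ z ∈ Finset.Icc lo (lo+hi) \ S, (t - z)) lo := by
    rw [fwdDiff_iter_eq_sum_shift, fwdDiff_iter_eq_sum_shift, Finset.mul_sum]
    refine Finset.sum_congr rfl fun k _ => ?_
    simp only [smul_eq_mul]; ring
  rw [hfe] at hnum
  obtain ⟨q1, q2⟩ := main_ineq hR hFR hv S hS lo hi hlo
  have hpos : (0:ℚ) < hi.factorial := by exact_mod_cast Nat.factorial_pos hi
  have hklt : ∀ z ∈ S, (S.filter (z < ·)).card ≤ m - 1 := by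
    intro z hz
    have : (S.filter (z < ·)).card < S.card := Finset.card_lt_card
      (Finset.filter_ssubset.2 ⟨z, hz, by simp⟩)
    omega
  constructor
  · intro hn
    have := q1 (by
      intro z hz
      have hk := hklt z hz
      refine h1 z _ ?_ (Z_of_empty E _ z _ (by rw [ha]; omega))
      have e : a + ((S.filter (z < ·)).card : ℤ) + (m+1:ℕ) = (S.filter (z < ·)).card - 1 := by
        rw [ha]; ring
      rw [e]; exact hn z hz)
    have h8 : (hi.factorial : ℚ) * ((PE E).coeff (m-1) + (PE E).coeff m * ∑ z ∈ S, (z : ℚ)) ≤ 0 := by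
      rw [← hnum]; exact_mod_cast this
    by_contra hc
    push Not at hc
    have := mul_pos hpos hc
    linarith
  · intro hn
    have := q2 (by
      intro z hz
      have hk := hklt z hz
      obtain ⟨n1, n2⟩ := hn z hz
      have e : a + 1 + ((S.filter (z < ·)).card : ℤ) + (m+1:ℕ) = (S.filter (z < ·)).card := by
        rw [ha]; ring
      rcases hk.lt_or_eq with hk | hk
      · exact h1 z _ (by rw [e]; exact n1) (Z_of_empty E _ z _ (by rw [ha]; omega))
      · have e2 : a + 1 + ((S.filter (z < ·)).card : ℤ) + 1 = -1 := by rw [ha]; omega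
        refine h3 z _ (FH_CC E z) (FH_EE E z) (by rw [e]; exact n1) (by rw [e2]; exact hcn z) ?_
        rw [e, e2]
        have e3 : ((S.filter (z < ·)).card : ℤ) + 1 = m := by omega
        rw [e3]
        exact n2 hk)
    have h8 : 0 ≤ (hi.factorial : ℚ) * ((PE E).coeff (m-1) + (PE E).coeff m * ∑ z ∈ S, (z : ℚ)) := by
      rw [← hnum]; exact_mod_cast this
    exact nonneg_of_mul_nonneg_right h8 hpos

end SB

namespace SB
variable {K : Type} [Field K] {n : ℕ}

/-- Homogeneous component of integer degree. -/
def hcomp (s : ℤ) (b : PolyS K n) : PolyS K n :=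
  if 0 ≤ s then homogeneousComponent s.toNat b else 0

lemma coeff_hcomp (s : ℤ) (b : PolyS K n) (e : Fin n →₀ ℕ) :
    MvPolynomial.coeff e (hcomp s b) = if (e.degree : ℤ) = s then MvPolynomial.coeff e b else 0 := by
  unfold hcomp
  split_ifs with h1 h2 h2
  · rw [coeff_homogeneousComponent, if_pos (by omega)]
  · rw [coeff_homogeneousComponent, if_neg (by omega)]
  · omega
  · simp

lemma hcomp_mem (s : ℤ) (b : PolyS K n) : hcomp s b ∈ homogZ K n s := by
  rw [mem_homogZ]
  intro e he
  rw [coeff_hcomp] at he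
  by_contra h
  rw [if_neg h] at he
  exact he rfl

lemma hcomp_of_mem {s : ℤ} {b : PolyS K n} (h : b ∈ homogZ K n s) : hcomp s b = b := by
  rw [mem_homogZ] at h
  ext e
  rw [coeff_hcomp]
  split_ifs with h1
  · rfl
  · by_contra h2
    exact h1 (h e (Ne.symm h2))

lemma hcomp_mul {z s : ℤ} {a : PolyS K n} (ha : a ∈ homogZ K n z) (b : PolyS K n) :
    hcomp (z + s) (a * b) = a * hcomp s b := by
  classical
  rw [mem_homogZ] at ha
  ext e
  rw [coeff_hcomp, coeff_mul, coeff_mul]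
  have key : ∀ x ∈ antidiagonal e, MvPolynomial.coeff x.1 a * MvPolynomial.coeff x.2 (hcomp s b) =
      if (e.degree : ℤ) = z + s then MvPolynomial.coeff x.1 a * MvPolynomial.coeff x.2 b else 0 := by
    intro x hx
    by_cases h0 : MvPolynomial.coeff x.1 a = 0
    · simp [h0]
    · have h1 := ha _ h0
      have h2 : e.degree = x.1.degree + x.2.degree := by
        rw [← mem_antidiagonal.1 hx, map_add]
      rw [coeff_hcomp]
      by_cases h3 : (x.2.degree : ℤ) = s
      · rw [if_pos h3, if_pos (by omega)]
      · rw [if_neg h3, if_neg (by omega), mul_zero]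
  rw [Finset.sum_congr rfl key]
  split_ifs <;> simp

lemma hcomp_sum {ι : Type} (T : Finset ι) (s : ℤ) (f : ι → PolyS K n) :
    hcomp s (∑ i ∈ T, f i) = ∑ i ∈ T, hcomp s (f i) := by
  unfold hcomp
  split_ifs
  · rw [map_sum]
  · simp

/-- A homogeneous vector in the image is the image of a homogeneous vector. -/
lemma homog_lift {a b : ℕ} (M : Matrix (Fin a) (Fin b) (PolyS K n)) (da : Fin a → ℤ) (db : Fin b → ℤ)
    (hM : ∀ p q, M p q ∈ homogZ K n (db q - da p)) (t : ℤ) (w : Fin b → PolyS K n)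
    (hw : ∀ p, M.mulVec w p ∈ homogZ K n (t - da p)) :
    M.mulVec (fun q => hcomp (t - db q) (w q)) = M.mulVec w := by
  funext p
  rw [← hcomp_of_mem (hw p)]
  simp only [Matrix.mulVec, dotProduct]
  rw [hcomp_sum]
  refine Finset.sum_congr rfl fun q _ => ?_
  rw [← hcomp_mul (hM p q)]
  congr 1; ring

lemma mem_freePiece {r : ℕ} (dg : Fin r → ℤ) (l : ℤ) (v : Fin r → PolyS K n) :
    v ∈ freePiece dg l ↔ ∀ p, v p ∈ homogZ K n (l - dg p) := by
  simp [freePiece, Submodule.mem_pi]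

section
variable (E : CoComplex K n)

/-- The cocycles as a subspace of polynomial vectors. -/
def kerEquiv (i : ℕ) (t : ℤ) : LinearMap.ker (td E (sGM K n) t (i:ℤ)) ≃ₗ[K] E.kerPiece i t where
  toFun v := ⟨fun p => (v.1 p : PolyS K n), by
    refine ⟨?_, ?_⟩
    · change (E.dd i).mulVec (fun p => (v.1 p : PolyS K n)) = 0
      funext q
      have h : td E (sGM K n) t (i:ℤ) v.1 = 0 := v.2
      have := td_apply E (sGM K n) t (i:ℤ) v.1 q
      rw [h] at this
      exact this.symm
    · change _ ∈ freePiece (E.deg i) t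
      rw [mem_freePiece]
      exact fun p => (v.1 p).2⟩
  map_add' v w := rfl
  map_smul' a v := rfl
  invFun v := ⟨fun p => ⟨v.1 p, (mem_freePiece _ _ _).1 v.2.2 p⟩, by
    rw [LinearMap.mem_ker]
    refine TV_ext E _ fun q => ?_
    rw [td_apply]
    have h : (E.dd i).mulVec v.1 = 0 := v.2.1
    exact congrFun h q⟩
  left_inv v := rfl
  right_inv v := rfl

lemma hd_eq (k : ℕ) (t : ℤ) : hd ((CC E).c t) (k:ℤ) = cohomDim E (k+1) t := by
  refine (Submodule.Quotient.equiv _ _ (kerEquiv E (k+1) t) ?_).finrank_eq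
  apply le_antisymm
  · rintro _ ⟨v, ⟨w, hw⟩, rfl⟩
    refine ⟨fun p => (w p : PolyS K n), ?_⟩
    funext q
    have := td_apply E (sGM K n) t (k:ℤ) w q
    refine this.symm.trans ?_
    exact congrArg (fun u : TV E (sGM K n) ((k:ℤ)+1) t => (u (show Fin (rkZ E ((k:ℤ)+1)) from q) : PolyS K n)) hw
  · rintro u ⟨w, hw⟩
    have hw : (E.dd k).mulVec w = u.1 := hw
    refine ⟨(kerEquiv E (k+1) t).symm u, ?_, LinearEquiv.apply_symm_apply _ _⟩
    have hu := (mem_freePiece _ _ _).1 u.2.2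
    have h2 := homog_lift (E.dd k) (E.deg (k+1)) (E.deg k) (E.isHomog k) t w (by
      intro p; rw [hw]; exact hu p)
    refine ⟨fun p => ⟨hcomp (t - E.deg k p) (w p), hcomp_mem _ _⟩, ?_⟩
    refine TV_ext E (sGM K n) fun q => ?_
    refine (td_apply E (sGM K n) t (k:ℤ) _ q).trans ?_
    exact (congrFun (h2.trans hw) q)

lemma Z_succ {k : ℕ} {t : ℤ} (h : cohomDim E (k+1) t = 0) : Z ((CC E).c t) (k:ℤ) :=
  (Z_of_hd ((FH_CC E t).fin k)).2 ((hd_eq E k t).trans h)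

lemma kerPiece_fin (i : ℕ) (t : ℤ) : FiniteDimensional K (E.kerPiece i t) := by
  haveI : FiniteDimensional K (TV E (sGM K n) (i:ℤ) t) := inferInstance
  exact (kerEquiv E i t).finiteDimensional

lemma Z_zero {t : ℤ} (h : cohomDim E 0 t = 0) : Z ((CC E).c t) (-1) := by
  haveI := kerPiece_fin E 0 t
  intro v hv
  refine ⟨0, ?_⟩
  rw [LinearMap.map_zero]
  have h1 : kerEquiv E 0 t ⟨v, hv⟩ = 0 := by
    unfold cohomDim at h
    rw [Module.finrank_zero_iff] at h
    have := (Submodule.Quotient.mk_eq_zero _).1 (h.elim (Submodule.Quotient.mk (kerEquiv E 0 t ⟨v, hv⟩)) 0)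
    have : ((kerEquiv E 0 t ⟨v, hv⟩ : E.kerPiece 0 t) : Fin (E.rk 0) → PolyS K n) = 0 := this
    exact Subtype.ext this
  have h2 := (LinearEquiv.map_eq_zero_iff _).1 h1
  exact (congrArg Subtype.val h2).symm

end

/-- The residue functional. -/
def resf (K : Type) [Field K] (n : ℕ) : Qk K n n →ₗ[K] K :=
  ((Wk K n n).restrictScalars K).liftQ
    ({ toFun := fun w => w.coeff (fun _ => -1)
       map_add' := fun a b => rfl
       map_smul' := fun a b => rfl } : Lr K n →ₗ[K] K) (by
    intro w hw
    exact hw _ fun ⟨i, _, h⟩ => by simp at h)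

lemma resf_mk (w : Lr K n) : resf K n (mkK K n n w) = w.coeff (fun _ => -1) := rfl

lemma mkK_smul (a : PolyS K n) (w : Lr K n) : a • mkK K n n w = mkK K n n (iot a * w) :=
  (map_smul (mkk K n n) a w).symm

lemma hd_le_ker (E : CoComplex K n) (G : GM K n) (hG : ∀ s, FiniteDimensional K (G.gr s)) (t : ℤ) :
    hd ((tens E G).c t) (-1) ≤ finrank K (LinearMap.ker (td E G t 0)) := by
  haveI : FiniteDimensional K (TV E G 0 t) := inferInstance
  exact Submodule.finrank_quotient_le (R := K) (M := LinearMap.ker (td E G t 0)) _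

lemma pair_le (F : FreeComplex K n) (d t : ℤ) (hd0 : t = -d - n) :
    hd ((EE (dualCo F)).c t) (-1) ≤ MPieceDim F d := by
  haveI : ∀ s, FiniteDimensional K ((gmk K n n n).gr s) := fun s => (gmk_fin s).1
  refine (hd_le_ker _ _ (fun s => (gmk_fin s).1) t).trans ?_
  set Q := (freePiece (K := K) (n := n) (F.deg 0) d) ⧸
    (Submodule.comap (freePiece (F.deg 0) d).subtype
      ((LinearMap.range ((F.dd 0).mulVecLin)).restrictScalars K)) with hQ
  haveI hfp : FiniteDimensional K (freePiece (K := K) (n := n) (F.deg 0) d) := by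
    let f : freePiece (K := K) (n := n) (F.deg 0) d →ₗ[K] (∀ p, homogZ K n (d - F.deg 0 p)) :=
      { toFun := fun v p => ⟨v.1 p, (mem_freePiece _ _ _).1 v.2 p⟩
        map_add' := fun _ _ => rfl
        map_smul' := fun _ _ => rfl }
    refine FiniteDimensional.of_injective f ?_
    intro v w h
    apply Subtype.ext
    funext p
    exact congrArg Subtype.val (congrFun h p)
  set TT := TV (dualCo F) (gmk K n n n) 0 t with hTT
  let B : TT →ₗ[K] (Fin (F.rk 0) → PolyS K n) →ₗ[K] K :=
    LinearMap.mk₂ K (fun v q => resf K n (∑ p : Fin (F.rk 0), q p • ((v p : (gmk K n n n).gr _) : Qk K n n)))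
      (fun v v' q => by
        rw [← map_add, ← Finset.sum_add_distrib]
        congr 1
        exact Finset.sum_congr rfl fun p _ => smul_add _ _ _)
      (fun c v q => by
        rw [← map_smul, Finset.smul_sum]
        congr 1
        exact Finset.sum_congr rfl fun p _ => smul_comm (q p) c ((v p : (gmk K n n n).gr _) : Qk K n n))
      (fun v q q' => by
        rw [← map_add, ← Finset.sum_add_distrib]
        congr 1
        exact Finset.sum_congr rfl fun p _ => add_smul _ _ _)
      (fun c v q => by
        rw [← map_smul, Finset.smul_sum]
        congr 1
        exact Finset.sum_congr rfl fun p _ => smul_assoc c (q p) ((v p : (gmk K n n n).gr _) : Qk K n n))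
  have hB : ∀ v q, B v q = resf K n (∑ p : Fin (F.rk 0), q p • ((v p : (gmk K n n n).gr _) : Qk K n n)) :=
    fun _ _ => rfl
  have hker : ∀ v ∈ LinearMap.ker (td (dualCo F) (gmk K n n n) t 0), ∀ w,
      B v ((F.dd 0).mulVec w) = 0 := by
    intro v hv w
    rw [hB]
    have h1 : ∀ q : Fin (F.rk 1), ∑ p : Fin (F.rk 0), (F.dd 0 p q) • ((v p : (gmk K n n n).gr _) : Qk K n n) = 0 := by
      intro q
      have := td_apply (dualCo F) (gmk K n n n) t 0 v q
      rw [LinearMap.mem_ker.1 hv] at this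
      exact this.symm
    have h2 : ∑ p : Fin (F.rk 0), ((F.dd 0).mulVec w) p • ((v p : (gmk K n n n).gr _) : Qk K n n) =
        ∑ q, w q • ∑ p : Fin (F.rk 0), (F.dd 0 p q) • ((v p : (gmk K n n n).gr _) : Qk K n n) := by
      simp only [Matrix.mulVec, dotProduct, Finset.sum_smul, Finset.smul_sum]
      rw [Finset.sum_comm]
      refine Finset.sum_congr rfl fun q _ => Finset.sum_congr rfl fun p _ => ?_
      rw [mul_comm, mul_smul]
    rw [h2]
    simp [h1]
  let Φ : LinearMap.ker (td (dualCo F) (gmk K n n n) t 0) →ₗ[K] Module.Dual K Q :=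
    { toFun := fun v => Submodule.liftQ _ ((B v.1) ∘ₗ (freePiece (F.deg 0) d).subtype) (by
        rintro q ⟨w, hw⟩
        rw [LinearMap.mem_ker]
        change B v.1 q.1 = 0
        have hw : (F.dd 0).mulVec w = q.1 := hw
        rw [← hw]
        exact hker v.1 v.2 w)
      map_add' := fun v w => by
        apply LinearMap.ext
        intro x
        obtain ⟨x, rfl⟩ := Submodule.Quotient.mk_surjective _ x
        change B (v.1 + w.1) x.1 = B v.1 x.1 + B w.1 x.1
        rw [map_add]; rfl
      map_smul' := fun c v => by
        apply LinearMap.ext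
        intro x
        obtain ⟨x, rfl⟩ := Submodule.Quotient.mk_surjective _ x
        change B (c • v.1) x.1 = c • B v.1 x.1
        rw [map_smul]; rfl }
  have hinj : Function.Injective Φ := by
    rw [← LinearMap.ker_eq_bot, LinearMap.ker_eq_bot']
    rintro ⟨v, hv⟩ h
    apply Subtype.ext
    refine TV_ext _ _ fun p => ?_
    have hq : ∀ q ∈ freePiece (K := K) (n := n) (F.deg 0) d, B v q = 0 := by
      intro q hq
      exact congrArg (fun φ : Module.Dual K Q => φ (Submodule.Quotient.mk ⟨q, hq⟩)) h
    change ((v p : (gmk K n n n).gr _) : Qk K n n) = 0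
    obtain ⟨w, hw, hw2⟩ := (v p).2
    have hw2 : mkK K n n w = ((v p : (gmk K n n n).gr _) : Qk K n n) := hw2
    rw [← hw2, mkK_eq_zero]
    intro e he
    by_contra hne
    have he2 : e ∈ Us n n (t - dgZ (dualCo F) 0 p) := by
      by_contra hh; exact hne (hw e hh)
    have hs : ∑ i, e i = t - (- F.deg 0 p) := he2.2
    have hneg : ∀ i, e i < 0 := by
      intro i; by_contra hh; exact he ⟨i, i.2, by omega⟩
    obtain ⟨f, hf⟩ := nonneg_lift (fun i => -1 - e i) (fun i => by have := hneg i; omega)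
    have hfd : ((f.degree : ℕ) : ℤ) = d - F.deg 0 p := by
      rw [degree_cast]
      have : ∑ i, (f i : ℤ) = ∑ i, (-1 - e i) := Finset.sum_congr rfl fun i _ => (congrFun hf i).symm
      rw [this, Finset.sum_sub_distrib, hs]
      simp
      rw [hd0]; ring
    have := hq (Pi.single p (monomial f 1)) (by
      rw [mem_freePiece]
      intro p'
      by_cases hp : p' = p
      · subst hp
        rw [Pi.single_eq_same, mem_homogZ]
        intro e' he'
        rw [coeff_monomial] at he'
        by_cases h5 : f = e'
        · rw [← h5, hfd]
        · rw [if_neg h5] at he'; exact absurd rfl he'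
      · rw [Pi.single_eq_of_ne hp]; exact Submodule.zero_mem _)
    have hsum : ∑ p' : Fin (F.rk 0), (Pi.single (show Fin (F.rk 0) from p) (monomial f 1) : Fin (F.rk 0) → PolyS K n) p' •
        ((v p' : (gmk K n n n).gr _) : Qk K n n) = (monomial f 1 : PolyS K n) • mkK K n n w := by
      refine (Finset.sum_eq_single (show Fin (F.rk 0) from p) ?_ ?_).trans ?_
      · intro b _ hb
        rw [Pi.single_eq_of_ne hb, zero_smul]
      · intro h; exact absurd (Finset.mem_univ _) h
      · refine Eq.trans ?_ (congrArg (fun z : Qk K n n => (monomial f 1 : PolyS K n) • z) hw2.symm)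
        rw [Pi.single_eq_same]
    have this := (congrArg (resf K n) hsum).symm.trans ((hB _ _).symm.trans this)
    rw [mkK_smul, resf_mk, iot_monomial, ← hf] at this
    change (lm _ * w).coeff _ = 0 at this
    rw [lm_mul_coeff'] at this
    apply hne
    rw [← this]
    congr 1
    funext i
    simp
  calc finrank K (LinearMap.ker (td (dualCo F) (gmk K n n n) t 0)) ≤ finrank K (Module.Dual K Q) :=
        LinearMap.finrank_le_finrank_of_injective hinj
    _ = finrank K Q := Subspace.dual_finrank_eq
    _ = MPieceDim F d := rfl

end SB

namespace SB
variable {K : Type} [Field K] {n : ℕ}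

section mat
variable {R : Type} [CommRing R] [IsDomain R]

/-- Bordered determinants. -/
lemma bordered {s : ℕ} (W : Matrix (Fin s) (Fin s) R) (c : Matrix (Fin s) (Fin 1) R)
    (x : Matrix (Fin 1) (Fin s) R) (d : Matrix (Fin 1) (Fin 1) R) (hW : W.det ≠ 0)
    (h : (Matrix.fromBlocks W c x d).det = 0) :
    (W.det • d - x * W.adjugate * c) 0 0 = 0 := by
  have h1 : Matrix.fromBlocks W c x d * Matrix.fromBlocks 1 (-(W.adjugate * c)) 0 (W.det • (1 : Matrix (Fin 1) (Fin 1) R)) =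
      Matrix.fromBlocks W 0 x (W.det • d - x * W.adjugate * c) := by
    rw [Matrix.fromBlocks_multiply]
    congr 1
    · simp
    · rw [Matrix.mul_neg, ← Matrix.mul_assoc, Matrix.mul_adjugate]; simp
    · simp
    · rw [Matrix.mul_neg, ← Matrix.mul_assoc]; simp [sub_eq_neg_add]
  have h2 := congrArg Matrix.det h1
  rw [Matrix.det_mul, h, zero_mul, Matrix.det_fromBlocks_zero₁₂] at h2
  have h3 := (mul_eq_zero.1 h2.symm).resolve_left hW
  rwa [Matrix.det_fin_one] at h3

lemma minor_inverse {a b s : ℕ} (A : Matrix (Fin a) (Fin b) R)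
    (hmin : ∀ (f : Fin (s+1) ↪ Fin a) (g : Fin (s+1) ↪ Fin b), (A.submatrix f g).det = 0)
    (f : Fin s ↪ Fin a) (g : Fin s ↪ Fin b) (hD : (A.submatrix f g).det ≠ 0) :
    ∃ B : Matrix (Fin b) (Fin a) R, A * B * A = (A.submatrix f g).det • A ∧
      ∀ i, i ∉ Set.range f → ∀ j, B j i = 0 := by
  classical
  set W := A.submatrix f g with hW
  let P : Matrix (Fin b) (Fin s) R := (1 : Matrix (Fin b) (Fin b) R).submatrix id g
  let Q : Matrix (Fin s) (Fin a) R := (1 : Matrix (Fin a) (Fin a) R).submatrix f id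
  have hAP : A * P = A.submatrix id g := by
    ext i j; simp [P, Matrix.mul_apply, Matrix.one_apply]
  have hQA : Q * A = A.submatrix f id := by
    ext i j; simp [Q, Matrix.mul_apply, Matrix.one_apply]
  refine ⟨P * W.adjugate * Q, ?_, ?_⟩
  · have h1 : A * (P * W.adjugate * Q) * A = A.submatrix id g * W.adjugate * A.submatrix f id := by
      rw [← hAP, ← hQA]; simp only [Matrix.mul_assoc]
    rw [h1]
    ext i j
    have hN : (Matrix.fromBlocks W (Matrix.of fun k (_ : Fin 1) => A (f k) j)
        (Matrix.of fun (_ : Fin 1) k => A i (g k)) (Matrix.of fun (_ : Fin 1) (_ : Fin 1) => A i j)).det = 0 := by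
      have hsub : Matrix.fromBlocks W (Matrix.of fun k (_ : Fin 1) => A (f k) j)
        (Matrix.of fun (_ : Fin 1) k => A i (g k)) (Matrix.of fun (_ : Fin 1) (_ : Fin 1) => A i j) =
          A.submatrix (Sum.elim f fun _ : Fin 1 => i) (Sum.elim g fun _ : Fin 1 => j) := by
        ext x y; rcases x with x | x <;> rcases y with y | y <;> rfl
      rw [hsub]
      by_cases h1 : Function.Injective (Sum.elim f fun _ : Fin 1 => i)
      · by_cases h2 : Function.Injective (Sum.elim g fun _ : Fin 1 => j)
        · have := hmin ⟨_, h1.comp finSumFinEquiv.symm.injective⟩ ⟨_, h2.comp finSumFinEquiv.symm.injective⟩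
          rw [← this, ← Matrix.det_submatrix_equiv_self finSumFinEquiv.symm]
          rfl
        · simp only [Function.Injective, not_forall] at h2
          obtain ⟨x, y, hxy, hne⟩ := h2
          refine Matrix.det_zero_of_column_eq hne fun k => ?_
          simp only [Matrix.submatrix_apply, hxy]
      · simp only [Function.Injective, not_forall] at h1
        obtain ⟨x, y, hxy, hne⟩ := h1
        refine Matrix.det_zero_of_row_eq hne ?_
        funext k
        simp only [Matrix.submatrix_apply, hxy]
    have := bordered W _ _ _ hD hN
    rw [Matrix.sub_apply, sub_eq_zero] at this
    rw [Matrix.smul_apply]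
    refine Eq.trans ?_ this.symm
    simp [Matrix.mul_apply]
  · intro i hi j
    simp only [Matrix.mul_apply (N := Q)]
    refine Finset.sum_eq_zero fun k _ => ?_
    have : Q k i = 0 := by
      simp only [Q, Matrix.submatrix_apply, id, Matrix.one_apply]
      rw [if_neg]; intro h; exact hi ⟨k, h⟩
    rw [this, mul_zero]
end mat

lemma mat_lift {a b c e : ℕ} (M : Matrix (Fin a) (Fin b) (PolyS K n)) (N : Matrix (Fin b) (Fin c) (PolyS K n))
    (h : LinearMap.ker M.mulVecLin = LinearMap.range N.mulVecLin) (X : Matrix (Fin b) (Fin e) (PolyS K n))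
    (hX : M * X = 0) : ∃ Y : Matrix (Fin c) (Fin e) (PolyS K n), N * Y = X := by
  have : ∀ j, ∃ y, N.mulVec y = X.col j := by
    intro j
    have : X.col j ∈ LinearMap.ker M.mulVecLin := by
      rw [LinearMap.mem_ker]
      funext i
      exact congrFun (congrFun hX i) j
    rw [h] at this
    exact this
  choose y hy using this
  refine ⟨Matrix.of fun i j => y j i, ?_⟩
  ext i j
  exact congrArg (MvPolynomial.coeff _) (congrFun (hy j) i)

lemma homotopy (F : FreeComplex K n) (hres : IsResolution F) (D : PolyS K n)
    (B : Matrix (Fin (F.rk 1)) (Fin (F.rk 0)) (PolyS K n)) (hB : F.dd 0 * B * F.dd 0 = D • F.dd 0) (i : ℕ) :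
    (∃ σ : Matrix (Fin (F.rk (i+1))) (Fin (F.rk i)) (PolyS K n), F.dd i * σ * F.dd i = D • F.dd i) ∧
    (∃ (σ : Matrix (Fin (F.rk (i+1))) (Fin (F.rk i)) (PolyS K n))
      (τ : Matrix (Fin (F.rk (i+2))) (Fin (F.rk (i+1))) (PolyS K n)),
      F.dd (i+1) * τ + σ * F.dd i = D • (1 : Matrix _ _ (PolyS K n))) := by
  have step : ∀ i, (∃ σ : Matrix (Fin (F.rk (i+1))) (Fin (F.rk i)) (PolyS K n), F.dd i * σ * F.dd i = D • F.dd i) →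
      (∃ (σ : Matrix (Fin (F.rk (i+1))) (Fin (F.rk i)) (PolyS K n))
      (τ : Matrix (Fin (F.rk (i+2))) (Fin (F.rk (i+1))) (PolyS K n)),
      F.dd (i+1) * τ + σ * F.dd i = D • (1 : Matrix _ _ (PolyS K n))) := by
    rintro i ⟨σ, hσ⟩
    obtain ⟨τ, hτ⟩ := mat_lift (F.dd i) (F.dd (i+1)) (hres i)
      (D • (1 : Matrix _ _ (PolyS K n)) - σ * F.dd i) (by
        rw [Matrix.mul_sub, ← Matrix.mul_assoc, hσ]; simp)
    exact ⟨σ, τ, by rw [hτ]; simp⟩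
  have all : ∀ i, (∃ σ : Matrix (Fin (F.rk (i+1))) (Fin (F.rk i)) (PolyS K n), F.dd i * σ * F.dd i = D • F.dd i) := by
    intro i
    induction i with
    | zero => exact ⟨B, hB⟩
    | succ i ih =>
      obtain ⟨σ, τ, h⟩ := step i ih
      refine ⟨τ, ?_⟩
      have : F.dd (i+1) * τ = D • (1 : Matrix _ _ (PolyS K n)) - σ * F.dd i := by rw [← h]; simp
      rw [this, Matrix.sub_mul, Matrix.mul_assoc, F.isComplex i]; simp
  exact ⟨all i, step i (all i)⟩

lemma fitt_struct (F : FreeComplex K n) {r : ℕ} (hr : 0 < r) (h : fittingIdeal F ((r:ℤ)-1) = ⊥) :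
    ∃ s, F.rk 0 = s + r ∧ fittingIdeal F r = minorsIdeal (F.dd 0) s ∧
      ∀ (f : Fin (s+1) ↪ Fin (F.rk 0)) (g : Fin (s+1) ↪ Fin (F.rk 1)), ((F.dd 0).submatrix f g).det = 0 := by
  unfold fittingIdeal at h
  split_ifs at h with h1
  · exact absurd h top_ne_bot
  · obtain ⟨s, hs⟩ : ∃ s, F.rk 0 = s + r := ⟨F.rk 0 - r, by omega⟩
    refine ⟨s, hs, ?_, ?_⟩
    · unfold fittingIdeal
      split_ifs with h2
      · have : s = 0 := by omega
        subst this
        symm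
        rw [Ideal.eq_top_iff_one]
        refine Ideal.subset_span ⟨(⟨Fin.elim0, fun x => x.elim0⟩, ⟨Fin.elim0, fun x => x.elim0⟩), ?_⟩
        simp
      · congr 1; omega
    · intro f g
      have e : ((F.rk 0 : ℤ) - ((r:ℤ)-1)).toNat = s + 1 := by omega
      rw [e] at h
      have : ((F.dd 0).submatrix f g).det ∈ minorsIdeal (F.dd 0) (s+1) := Ideal.subset_span ⟨(f, g), rfl⟩
      rw [h] at this
      exact this

lemma ker_colon (F : FreeComplex K n) (hres : IsResolution F) {r : ℕ} (hr : 0 < r) (h : fittingIdeal F ((r:ℤ)-1) = ⊥)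
    (i : ℕ) (c : PolyS K n) (hc : c ∈ fittingIdeal F r) (u : Fin (F.rk (i+1)) → PolyS K n)
    (hu : (F.dd (i+1)).transpose.mulVec u = 0) :
    c • u ∈ LinearMap.range ((F.dd i).transpose.mulVecLin) := by
  obtain ⟨s, hs, hf, hmin⟩ := fitt_struct F hr h
  rw [hf] at hc
  induction hc using Submodule.span_induction with
  | mem x hx =>
    obtain ⟨⟨f, g⟩, rfl⟩ := hx
    change ((F.dd 0).submatrix f g).det • u ∈ _
    by_cases hD : ((F.dd 0).submatrix f g).det = 0
    · rw [hD, zero_smul]; exact Submodule.zero_mem _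
    · obtain ⟨B, hB, _⟩ := minor_inverse (F.dd 0) hmin f g hD
      obtain ⟨σ, τ, h3⟩ := (homotopy F hres _ B hB i).2
      refine ⟨σ.transpose.mulVec u, ?_⟩
      have h4 := congrArg (fun M => Matrix.mulVec M u) (congrArg Matrix.transpose h3)
      simp only [Matrix.transpose_add, Matrix.transpose_mul, Matrix.add_mulVec, ← Matrix.mulVec_mulVec, hu, Matrix.mulVec_zero, zero_add,
        Matrix.transpose_smul, Matrix.transpose_one, Matrix.smul_mulVec, Matrix.one_mulVec] at h4
      exact h4
  | zero => rw [zero_smul]; exact Submodule.zero_mem _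
  | add x y _ _ hx hy => rw [add_smul]; exact Submodule.add_mem _ hx hy
  | smul a x _ hx => rw [smul_assoc]; exact Submodule.smul_mem _ _ hx

lemma hcomp_mulVec {a b : ℕ} (M : Matrix (Fin a) (Fin b) (PolyS K n)) (da : Fin a → ℤ) (db : Fin b → ℤ)
    (hM : ∀ p q, M p q ∈ homogZ K n (db q - da p)) (t : ℤ) (w : Fin b → PolyS K n) :
    M.mulVec (fun q => hcomp (t - db q) (w q)) = fun p => hcomp (t - da p) (M.mulVec w p) := by
  funext p
  simp only [Matrix.mulVec, dotProduct]
  rw [hcomp_sum]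
  refine Finset.sum_congr rfl fun q _ => ?_
  rw [← hcomp_mul (hM p q)]
  congr 1; ring

end SB

namespace SB
variable {K : Type} [Field K] {n : ℕ}

lemma trunc_split (N : ℕ) (c : PolyS K n) : ∃ lo hi : PolyS K n, c = lo + hi ∧ lo.totalDegree ≤ N ∧ hi ∈ irrel K n ^ N := by
  refine ⟨∑ i ∈ range N, homogeneousComponent i c, c - ∑ i ∈ range N, homogeneousComponent i c, by ring, ?_, ?_⟩
  · refine (totalDegree_finset_sum _ _).trans (Finset.sup_le fun i hi => ?_)
    refine ((homogeneousComponent_isHomogeneous i c).totalDegree_le).trans ?_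
    exact (Finset.mem_range.1 hi).le
  · change _ ∈ idealOfVars (Fin n) K ^ N
    rw [mem_pow_idealOfVars_iff']
    intro x hx
    rw [coeff_sub, coeff_sum]
    simp only [coeff_homogeneousComponent]
    rw [Finset.sum_ite_eq, if_pos (Finset.mem_range.2 hx), sub_self]

lemma hcomp_high {s : ℤ} {b : PolyS K n} (h : (b.totalDegree : ℤ) < s) : hcomp s b = 0 := by
  ext e
  rw [coeff_hcomp, coeff_zero]
  split_ifs with h1
  · apply coeff_eq_zero_of_totalDegree_lt
    have : e.degree = ∑ i ∈ e.support, e i := rfl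
    rw [← this]; omega
  · rfl

lemma hcomp_sub (s : ℤ) (a b : PolyS K n) : hcomp s (a - b) = hcomp s a - hcomp s b := by
  unfold hcomp
  split_ifs
  · rw [map_sub]
  · simp

lemma high_van_one (F : FreeComplex K n) (hres : IsResolution F) {r : ℕ} (hr : 0 < r) (hvb : IsVectorBundle F r)
    (i : ℕ) : ∃ T : ℤ, ∀ t, T ≤ t → cohomDim (dualCo F) (i+1) t = 0 := by
  obtain ⟨h0, N, hN⟩ := hvb
  obtain ⟨G, hG⟩ : (LinearMap.ker ((F.dd (i+1)).transpose.mulVecLin)).FG := IsNoetherian.noetherian _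
  obtain ⟨B, hB⟩ := deg_bdd (dualCo F)
  let D : ℕ := N + ∑ u ∈ G, ∑ p, (u p).totalDegree
  refine ⟨D + B + 1, fun t ht => ?_⟩
  have key : ∀ u : Fin (F.rk (i+1)) → PolyS K n, u ∈ (dualCo F).kerPiece (i+1) t → u ∈ (dualCo F).imSub (i+1) := by
    intro u hu
    have hu1 : u ∈ LinearMap.ker ((F.dd (i+1)).transpose.mulVecLin) := hu.1
    have hu2 := (mem_freePiece _ _ _).1 hu.2
    have hspan := hu1
    rw [← hG] at hspan
    obtain ⟨c, hc⟩ := Submodule.mem_span_finset.1 hspan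
    choose lo hi hsplit hlo hhi using fun x => trunc_split N (c x)
    set w : Fin (F.rk (i+1)) → PolyS K n := ∑ x ∈ G, lo x • x with hw
    have huw : u - w ∈ LinearMap.range ((F.dd i).transpose.mulVecLin) := by
      have : u - w = ∑ x ∈ G, hi x • x := by
        rw [← hc.2, hw, ← Finset.sum_sub_distrib]
        refine Finset.sum_congr rfl fun x _ => ?_
        rw [hsplit x, add_smul, add_sub_cancel_left]
      rw [this]
      refine Submodule.sum_mem _ fun x hx => ?_
      refine ker_colon F hres hr h0 i (hi x) (hN (hhi x)) x ?_
      have : x ∈ LinearMap.ker ((F.dd (i+1)).transpose.mulVecLin) := by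
        rw [← hG]; exact Submodule.subset_span hx
      exact this
    obtain ⟨y, hy⟩ := huw
    have hy : (F.dd i).transpose.mulVec y = u - w := hy
    have h7 : ∀ p : Fin (F.rk (i+1)), (w p).totalDegree ≤ D := by
      intro p
      rw [hw, Finset.sum_apply]
      refine (totalDegree_finset_sum _ _).trans (Finset.sup_le fun x hx => ?_)
      rw [Pi.smul_apply, smul_eq_mul]
      refine (totalDegree_mul _ _).trans (Nat.add_le_add (hlo x) ?_)
      refine le_trans ?_ (Finset.single_le_sum (f := fun u : Fin (F.rk (i+1)) → PolyS K n => ∑ p, (u p).totalDegree) (fun _ _ => Nat.zero_le _) hx)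
      exact Finset.single_le_sum (f := fun p => (x p).totalDegree) (fun _ _ => Nat.zero_le _) (Finset.mem_univ p)
    have h5 := hcomp_mulVec ((dualCo F).dd i) ((dualCo F).deg (i+1)) ((dualCo F).deg i) ((dualCo F).isHomog i) t y
    refine ⟨fun q => hcomp (t - (dualCo F).deg i q) (y q), ?_⟩
    refine h5.trans ?_
    funext p
    have h6 : ((dualCo F).dd i).mulVec y p = u p - w p := congrFun hy p
    rw [h6, hcomp_sub, hcomp_of_mem (hu2 p)]
    rw [hcomp_high (b := w p), sub_zero]
    have h7 := h7 p
    have h8 := abs_le.1 (hB (i+1) p)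
    have h7' : ((w p).totalDegree : ℤ) ≤ D := by exact_mod_cast h7
    omega
  unfold cohomDim
  have : (Submodule.comap ((dualCo F).kerPiece (i+1) t).subtype ((dualCo F).imSub (i+1))) = ⊤ := by
    rw [Submodule.comap_subtype_eq_top]; exact key
  rw [this]
  exact finrank_zero_of_subsingleton

lemma Z_of_rk (E : CoComplex K n) (G : GM K n) (t j : ℤ) (h : rkZ E (j+1) = 0) : Z ((tens E G).c t) j := by
  intro v _
  refine ⟨0, ?_⟩
  rw [LinearMap.map_zero]
  refine TV_ext E G fun q => ?_
  have q' : Fin (rkZ E (j+1)) := q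
  rw [h] at q'
  exact q'.elim0

lemma high_van (F : FreeComplex K n) (hres : IsResolution F) {r : ℕ} (hr : 0 < r) (hvb : IsVectorBundle F r) :
    ∃ T : ℤ, ∀ t, T ≤ t → ∀ j, 0 ≤ j → Z ((CC (dualCo F)).c t) j := by
  choose T hT using high_van_one F hres hr hvb
  refine ⟨∑ i ∈ range (F.len + 1), |T i|, fun t ht j hj => ?_⟩
  obtain ⟨k, rfl⟩ := Int.eq_ofNat_of_zero_le hj
  by_cases hk : k < F.len + 1
  · apply Z_succ
    apply hT
    refine le_trans (le_abs_self _) (le_trans ?_ ht)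
    exact Finset.single_le_sum (f := fun i => |T i|) (fun _ _ => abs_nonneg _) (Finset.mem_range.2 hk)
  · apply Z_of_rk
    apply rkZ_out
    right
    change (F.len : ℤ) < _
    push_cast; omega

end SB

namespace SB
variable {K : Type} [Field K] {n : ℕ}

lemma hd_zero (E : CoComplex K n) (t : ℤ) : hd ((CC E).c t) (-1) = finrank K (E.kerPiece 0 t) := by
  refine LinearEquiv.finrank_eq ((Submodule.quotEquivOfEqBot _ ?_).trans (kerEquiv E 0 t))
  rw [eq_bot_iff]
  rintro ⟨v, hv⟩ ⟨w, hw⟩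
  have : w = 0 := TV_ext E _ fun p => p.elim0
  rw [this, LinearMap.map_zero] at hw
  rw [Submodule.mem_bot]
  exact Subtype.ext hw.symm

lemma exists_section {m : ℕ} (F : FreeComplex K (m+1)) {r : ℕ} (hr : 0 < r) (hvb : IsVectorBundle F r) :
    ∃ (t : ℤ) (v : Fin (F.rk 0) → PolyS K (m+1)), v ≠ 0 ∧ v ∈ (dualCo F).kerPiece 0 t := by
  classical
  obtain ⟨h0, N, hN⟩ := hvb
  obtain ⟨s, hs, hf, hmin⟩ := fitt_struct F hr h0
  have hne : ∃ (f : Fin s ↪ Fin (F.rk 0)) (g : Fin s ↪ Fin (F.rk 1)), ((F.dd 0).submatrix f g).det ≠ 0 := by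
    by_contra hcon
    push Not at hcon
    have : fittingIdeal F r ≤ ⊥ := by
      rw [hf]
      refine Ideal.span_le.2 ?_
      rintro _ ⟨⟨f, g⟩, rfl⟩
      exact hcon f g
    have h1 : (MvPolynomial.X 0 : PolyS K (m+1))^N ∈ irrel K (m+1) ^ N :=
      Ideal.pow_mem_pow (show (MvPolynomial.X 0 : PolyS K (m+1)) ∈ irrel K (m+1) from Ideal.subset_span ⟨0, rfl⟩) N
    have h2 : (MvPolynomial.X 0 : PolyS K (m+1))^N = 0 := this (hN h1)
    exact MvPolynomial.X_ne_zero _ ((pow_eq_zero_iff (n := N) (by rintro rfl; simp at h2)).1 h2)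
  obtain ⟨f, g, hD⟩ := hne
  obtain ⟨B, hB, hB0⟩ := minor_inverse (F.dd 0) hmin f g hD
  obtain ⟨i, hi⟩ : ∃ i, i ∉ Set.range f := by
    by_contra hcon
    push Not at hcon
    have := Fintype.card_le_of_surjective f hcon
    simp at this; omega
  set D := ((F.dd 0).submatrix f g).det
  set C := D • (1 : Matrix (Fin (F.rk 0)) (Fin (F.rk 0)) (PolyS K (m+1))) - F.dd 0 * B with hC
  have hCA : C * F.dd 0 = 0 := by rw [hC, Matrix.sub_mul, hB]; simp
  have hCii : C i i = D := by
    rw [hC, Matrix.sub_apply, Matrix.mul_apply]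
    rw [Finset.sum_eq_zero fun j _ => by rw [hB0 i hi j, mul_zero]]
    simp
  have hv : (F.dd 0).transpose.mulVec (C i) = 0 := by
    rw [Matrix.mulVec_transpose]
    funext j
    exact congrFun (congrFun hCA i) j
  obtain ⟨e, he⟩ := MvPolynomial.ne_zero_iff.1 (hCii.symm ▸ hD : C i i ≠ 0)
  refine ⟨(e.degree : ℤ) + (- F.deg 0 i), fun p => hcomp ((e.degree : ℤ) + (- F.deg 0 i) - (- F.deg 0 p)) (C i p), ?_, ?_, ?_⟩
  · intro h
    apply he
    have h3 := congrArg (MvPolynomial.coeff e) (congrFun h i)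
    rw [coeff_hcomp, if_pos (by ring)] at h3
    exact h3
  · have h5 := hcomp_mulVec ((dualCo F).dd 0) ((dualCo F).deg 1) ((dualCo F).deg 0) ((dualCo F).isHomog 0) ((e.degree : ℤ) + (- F.deg 0 i)) (C i)
    refine h5.trans ?_
    funext p
    have h6 : ((dualCo F).dd 0).mulVec (C i) p = 0 := congrFun hv p
    rw [h6]
    unfold hcomp; simp
  · refine (mem_freePiece _ _ _).2 fun p => hcomp_mem _ _

lemma ker_lower (E : CoComplex K n) (t s : ℤ) (v : Fin (E.rk 0) → PolyS K n) (hv0 : v ≠ 0) (hv : v ∈ E.kerPiece 0 t) :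
    HFn n s ≤ finrank K (E.kerPiece 0 (t + s)) := by
  haveI := kerPiece_fin E 0 (t+s)
  rw [← (homogZ_fin (K := K) (n := n) s).2]
  have h1 : (E.dd 0).mulVec v = 0 := hv.1
  have h2 := (mem_freePiece _ _ _).1 hv.2
  let φ : homogZ K n s →ₗ[K] E.kerPiece 0 (t+s) :=
    { toFun := fun a => ⟨(a : PolyS K n) • v, by
        refine ⟨?_, (mem_freePiece _ _ _).2 fun p => ?_⟩
        · change (E.dd 0).mulVec ((a : PolyS K n) • v) = 0
          rw [Matrix.mulVec_smul, h1, smul_zero]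
        · have e : t + s - E.deg 0 p = s + (t - E.deg 0 p) := by ring
          have := hcomp_mul a.2 (s := t - E.deg 0 p) (v p)
          rw [hcomp_of_mem (h2 p)] at this
          rw [Pi.smul_apply, smul_eq_mul, ← this, e]
          exact hcomp_mem _ _⟩
      map_add' := fun a b => Subtype.ext (add_smul _ _ _)
      map_smul' := fun c a => Subtype.ext (smul_assoc c (a : PolyS K n) v) }
  refine LinearMap.finrank_le_finrank_of_injective (f := φ) ?_
  rw [injective_iff_map_eq_zero]
  intro a ha
  have : (a : PolyS K n) • v = 0 := congrArg Subtype.val ha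
  exact Subtype.ext ((smul_eq_zero.1 this).resolve_right hv0)

lemma coeff_nonneg_of_eventually {m : ℕ} (hm : 0 < m) (Q : Polynomial ℚ) (hQ : Q.natDegree ≤ m) (T : ℤ)
    (h : ∀ t : ℤ, T ≤ t → 0 ≤ Q.eval (t : ℚ)) : 0 ≤ Q.coeff m := by
  by_contra hneg
  push Not at hneg
  have hd : Q.natDegree = m := le_antisymm hQ (Polynomial.le_natDegree_of_ne_zero hneg.ne)
  have hlc : Q.leadingCoeff = Q.coeff m := by rw [Polynomial.leadingCoeff, hd]
  have ht := Polynomial.tendsto_atBot_of_leadingCoeff_nonpos Q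
    (Polynomial.natDegree_pos_iff_degree_pos.1 (by omega)) (by rw [hlc]; exact hneg.le)
  have ht2 := ht.comp (tendsto_intCast_atTop_atTop (R := ℚ))
  have h3 := (ht2.eventually (Filter.eventually_lt_atBot 0)).and (Filter.eventually_ge_atTop T)
  obtain ⟨t, h4, h5⟩ := h3.exists
  exact absurd (h t h5) (not_le.2 h4)

lemma chi_zero {A : Cpx K} (hA : FH A) (h : ∀ j, j ≠ -1 → Z A j) : chi A = - (hd A (-1) : ℤ) := by
  unfold chi
  rw [finsum_eq_single _ (-1)]
  · simp [sg]
  · intro j hj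
    rw [(Z_of_hd (hA.fin j)).1 (h j hj)]; simp

lemma genHilb_natDegree (m : ℕ) (a : ℤ) : (genHilb (m+1) a).natDegree ≤ m := by
  unfold genHilb
  rw [if_neg (by omega)]
  refine (Polynomial.natDegree_C_mul_le _ _).trans ?_
  refine (Polynomial.natDegree_prod_le _ _).trans ?_
  refine (Finset.sum_le_card_nsmul _ _ 1 fun k _ => ?_).trans (by simp)
  compute_degree

/-- The top two coefficients of the basic Hilbert polynomial. -/
lemma genHilb_coeff {m : ℕ} (hm : 0 < m) (a : ℤ) :
    (genHilb (m+1) a).coeff m = (m.factorial : ℚ)⁻¹ ∧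
    (genHilb (m+1) a).coeff (m-1) = (m.factorial : ℚ)⁻¹ * (m * ((m+1:ℚ)/2 - a)) := by
  have key : ∀ m : ℕ, (∏ k ∈ range m, (Polynomial.X - Polynomial.C (a : ℚ) + Polynomial.C ((k : ℚ) + 1))).Monic ∧
      (∏ k ∈ range m, (Polynomial.X - Polynomial.C (a : ℚ) + Polynomial.C ((k : ℚ) + 1))).natDegree = m ∧
      (0 < m → (∏ k ∈ range m, (Polynomial.X - Polynomial.C (a : ℚ) + Polynomial.C ((k : ℚ) + 1))).coeff (m-1) =
        (m * ((m+1:ℚ)/2 - a))) := by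
    intro m
    have e : ∀ k : ℕ, (Polynomial.X - Polynomial.C (a : ℚ) + Polynomial.C ((k : ℚ) + 1)) =
      Polynomial.X + Polynomial.C ((k:ℚ) + 1 - a) := by
      intro k; simp only [map_sub, map_add, Polynomial.C_1]; ring
    simp only [e]
    have hmon : ∀ m, (∏ k ∈ range m, (Polynomial.X + Polynomial.C ((k:ℚ) + 1 - a))).Monic :=
      fun m => Polynomial.monic_prod_of_monic _ _ fun k _ => Polynomial.monic_X_add_C _
    have hdeg : ∀ m, (∏ k ∈ range m, (Polynomial.X + Polynomial.C ((k:ℚ) + 1 - a))).natDegree = m := by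
      intro m
      rw [Polynomial.natDegree_prod_of_monic _ _ fun k _ => Polynomial.monic_X_add_C _]
      simp only [Polynomial.natDegree_X_add_C]
      simp
    refine ⟨hmon m, hdeg m, ?_⟩
    induction m with
    | zero => intro h; omega
    | succ m ih =>
      intro _
      rw [Finset.prod_range_succ, Nat.add_sub_cancel, mul_add, Polynomial.coeff_add, Polynomial.coeff_mul_C]
      have h1 : (∏ k ∈ range m, (Polynomial.X + Polynomial.C ((k:ℚ) + 1 - a))).coeff m = 1 := by
        have := hmon m
        rw [Polynomial.Monic, Polynomial.leadingCoeff, hdeg m] at this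
        exact this
      rw [h1]
      rcases Nat.eq_zero_or_pos m with rfl | hm
      · simp
      · obtain ⟨l, rfl⟩ : ∃ l, m = l + 1 := ⟨m - 1, by omega⟩
        rw [Polynomial.coeff_mul_X]
        have := ih (by omega)
        rw [Nat.add_sub_cancel] at this
        rw [this]; push_cast; ring
  obtain ⟨h1, h2, h3⟩ := key m
  unfold genHilb
  rw [if_neg (by omega), Nat.add_sub_cancel, Polynomial.coeff_C_mul, Polynomial.coeff_C_mul, h3 hm]
  refine ⟨?_, rfl⟩
  rw [Polynomial.Monic, Polynomial.leadingCoeff, h2] at h1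
  rw [h1, mul_one]

lemma rank_pos {m : ℕ} (hm : 0 < m) (F : FreeComplex K (m+1)) (hres : IsResolution F) {r : ℕ} (hr : 0 < r) (hvb : IsVectorBundle F r) :
    0 < (PE (dualCo F)).coeff m := by
  obtain ⟨t0, v, hv0, hv⟩ := exists_section F hr hvb
  obtain ⟨T, hT⟩ := high_van F hres hr hvb
  obtain ⟨B, hB⟩ := deg_bdd (dualCo F)
  have hPEd : (PE (dualCo F)).natDegree ≤ m := by
    refine Polynomial.natDegree_sum_le_of_forall_le _ _ fun i _ => ?_
    refine (Polynomial.natDegree_C_mul_le _ _).trans ?_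
    exact Polynomial.natDegree_sum_le_of_forall_le _ _ fun p _ => genHilb_natDegree m _
  have h := coeff_nonneg_of_eventually hm (PE (dualCo F) - genHilb (m+1) t0)
    ((Polynomial.natDegree_sub_le _ _).trans (max_le hPEd (genHilb_natDegree m _))) (max T (max (B+1) t0)) (by
    intro t ht
    have ht1 : T ≤ t := (le_max_left _ _).trans ht
    have ht2 : B + 1 ≤ t := (le_max_left _ _).trans ((le_max_right _ _).trans ht)
    have ht3 : t0 ≤ t := (le_max_right _ _).trans ((le_max_right _ _).trans ht)
    have hEE : ∀ j, Z ((EE (dualCo F)).c t) j := fun j => by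
      refine Z_of_bot (dualCo F) _ t _ fun i p => gmk_bot _ ?_
      have := le_trans (le_abs_self _) (hB i p)
      push_cast; omega
    rw [Polynomial.eval_sub, PE_eval, chi_zero (FH_EE _ t) (fun j _ => hEE j),
      (Z_of_hd ((FH_EE _ t).fin (-1))).1 (hEE (-1)), chi_zero (FH_CC _ t), genHilb_eval,
      HFn_neg (by omega : -(t - t0) - ((m+1:ℕ):ℤ) < 0), hd_zero]
    · have h1 := ker_lower (dualCo F) t0 (t - t0) v hv0 hv
      rw [add_sub_cancel] at h1
      have h2 : (HFn (m+1) (t - t0) : ℚ) ≤ (finrank K ((dualCo F).kerPiece 0 t) : ℚ) := by exact_mod_cast h1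
      push_cast
      linarith
    · intro j hj
      rcases lt_or_ge j 0 with h | h
      · exact Z_of_empty _ _ _ _ (by omega)
      · exact hT t ht1 j h)
  rw [Polynomial.coeff_sub, (genHilb_coeff hm t0).1] at h
  have : (0:ℚ) < (m.factorial : ℚ)⁻¹ := by positivity
  linarith

end SB

namespace SB
variable {K : Type} [Field K] {n : ℕ}

lemma anti_set (m : ℕ) (f : ℕ → ℤ) (hf : ∀ k l, k < l → l < m → f l < f k) :
    ∃ S : Finset ℤ, S.card = m ∧ (∑ z ∈ S, (z : ℚ) = ∑ k ∈ range m, (f k : ℚ)) ∧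
      ∀ z ∈ S, ∃ k, k < m ∧ z = f k ∧ (S.filter (z < ·)).card = k := by
  have hinj : Set.InjOn f (range m : Set ℕ) := by
    intro k hk l hl h
    have hk := Finset.mem_range.1 hk
    have hl := Finset.mem_range.1 hl
    rcases lt_trichotomy k l with h1 | h1 | h1
    · have := hf k l h1 hl; omega
    · exact h1
    · have := hf l k h1 hk; omega
  refine ⟨(range m).image f, ?_, ?_, ?_⟩
  · rw [Finset.card_image_of_injOn hinj, Finset.card_range]
  · rw [Finset.sum_image hinj]
  · intro z hz
    obtain ⟨k, hk, rfl⟩ := Finset.mem_image.1 hz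
    have hk := Finset.mem_range.1 hk
    refine ⟨k, hk, rfl, ?_⟩
    have : ((range m).image f).filter (f k < ·) = (range k).image f := by
      ext x
      simp only [Finset.mem_filter, Finset.mem_image, Finset.mem_range]
      constructor
      · rintro ⟨⟨l, hl, rfl⟩, h⟩
        refine ⟨l, ?_, rfl⟩
        by_contra h2
        rcases eq_or_lt_of_le (not_lt.1 h2) with h3 | h3
        · subst h3; exact lt_irrefl _ h
        · have := hf k l h3 hl; omega
      · rintro ⟨l, hl, rfl⟩
        exact ⟨⟨l, by omega, rfl⟩, hf l k hl hk⟩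
    rw [this, Finset.card_image_of_injOn, Finset.card_range]
    exact hinj.mono (by intro x hx; simp at hx ⊢; omega)

lemma sum_refl (m : ℕ) (g : ℕ → ℚ) : ∑ k ∈ range m, g (m - k) = ∑ i ∈ Finset.Icc 1 m, g i := by
  refine Finset.sum_nbij' (fun k => m - k) (fun i => m - i) ?_ ?_ ?_ ?_ ?_
  · intro k hk; have := Finset.mem_range.1 hk; exact Finset.mem_Icc.2 (by omega)
  · intro k hk; have := Finset.mem_Icc.1 hk; exact Finset.mem_range.2 (by omega)
  · intro k hk; have := Finset.mem_range.1 hk; change m - (m - k) = k; omega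
  · intro k hk; have := Finset.mem_Icc.1 hk; change m - (m - k) = k; omega
  · intro k hk; rfl

lemma sum_id (m : ℕ) : ∑ k ∈ range m, (k : ℚ) = m * (m - 1) / 2 := by
  induction m with
  | zero => simp
  | succ m ih => rw [Finset.sum_range_succ, ih]; push_cast; ring

lemma Z_of_coh (E : CoComplex K n) {k : ℕ} {t : ℤ} (h : cohomDim E k t = 0) : Z ((CC E).c t) ((k:ℤ) - 1) := by
  cases k with
  | zero => exact Z_zero E h
  | succ k =>
    have e : ((k+1 : ℕ) : ℤ) - 1 = k := by push_cast; ring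
    rw [e]; exact Z_succ E h

lemma sheafH_pos {m : ℕ} (F : FreeComplex K (m+1)) (j k : ℕ) (d t : ℤ) (hj : 0 < j) (hk : j + k = m) (ht : t = -d - (m+1))
    (h : sheafH F j d = 0) : cohomDim (dualCo F) k t = 0 := by
  unfold sheafH at h
  rw [if_neg hj.ne'] at h
  unfold extDim at h
  rw [if_pos (by push_cast; omega)] at h
  have e1 : (((m+1:ℕ) : ℤ) - 1 - j).toNat = k := by push_cast; omega
  have e2 : -d - ((m+1:ℕ) : ℤ) = t := by push_cast; omega
  rw [e1, e2] at h
  exact h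

lemma sheafH_zero {m : ℕ} (F : FreeComplex K (m+1)) (d t : ℤ) (ht : t = -d - (m+1))
    (h : sheafH F 0 d = 0) : cohomDim (dualCo F) m t = 0 ∧ MPieceDim F d ≤ cohomDim (dualCo F) (m+1) t := by
  unfold sheafH at h
  rw [if_pos rfl] at h
  unfold extDim at h
  rw [if_pos (by push_cast; omega), if_pos (by push_cast; omega)] at h
  have e1 : (((m+1:ℕ) : ℤ) - 1).toNat = m := by push_cast; omega
  have e3 : (((m+1:ℕ) : ℤ)).toNat = m + 1 := by omega
  have e2 : -d - ((m+1:ℕ) : ℤ) = t := by push_cast; omega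
  rw [e1, e2, e3] at h
  omega

lemma coeffs {m : ℕ} (hm : 0 < m) (F : FreeComplex K (m+1)) :
    (hilbPoly F).coeff m = (PE (dualCo F)).coeff m ∧
    (hilbPoly F).coeff (m-1) = (m * (m+1)) * (PE (dualCo F)).coeff m - (PE (dualCo F)).coeff (m-1) := by
  have e : ∀ j, (hilbPoly F).coeff j = ∑ i ∈ range (F.len + 1), (-1:ℚ)^i * ∑ p : Fin (F.rk i), (genHilb (m+1) (F.deg i p)).coeff j := by
    intro j
    simp only [hilbPoly, Polynomial.finset_sum_coeff, Polynomial.coeff_C_mul]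
  have e' : ∀ j, (PE (dualCo F)).coeff j = ∑ i ∈ range (F.len + 1), (-1:ℚ)^i * ∑ p : Fin (F.rk i), (genHilb (m+1) (-F.deg i p)).coeff j := by
    intro j
    simp only [PE, Polynomial.finset_sum_coeff, Polynomial.coeff_C_mul]
    rfl
  constructor
  · rw [e, e']; simp only [(genHilb_coeff hm _).1]
  · rw [e, e', e', Finset.mul_sum, ← Finset.sum_sub_distrib]
    refine Finset.sum_congr rfl fun i _ => ?_
    rw [mul_left_comm, ← mul_sub]
    congr 1
    rw [Finset.mul_sum, ← Finset.sum_sub_distrib]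
    refine Finset.sum_congr rfl fun p _ => ?_
    rw [(genHilb_coeff hm _).1, (genHilb_coeff hm _).2, (genHilb_coeff hm _).2]
    push_cast; ring

lemma slope_eq {m : ℕ} (hm : 0 < m) (F : FreeComplex K (m+1)) (hp : 0 < (PE (dualCo F)).coeff m) :
    sheafDeg m F / sheafRank F m * (m * (PE (dualCo F)).coeff m) =
      m * (m+1) / 2 * (PE (dualCo F)).coeff m - (PE (dualCo F)).coeff (m-1) := by
  obtain ⟨h1, h2⟩ := coeffs hm F
  unfold sheafDeg sheafRank
  rw [Polynomial.coeff_sub, Polynomial.coeff_C_mul, (genHilb_coeff hm 0).2, h1, h2]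
  obtain ⟨l, rfl⟩ : ∃ l, m = l + 1 := ⟨m - 1, by omega⟩
  rw [Nat.add_sub_cancel, Nat.factorial_succ]
  have : (l.factorial : ℚ) ≠ 0 := by exact_mod_cast Nat.factorial_ne_zero l
  have hl : ((l:ℚ) + 1) ≠ 0 := by positivity
  have := hp.ne'
  push_cast
  field_simp
  ring

end SB

/-- If `𝓔` is a vector bundle on `ℙ^m` (the sheaf associated to
`coker (F₁ → F₀)`), then its slope `μ(𝓔) = deg 𝓔 / rank 𝓔` satisfies
`-(1/m) Σ_{i=1}^m R_i(𝓔) ≤ μ(𝓔) ≤ -(1/m) Σ_{i=1}^m r_i(𝓔)`, where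
`r_i(𝓔) = sup{d : H^j(𝓔(d-j)) = 0 ∀ j < i}` and
`R_i(𝓔) = inf{d : H^j(𝓔(d-j)) = 0 ∀ j ≥ i}` are the cohomology range of `𝓔`. -/
theorem slope_bounds (K : Type) [Field K] (m : ℕ) (hm : 0 < m)
    (F : FreeComplex K (m + 1)) (hres : IsResolution F)
    (r : ℕ) (hr : 0 < r) (hvb : IsVectorBundle F r)
    (rr RR : ℕ → ℤ)
    (hrr : ∀ i ∈ Finset.Icc 1 m,
      IsGreatest {d : ℤ | ∀ j : ℕ, j < i → sheafH F j (d - j) = 0} (rr i))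
    (hRR : ∀ i ∈ Finset.Icc 1 m,
      IsLeast {d : ℤ | ∀ j : ℕ, i ≤ j → sheafH F j (d - j) = 0} (RR i)) :
    -(1 / (m : ℚ)) * ∑ i ∈ Finset.Icc 1 m, (RR i : ℚ) ≤ sheafDeg m F / sheafRank F m ∧
      sheafDeg m F / sheafRank F m ≤ -(1 / (m : ℚ)) * ∑ i ∈ Finset.Icc 1 m, (rr i : ℚ) := by
  have hp := SB.rank_pos hm F hres hr hvb
  have hslope := SB.slope_eq hm F hp
  have hhi := SB.high_van F hres hr hvb
  have hm0 : (0:ℚ) < m := by exact_mod_cast hm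
  have hmp := mul_pos hm0 hp
  have hRa : ∀ i i', 1 ≤ i → i ≤ i' → i' ≤ m → RR i' ≤ RR i := by
    intro i i' h1 h2 h3
    refine (hRR i' (Finset.mem_Icc.2 (by omega))).2 ?_
    intro j hj
    exact (hRR i (Finset.mem_Icc.2 (by omega))).1 j (by omega)
  have hra : ∀ i i', 1 ≤ i → i ≤ i' → i' ≤ m → rr i' ≤ rr i := by
    intro i i' h1 h2 h3
    refine (hrr i (Finset.mem_Icc.2 (by omega))).2 ?_
    intro j hj
    exact (hrr i' (Finset.mem_Icc.2 (by omega))).1 j (by omega)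
  constructor
  · obtain ⟨S, hS, hsum, hz⟩ := SB.anti_set m (fun k => -RR (m-k) - 1 - k) (by
      intro k l hkl hl
      have := hRa (m-l) (m-k) (by omega) (by omega) (by omega)
      change -RR (m-l) - 1 - l < -RR (m-k) - 1 - k
      omega)
    have hc := (SB.core hm (dualCo F) hhi S hS).1 (by
      intro z hzS
      obtain ⟨k, hk, hzk, hcard⟩ := hz z hzS
      rw [hcard]
      apply SB.Z_of_coh
      have h1 := (hRR (m-k) (Finset.mem_Icc.2 (by omega))).1 (m-k) le_rfl
      refine SB.sheafH_pos F (m-k) k _ z (by omega) (by omega) ?_ h1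
      rw [hzk]; omega)
    rw [hsum] at hc
    have hs : ∑ k ∈ range m, ((-RR (m-k) - 1 - k : ℤ) : ℚ) = - ∑ i ∈ Finset.Icc 1 m, (RR i : ℚ) - m * (m+1)/2 := by
      push_cast
      rw [Finset.sum_sub_distrib, Finset.sum_sub_distrib, Finset.sum_neg_distrib, SB.sum_refl m (fun i => (RR i : ℚ)), SB.sum_id]
      simp; ring
    rw [hs] at hc
    rw [← mul_le_mul_iff_left₀ hmp, hslope]
    have : -(1 / (m : ℚ)) * (∑ i ∈ Finset.Icc 1 m, (RR i : ℚ)) * (m * (SB.PE (dualCo F)).coeff m) =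
      - (∑ i ∈ Finset.Icc 1 m, (RR i : ℚ)) * (SB.PE (dualCo F)).coeff m := by field_simp
    rw [this]
    linarith
  · obtain ⟨S, hS, hsum, hz⟩ := SB.anti_set m (fun k => -rr (m-k) - 2 - k) (by
      intro k l hkl hl
      have := hra (m-l) (m-k) (by omega) (by omega) (by omega)
      change -rr (m-l) - 2 - l < -rr (m-k) - 2 - k
      omega)
    have hc := (SB.core hm (dualCo F) hhi S hS).2 (by
      intro z hzS
      obtain ⟨k, hk, hzk, hcard⟩ := hz z hzS
      rw [hcard]
      have h1 := (hrr (m-k) (Finset.mem_Icc.2 (by omega))).1 (m-k-1) (by omega)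
      rcases eq_or_ne k (m-1) with hk1 | hk1
      · have e0 : m - k - 1 = 0 := by omega
        rw [e0] at h1
        have hmk : m - k = 1 := by omega
        rw [hmk] at h1 hzk
        obtain ⟨h2, h3⟩ := SB.sheafH_zero F _ z (by rw [hzk]; push_cast; omega) h1
        have hkm : m = k + 1 := by omega
        refine ⟨SB.Z_succ _ (by rw [← hkm]; exact h2), fun _ => ?_⟩
        refine (SB.pair_le F _ z ?_).trans (h3.trans (SB.hd_eq _ m z).ge)
        rw [hzk]; push_cast; omega
      · refine ⟨SB.Z_succ _ ?_, fun h => absurd h hk1⟩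
        refine SB.sheafH_pos F (m-k-1) (k+1) _ z (by omega) (by omega) ?_ h1
        rw [hzk]; omega)
    rw [hsum] at hc
    have hs : ∑ k ∈ range m, ((-rr (m-k) - 2 - k : ℤ) : ℚ) = - ∑ i ∈ Finset.Icc 1 m, (rr i : ℚ) - m * (m+1)/2 - m := by
      push_cast
      rw [Finset.sum_sub_distrib, Finset.sum_sub_distrib, Finset.sum_neg_distrib, SB.sum_refl m (fun i => (rr i : ℚ)), SB.sum_id]
      simp; ring
    rw [hs] at hc
    rw [← mul_le_mul_iff_left₀ hmp, hslope]
    have : -(1 / (m : ℚ)) * (∑ i ∈ Finset.Icc 1 m, (rr i : ℚ)) * (m * (SB.PE (dualCo F)).coeff m) =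
      - (∑ i ∈ Finset.Icc 1 m, (rr i : ℚ)) * (SB.PE (dualCo F)).coeff m := by field_simp
    rw [this]
    linarith

end
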